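/- arXiv:2502.08457 — 6 statements merged into one kernel-verified Lean document; each statement's English description precedes it below -/
import Mathlib

section
/- The value function F(ω) := L_out(ω, h⋆_ω) is differentiable on ℝ^d, and for every ω ∈ ℝ^d its gradient is ∇F(ω) = E_Q[∂_ω ℓ_out(ω, h⋆_ω(x), y)] + E_P[∂²_{ω,v} ℓ_in(ω, h⋆_ω(x), y) · a⋆_ω(x)], where the adjoint function a⋆_ω ∈ H is the unique minimizer over H of the strongly convex quadratic objective a ↦ L_adj(ω, a) := (1/2) E_P[∂²_v ℓ_in(ω, h⋆_ω(x), y) a(x)²] + E_Q[∂_v ℓ_out(ω, h⋆_ω(x), y) a(x)] + (λ/2)‖a‖²_H. -/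
open MeasureTheory ContinuousLinearMap
open scoped RealInnerProductSpace BigOperators

/-- `ℝ^n` as a Euclidean space. -/
abbrev Euc (n : ℕ) : Type := EuclideanSpace ℝ (Fin n)

/-- A function `g` of a variable `p` and a parameter `y`, of class `C²` in `p`, with `g` and its
first derivative jointly continuous and its second derivative locally bounded. -/
structure ParamC2 {E W : Type*} [NormedAddCommGroup E] [NormedSpace ℝ E] [TopologicalSpace W]
    (g : E → W → ℝ) : Prop where
  contDiff : ∀ y, ContDiff ℝ 2 fun p => g p y
  continuous : Continuous fun z : E × W => g z.1 z.2
  continuous_fderiv : Continuous fun z : E × W => fderiv ℝ (fun p => g p z.2) z.1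
  exists_bound : ∃ B : E × W → ℝ, Continuous B ∧
    ∀ z : E × W, ‖fderiv ℝ (fderiv ℝ fun p => g p z.2) z.1‖ ≤ B z

section ParamC2

variable {E W : Type*} [NormedAddCommGroup E] [NormedSpace ℝ E] [TopologicalSpace W]

lemma norm_fderiv_fderiv_eq_norm_iteratedFDeriv (f : E → ℝ) (p : E) :
    ‖fderiv ℝ (fderiv ℝ f) p‖ = ‖iteratedFDeriv ℝ 2 f p‖ := by
  rw [← norm_iteratedFDeriv_fderiv, ← norm_iteratedFDeriv_fderiv, norm_iteratedFDeriv_zero]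

lemma continuous_of_continuous_iteratedFDeriv_zero {f : E → W → ℝ}
    (h : Continuous fun z : E × W => iteratedFDeriv ℝ 0 (fun p => f p z.2) z.1) :
    Continuous fun z : E × W => f z.1 z.2 := by
  have := (ContinuousMultilinearMap.apply ℝ (fun _ : Fin 0 => E) ℝ ![]).continuous.comp h
  simpa [Function.comp_def] using this

lemma continuous_fderiv_apply_of_iteratedFDeriv_one {f : E → W → ℝ}
    (h : Continuous fun z : E × W => iteratedFDeriv ℝ 1 (fun p => f p z.2) z.1) (e : E) :
    Continuous fun z : E × W => fderiv ℝ (fun p => f p z.2) z.1 e := by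
  have := (ContinuousMultilinearMap.apply ℝ (fun _ : Fin 1 => E) ℝ ![e]).continuous.comp h
  simpa [Function.comp_def, iteratedFDeriv_one_apply] using this

lemma continuous_fderiv_fderiv_apply_of_iteratedFDeriv_two {f : E → W → ℝ}
    (h : Continuous fun z : E × W => iteratedFDeriv ℝ 2 (fun p => f p z.2) z.1) (e e' : E) :
    Continuous fun z : E × W => fderiv ℝ (fderiv ℝ fun p => f p z.2) z.1 e e' := by
  have := (ContinuousMultilinearMap.apply ℝ (fun _ : Fin 2 => E) ℝ ![e, e']).continuous.comp h
  simpa [Function.comp_def, iteratedFDeriv_two_apply] using this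

lemma ParamC2.of_iteratedFDeriv [FiniteDimensional ℝ E] {f : E → W → ℝ}
    (hC : ∀ y, ContDiff ℝ 3 fun p => f p y)
    (hj : ∀ i : ℕ, i ≤ 3 → Continuous fun z : E × W =>
      iteratedFDeriv ℝ i (fun p => f p z.2) z.1) : ParamC2 f where
  contDiff y := (hC y).of_le (by norm_num)
  continuous := continuous_of_continuous_iteratedFDeriv_zero (hj 0 (by norm_num))
  continuous_fderiv := continuous_clm_apply.2 fun e =>
    continuous_fderiv_apply_of_iteratedFDeriv_one (hj 1 (by norm_num)) e
  exists_bound := ⟨_, (hj 2 (by norm_num)).norm, fun _ =>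
    (norm_fderiv_fderiv_eq_norm_iteratedFDeriv _ _).le⟩

lemma ParamC2.fderiv_apply_of_iteratedFDeriv [FiniteDimensional ℝ E] {f : E → W → ℝ}
    (hC : ∀ y, ContDiff ℝ 3 fun p => f p y)
    (hj : ∀ i : ℕ, i ≤ 3 → Continuous fun z : E × W =>
      iteratedFDeriv ℝ i (fun p => f p z.2) z.1) (e : E) :
    ParamC2 fun p y => fderiv ℝ (fun p => f p y) p e := by
  have hD (y : W) : ContDiff ℝ 2 (fderiv ℝ fun p => f p y) :=
    (hC y).fderiv_right (by norm_num)
  refine ⟨fun y => (hD y).clm_apply contDiff_const,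
    continuous_fderiv_apply_of_iteratedFDeriv_one (hj 1 (by norm_num)) e,
    continuous_clm_apply.2 fun e' => ?_,
    ⟨_, ((hj 3 le_rfl).norm.const_mul ‖e‖), fun z => ?_⟩⟩
  · have := continuous_fderiv_fderiv_apply_of_iteratedFDeriv_two (hj 2 (by norm_num)) e' e
    refine this.congr fun z => ?_
    have hd : DifferentiableAt ℝ (fderiv ℝ fun p => f p z.2) z.1 :=
      ((hD z.2).differentiable (by norm_num)) _
    simp [fderiv_clm_apply hd (differentiableAt_const e)]
  · rw [norm_fderiv_fderiv_eq_norm_iteratedFDeriv]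
    refine (norm_iteratedFDeriv_clm_apply_const (N := 2) (hD z.2).contDiffAt le_rfl).trans_eq ?_
    rw [norm_iteratedFDeriv_fderiv]

/-- Uniform Lipschitz and second order Taylor estimates on bounded sets. -/
lemma ParamC2.exists_taylor_bound [FiniteDimensional ℝ E] {g : E → W → ℝ} (hg : ParamC2 g)
    {Y : Set W} (hY : IsCompact Y) (R : ℝ) :
    ∃ C, 0 ≤ C ∧ ∀ p p' : E, ‖p‖ ≤ R → ‖p'‖ ≤ R → ∀ y ∈ Y,
      |g p' y - g p y| ≤ C * ‖p' - p‖ ∧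
      |g p' y - g p y - fderiv ℝ (fun p => g p y) p (p' - p)| ≤ C * ‖p' - p‖ ^ 2 := by
  have hK : IsCompact (Metric.closedBall (0 : E) R ×ˢ Y) :=
    (isCompact_closedBall _ _).prod hY
  obtain ⟨C₁, hC₁⟩ := hK.exists_bound_of_continuousOn hg.continuous_fderiv.continuousOn
  obtain ⟨B, hB, hB'⟩ := hg.exists_bound
  obtain ⟨C₂, hC₂⟩ := hK.exists_bound_of_continuousOn hB.continuousOn
  refine ⟨max (max C₁ C₂) 0, le_max_right _ _, fun p p' hp hp' y hy => ?_⟩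
  set C := max (max C₁ C₂) 0
  have hC0 : 0 ≤ C := le_max_right _ _
  have hmem (r : E) (hr : r ∈ Metric.closedBall (0 : E) R) :
      (r, y) ∈ Metric.closedBall (0 : E) R ×ˢ Y := ⟨hr, hy⟩
  have hp0 : p ∈ Metric.closedBall (0 : E) R := by simpa using hp
  have hp0' : p' ∈ Metric.closedBall (0 : E) R := by simpa using hp'
  have hdiff : Differentiable ℝ fun p => g p y := (hg.contDiff y).differentiable (by norm_num)
  have hdiff' : Differentiable ℝ (fderiv ℝ fun p => g p y) :=
    ((hg.contDiff y).fderiv_right (m := 1) (by norm_num)).differentiable (by norm_num)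
  have hle₁ : C₁ ≤ C := (le_max_left _ _).trans (le_max_left _ _)
  have hle₂ : C₂ ≤ C := (le_max_right _ _).trans (le_max_left _ _)
  have hconv : Convex ℝ (Metric.closedBall (0 : E) R) := convex_closedBall _ _
  constructor
  · exact hconv.norm_image_sub_le_of_norm_fderiv_le (𝕜 := ℝ) (fun r _ => hdiff r)
      (fun r hr => (hC₁ _ (hmem r hr)).trans hle₁) hp0 hp0'
  · have hlip (r : E) (hr : r ∈ segment ℝ p p') :
        ‖fderiv ℝ (fun p => g p y) r - fderiv ℝ (fun p => g p y) p‖ ≤ C * ‖p' - p‖ := by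
      have hr0 := hconv.segment_subset hp0 hp0' hr
      refine (hconv.norm_image_sub_le_of_norm_fderiv_le (𝕜 := ℝ) (fun r _ => hdiff' r)
        (fun r hr => ((hB' (r, y)).trans (le_abs_self _)).trans
          ((hC₂ _ (hmem r hr)).trans hle₂)) hp0 hr0).trans ?_
      gcongr
      exact norm_sub_le_of_mem_segment hr
    have := (convex_segment p p').norm_image_sub_le_of_norm_fderiv_le' (𝕜 := ℝ)
      (fun r _ => hdiff r) hlip (left_mem_segment ℝ p p') (right_mem_segment ℝ p p')
    rw [sq, ← mul_assoc]
    exact this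

end ParamC2

/-- A regularized quadratic functional has a critical point, at which it grows quadratically. -/
lemma exists_regularized_quadratic_min {H : Type*} [NormedAddCommGroup H] [InnerProductSpace ℝ H]
    [CompleteSpace H] (B : H →L[ℝ] H →L[ℝ] ℝ) (hsymm : ∀ a b, B a b = B b a)
    (hpos : ∀ a, 0 ≤ B a a) (L : H →L[ℝ] ℝ) {lam : ℝ} (hlam : 0 < lam) :
    ∃ a : H, (∀ b, B a b + L b + lam * ⟪a, b⟫ = 0) ∧
      ∀ b, (1 / 2 * B a a + L a + lam / 2 * ‖a‖ ^ 2) + lam / 2 * ‖b - a‖ ^ 2 ≤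
        1 / 2 * B b b + L b + lam / 2 * ‖b‖ ^ 2 := by
  let I : H →L[ℝ] H →L[ℝ] ℝ := LinearMap.mkContinuous₂ (innerₗ H) 1 fun a b => by
    simpa using norm_inner_le_norm (𝕜 := ℝ) a b
  have hI (a b : H) : I a b = ⟪a, b⟫ := rfl
  have hcoer : IsCoercive (B + lam • I) := ⟨lam, hlam, fun u => by
    have := hpos u
    simp only [add_apply, smul_apply, hI, smul_eq_mul,
      real_inner_self_eq_norm_sq]
    nlinarith⟩
  set a : H := hcoer.continuousLinearEquivOfBilin.symm
    (-(InnerProductSpace.toDual ℝ H).symm L) with ha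
  have hfoc (b : H) : B a b + L b + lam * ⟪a, b⟫ = 0 := by
    have h := hcoer.continuousLinearEquivOfBilin_apply a b
    rw [ha, ContinuousLinearEquiv.apply_symm_apply, ← ha, inner_neg_left,
      InnerProductSpace.toDual_symm_apply] at h
    simp only [add_apply, smul_apply, hI,
      smul_eq_mul] at h
    linarith
  refine ⟨a, hfoc, fun b => ?_⟩
  have h₁ := hfoc (b - a)
  have h₂ := hpos (b - a)
  have h₃ := hsymm a b
  simp only [map_sub, sub_apply, inner_sub_right,
    real_inner_self_eq_norm_sq] at h₁ h₂
  rw [norm_sub_sq_real, real_inner_comm]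
  linarith

lemma abs_inner_feature_le {H X : Type*} [NormedAddCommGroup H] [InnerProductSpace ℝ H]
    {φ : X → H} {K : ℝ} (hφ : ∀ x, ‖φ x‖ ≤ K) (h : H) (x : X) :
    |⟪h, φ x⟫| ≤ K * ‖h‖ := by
  refine (abs_real_inner_le_norm _ _).trans ?_
  rw [mul_comm]
  gcongr
  exact hφ x

section Feature

variable {H X W : Type*} [NormedAddCommGroup H] [InnerProductSpace ℝ H]
  [MeasurableSpace X] [MeasurableSpace H] [BorelSpace H]
  [TopologicalSpace W] [SecondCountableTopology W] [MeasurableSpace W] [BorelSpace W]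

lemma integrable_comp_feature {V : Type*} [NormedAddCommGroup V] {φ : X → H}
    (hφm : Measurable φ) {K : ℝ} (hφ : ∀ x, ‖φ x‖ ≤ K) {Y : Set W} (hY : IsCompact Y)
    {μ : Measure (X × W)} [IsFiniteMeasure μ] (hμ : ∀ᵐ p ∂μ, p.2 ∈ Y)
    {F : (ℝ × ℝ × ℝ) × W → V} (hF : Continuous F) (h a b : H) :
    Integrable (fun p : X × W =>
      F ((⟪h, φ p.1⟫, ⟪a, φ p.1⟫, ⟪b, φ p.1⟫), p.2)) μ := by
  have hm (h : H) : Measurable fun p : X × W => ⟪h, φ p.1⟫ :=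
    (innerSL ℝ h).continuous.measurable.comp (hφm.comp measurable_fst)
  have hcomp : IsCompact ((Metric.closedBall (0 : ℝ) (K * ‖h‖) ×ˢ
      Metric.closedBall (0 : ℝ) (K * ‖a‖) ×ˢ Metric.closedBall (0 : ℝ) (K * ‖b‖)) ×ˢ Y) :=
    ((isCompact_closedBall _ _).prod
      ((isCompact_closedBall _ _).prod (isCompact_closedBall _ _))).prod hY
  obtain ⟨C, hC⟩ := hcomp.exists_bound_of_continuousOn hF.continuousOn
  refine Integrable.of_bound ?_ C ?_
  · exact (hF.stronglyMeasurable.comp_measurable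
      (((hm h).prodMk ((hm a).prodMk (hm b))).prodMk measurable_snd)).aestronglyMeasurable
  · filter_upwards [hμ] with p hp
    refine hC _ ⟨⟨?_, ?_, ?_⟩, hp⟩ <;>
    simpa using abs_inner_feature_le hφ _ p.1

/-- Integrated second order expansion of `(ω, h) ↦ ∫ g (ω, h(x), y) (b + a(x))`. -/
lemma ParamC2.exists_integral_taylor_bound {E : Type*} [NormedAddCommGroup E] [NormedSpace ℝ E]
    [FiniteDimensional ℝ E] {g : E × ℝ → W → ℝ} (hg : ParamC2 g) {φ : X → H}
    (hφm : Measurable φ) {K : ℝ} (hK : 0 ≤ K) (hφ : ∀ x, ‖φ x‖ ≤ K) {Y : Set W}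
    (hY : IsCompact Y) {μ : Measure (X × W)} [IsProbabilityMeasure μ]
    (hμ : ∀ᵐ p ∂μ, p.2 ∈ Y) (b : ℝ) (a : H) (R : ℝ) :
    ∃ C, 0 ≤ C ∧ ∀ (ω ω' : E) (h h' : H), ‖ω‖ ≤ R → ‖ω'‖ ≤ R → ‖h‖ ≤ R → ‖h'‖ ≤ R →
      |(∫ p, g (ω', ⟪h', φ p.1⟫) p.2 * (b + ⟪a, φ p.1⟫) ∂μ) -
        (∫ p, g (ω, ⟪h, φ p.1⟫) p.2 * (b + ⟪a, φ p.1⟫) ∂μ) -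
        ∫ p, fderiv ℝ (fun r => g r p.2) (ω, ⟪h, φ p.1⟫) (ω' - ω, ⟪h' - h, φ p.1⟫) *
          (b + ⟪a, φ p.1⟫) ∂μ| ≤ C * (‖ω' - ω‖ + ‖h' - h‖) ^ 2 := by
  obtain ⟨C, hC0, hC⟩ := hg.exists_taylor_bound hY (max R (K * R))
  refine ⟨C * (1 + K) ^ 2 * (|b| + K * ‖a‖), by positivity, fun ω ω' h h' hω hω' hh hh' => ?_⟩
  have hc := hg.continuous
  have hcd := hg.continuous_fderiv
  have hi₁ : Integrable (fun p : X × W => g (ω', ⟪h', φ p.1⟫) p.2 * (b + ⟪a, φ p.1⟫)) μ :=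
    integrable_comp_feature hφm hφ hY hμ
      (F := fun z => g (ω', z.1.1) z.2 * (b + z.1.2.1))
      ((hc.comp (f := fun z : (ℝ × ℝ × ℝ) × W => ((ω', z.1.1), z.2)) (by fun_prop)).mul
        (by fun_prop)) h' a 0
  have hi₂ : Integrable (fun p : X × W => g (ω, ⟪h, φ p.1⟫) p.2 * (b + ⟪a, φ p.1⟫)) μ :=
    integrable_comp_feature hφm hφ hY hμ
      (F := fun z => g (ω, z.1.1) z.2 * (b + z.1.2.1))
      ((hc.comp (f := fun z : (ℝ × ℝ × ℝ) × W => ((ω, z.1.1), z.2)) (by fun_prop)).mul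
        (by fun_prop)) h a 0
  have hi₃ : Integrable (fun p : X × W => fderiv ℝ (fun r => g r p.2) (ω, ⟪h, φ p.1⟫)
      (ω' - ω, ⟪h' - h, φ p.1⟫) * (b + ⟪a, φ p.1⟫)) μ :=
    integrable_comp_feature hφm hφ hY hμ
      (F := fun z => fderiv ℝ (fun r => g r z.2) (ω, z.1.1) (ω' - ω, z.1.2.1) * (b + z.1.2.2))
      (((hcd.comp (f := fun z : (ℝ × ℝ × ℝ) × W => ((ω, z.1.1), z.2)) (by fun_prop)).clm_apply
        (by fun_prop)).mul (by fun_prop)) h (h' - h) a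
  have hi₁₂ : Integrable (fun p : X × W => g (ω', ⟪h', φ p.1⟫) p.2 * (b + ⟪a, φ p.1⟫) -
      g (ω, ⟪h, φ p.1⟫) p.2 * (b + ⟪a, φ p.1⟫)) μ := hi₁.sub hi₂
  rw [← integral_sub hi₁ hi₂, ← integral_sub hi₁₂ hi₃]
  have hnorm (ω : E) (h : H) (x : X) (hω : ‖ω‖ ≤ R) (hh : ‖h‖ ≤ R) :
      ‖((ω, ⟪h, φ x⟫) : E × ℝ)‖ ≤ max R (K * R) := by
    rw [Prod.norm_def]
    refine max_le_max hω ((abs_inner_feature_le hφ h x).trans ?_)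
    gcongr
  rw [← Real.norm_eq_abs]
  refine (norm_integral_le_of_norm_le_const (μ := μ)
    (C := C * (1 + K) ^ 2 * (|b| + K * ‖a‖) * (‖ω' - ω‖ + ‖h' - h‖) ^ 2) ?_).trans_eq ?_
  swap
  · simp
  filter_upwards [hμ] with p hp
  have ht := (hC _ _ (hnorm ω h p.1 hω hh) (hnorm ω' h' p.1 hω' hh') p.2 hp).2
  have hsub : ((ω', ⟪h', φ p.1⟫) : E × ℝ) - (ω, ⟪h, φ p.1⟫) = (ω' - ω, ⟪h' - h, φ p.1⟫) := by
    simp [inner_sub_left]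
  rw [hsub] at ht
  have hle : ‖((ω' - ω, ⟪h' - h, φ p.1⟫) : E × ℝ)‖ ≤ (1 + K) * (‖ω' - ω‖ + ‖h' - h‖) := by
    rw [Prod.norm_def]
    refine max_le ?_ ((abs_inner_feature_le hφ (h' - h) p.1).trans ?_) <;>
    nlinarith [norm_nonneg (ω' - ω), norm_nonneg (h' - h),
      mul_nonneg hK (norm_nonneg (ω' - ω)), mul_nonneg hK (norm_nonneg (h' - h))]
  have hw : |b + ⟪a, φ p.1⟫| ≤ |b| + K * ‖a‖ :=
    (abs_add_le _ _).trans (by gcongr; exact abs_inner_feature_le hφ a p.1)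
  rw [← sub_mul, ← sub_mul, norm_mul, Real.norm_eq_abs, Real.norm_eq_abs]
  calc _ ≤ C * ((1 + K) * (‖ω' - ω‖ + ‖h' - h‖)) ^ 2 * (|b| + K * ‖a‖) := by
        gcongr
        exact ht.trans (by gcongr)
    _ = _ := by ring

lemma exists_clm_integral {φ : X → H} (hφm : Measurable φ) {K : ℝ} (hφ : ∀ x, ‖φ x‖ ≤ K)
    {Y : Set W} (hY : IsCompact Y) {μ : Measure (X × W)} [IsFiniteMeasure μ]
    (hμ : ∀ᵐ p ∂μ, p.2 ∈ Y) {T : ℝ × W → ℝ} (hT : Continuous T) (h : H) :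
    ∃ L : H →L[ℝ] ℝ, ∀ a, L a = ∫ p, T (⟪h, φ p.1⟫, p.2) * ⟪a, φ p.1⟫ ∂μ := by
  have hi (a : H) : Integrable (fun p : X × W => T (⟪h, φ p.1⟫, p.2) * ⟪a, φ p.1⟫) μ :=
    integrable_comp_feature hφm hφ hY hμ
      (F := fun z => T (z.1.1, z.2) * z.1.2.1) (by fun_prop) h a 0
  have hiT : Integrable (fun p : X × W => T (⟪h, φ p.1⟫, p.2)) μ :=
    integrable_comp_feature hφm hφ hY hμ
      (F := fun z => T (z.1.1, z.2)) (by fun_prop) h 0 0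
  refine ⟨LinearMap.mkContinuous
    { toFun := fun a => ∫ p, T (⟪h, φ p.1⟫, p.2) * ⟪a, φ p.1⟫ ∂μ
      map_add' := fun a a' => ?_
      map_smul' := fun c a => ?_ } ((∫ p, |T (⟪h, φ p.1⟫, p.2)| ∂μ) * K) fun a => ?_,
    fun a => rfl⟩
  · rw [← integral_add (hi a) (hi a')]
    simp [inner_add_left, mul_add]
  · simp only [real_inner_smul_left, smul_eq_mul, RingHom.id_apply]
    rw [← integral_const_mul]
    congr with p
    ring
  · change ‖∫ p, T (⟪h, φ p.1⟫, p.2) * ⟪a, φ p.1⟫ ∂μ‖ ≤ _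
    rw [mul_assoc, ← integral_mul_const]
    refine norm_integral_le_of_norm_le (hiT.abs.mul_const _) (.of_forall fun p => ?_)
    rw [norm_mul]
    exact mul_le_mul_of_nonneg_left (abs_inner_feature_le hφ a p.1) (abs_nonneg _)

lemma exists_bilin_integral {φ : X → H} (hφm : Measurable φ) {K : ℝ} (hφ : ∀ x, ‖φ x‖ ≤ K)
    {Y : Set W} (hY : IsCompact Y) {μ : Measure (X × W)} [IsFiniteMeasure μ]
    (hμ : ∀ᵐ p ∂μ, p.2 ∈ Y) {G : ℝ × W → ℝ} (hG : Continuous G) (h : H) :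
    ∃ B : H →L[ℝ] H →L[ℝ] ℝ,
      ∀ a b, B a b = ∫ p, G (⟪h, φ p.1⟫, p.2) * ⟪a, φ p.1⟫ * ⟪b, φ p.1⟫ ∂μ := by
  have hi (a b : H) :
      Integrable (fun p : X × W => G (⟪h, φ p.1⟫, p.2) * ⟪a, φ p.1⟫ * ⟪b, φ p.1⟫) μ :=
    integrable_comp_feature hφm hφ hY hμ
      (F := fun z => G (z.1.1, z.2) * z.1.2.1 * z.1.2.2) (by fun_prop) h a b
  have hiG : Integrable (fun p : X × W => G (⟪h, φ p.1⟫, p.2)) μ :=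
    integrable_comp_feature hφm hφ hY hμ
      (F := fun z => G (z.1.1, z.2)) (by fun_prop) h 0 0
  refine ⟨LinearMap.mkContinuous₂ (LinearMap.mk₂ ℝ
    (fun a b => ∫ p, G (⟪h, φ p.1⟫, p.2) * ⟪a, φ p.1⟫ * ⟪b, φ p.1⟫ ∂μ) ?_ ?_ ?_ ?_)
    ((∫ p, |G (⟪h, φ p.1⟫, p.2)| ∂μ) * (K * K)) fun a b => ?_, fun a b => rfl⟩
  · intro a a' b
    rw [← integral_add (hi a b) (hi a' b)]
    simp [inner_add_left, mul_add, add_mul]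
  · intro c a b
    simp only [real_inner_smul_left, smul_eq_mul]
    rw [← integral_const_mul]
    congr with p
    ring
  · intro a b b'
    rw [← integral_add (hi a b) (hi a b')]
    simp [inner_add_left, mul_add]
  · intro c a b
    simp only [real_inner_smul_left, smul_eq_mul]
    rw [← integral_const_mul]
    congr with p
    ring
  · change ‖∫ p, G (⟪h, φ p.1⟫, p.2) * ⟪a, φ p.1⟫ * ⟪b, φ p.1⟫ ∂μ‖ ≤ _
    rw [mul_assoc, mul_assoc, ← integral_mul_const]
    refine norm_integral_le_of_norm_le (hiG.abs.mul_const _) (.of_forall fun p => ?_)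
    rw [mul_assoc, norm_mul, norm_mul]
    have ha := abs_inner_feature_le hφ a p.1
    have hb := abs_inner_feature_le hφ b p.1
    calc |G (⟪h, φ p.1⟫, p.2)| * (|⟪a, φ p.1⟫| * |⟪b, φ p.1⟫|)
        ≤ |G (⟪h, φ p.1⟫, p.2)| * ((K * ‖a‖) * (K * ‖b‖)) := by
          gcongr
          exact (abs_nonneg _).trans ha
      _ = _ := by ring

variable {E : Type*} [NormedAddCommGroup E] [NormedSpace ℝ E]

lemma eq_zero_of_linear_add_sq_nonneg {S M : ℝ}
    (h : ∀ t : ℝ, |t| ≤ 1 → 0 ≤ t * S + M * t ^ 2) : S = 0 := by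
  set s : ℝ := 1 / (1 + |S| + |M|) with hs
  have hpos : 0 < 1 + |S| + |M| := by positivity
  have hs0 : 0 < s := by positivity
  have hsmul : s * (1 + |S| + |M|) = 1 := by rw [hs]; field_simp
  have hsS : s * |S| ≤ 1 := by nlinarith [mul_nonneg hs0.le (abs_nonneg M)]
  have hsM : s * M < 1 := by
    nlinarith [mul_nonneg hs0.le (abs_nonneg S), mul_le_mul_of_nonneg_left (le_abs_self M) hs0.le]
  have h1 := h (-(s * S)) (by rw [abs_neg, abs_mul, abs_of_pos hs0]; exact hsS)
  have h2 : s * (1 - s * M) * S ^ 2 ≤ 0 := by nlinarith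
  have h3 : 0 < s * (1 - s * M) := mul_pos hs0 (by linarith)
  exact pow_eq_zero_iff two_ne_zero |>.1 (le_antisymm (by nlinarith) (sq_nonneg S))

/-- First order optimality condition for the regularized risk. -/
lemma ParamC2.integral_fderiv_add_inner_eq_zero [FiniteDimensional ℝ E] {f : E × ℝ → W → ℝ}
    (hf : ParamC2 f) {φ : X → H}
    (hφm : Measurable φ) {K : ℝ} (hK : 0 ≤ K) (hφ : ∀ x, ‖φ x‖ ≤ K) {Y : Set W}
    (hY : IsCompact Y) {P : Measure (X × W)} [IsProbabilityMeasure P]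
    (hP : ∀ᵐ p ∂P, p.2 ∈ Y) {lam : ℝ} {ω : E} {h : H}
    (hmin : ∀ h' : H, (∫ p, f (ω, ⟪h, φ p.1⟫) p.2 ∂P) + lam / 2 * ‖h‖ ^ 2 ≤
      (∫ p, f (ω, ⟪h', φ p.1⟫) p.2 ∂P) + lam / 2 * ‖h'‖ ^ 2) (a : H) :
    (∫ p, fderiv ℝ (fun r => f r p.2) (ω, ⟪h, φ p.1⟫) (0, 1) * ⟪a, φ p.1⟫ ∂P) +
      lam * ⟪h, a⟫ = 0 := by
  obtain ⟨C, -, hC⟩ := hf.exists_integral_taylor_bound hφm hK hφ hY hP 1 0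
    (max ‖ω‖ (‖h‖ + ‖a‖))
  refine eq_zero_of_linear_add_sq_nonneg (M := (C + lam / 2) * ‖a‖ ^ 2) fun t ht => ?_
  have hta : ‖h + t • a‖ ≤ ‖h‖ + ‖a‖ := (norm_add_le _ _).trans (by
    rw [norm_smul]
    gcongr
    exact mul_le_of_le_one_left (norm_nonneg _) ht)
  have h1 := hC ω ω h (h + t • a) (le_max_left _ _) (le_max_left _ _)
    ((le_add_of_nonneg_right (norm_nonneg _)).trans (le_max_right _ _))
    (hta.trans (le_max_right _ _))
  have h2 := hmin (h + t • a)
  have hlin : (∫ p, fderiv ℝ (fun r => f r p.2) (ω, ⟪h, φ p.1⟫) (0, t * ⟪a, φ p.1⟫) ∂P) =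
      t * ∫ p, fderiv ℝ (fun r => f r p.2) (ω, ⟪h, φ p.1⟫) (0, 1) * ⟪a, φ p.1⟫ ∂P := by
    rw [← integral_const_mul]
    congr with p
    rw [show ((0 : E), t * ⟪a, φ p.1⟫) = (t * ⟪a, φ p.1⟫) • ((0 : E), (1 : ℝ)) by simp, map_smul,
      smul_eq_mul]
    ring
  simp only [inner_zero_left, add_zero, mul_one, sub_self, norm_zero, zero_add,
    add_sub_cancel_left, real_inner_smul_left, hlin, norm_smul, mul_pow, Real.norm_eq_abs,
    sq_abs] at h1
  rw [norm_add_sq_real, norm_smul, mul_pow, Real.norm_eq_abs, sq_abs, real_inner_smul_right] at h2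
  have h3 := (abs_le.1 h1).2
  linarith

/-- The regularized solution map is locally Lipschitz at every point. -/
lemma ParamC2.exists_norm_sub_le [FiniteDimensional ℝ E] {g : E × ℝ → W → ℝ} (hg : ParamC2 g)
    (hmono : ∀ ω v v' y, 0 ≤ (g (ω, v') y - g (ω, v) y) * (v' - v)) {φ : X → H}
    (hφm : Measurable φ) {K : ℝ} (hK : 0 ≤ K) (hφ : ∀ x, ‖φ x‖ ≤ K) {Y : Set W}
    (hY : IsCompact Y) {P : Measure (X × W)} [IsProbabilityMeasure P]
    (hP : ∀ᵐ p ∂P, p.2 ∈ Y) {lam : ℝ} (hlam : 0 < lam) {hstar : E → H}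
    (hfoc : ∀ ω a, (∫ p, g (ω, ⟪hstar ω, φ p.1⟫) p.2 * ⟪a, φ p.1⟫ ∂P) +
      lam * ⟪hstar ω, a⟫ = 0) (ω : E) :
    ∃ L, 0 ≤ L ∧ ∀ ω', ‖ω' - ω‖ ≤ 1 → ‖hstar ω' - hstar ω‖ ≤ L * ‖ω' - ω‖ := by
  obtain ⟨C, hC0, hC⟩ := hg.exists_taylor_bound hY (max (‖ω‖ + 1) (K * ‖hstar ω‖))
  refine ⟨C * K / lam, by positivity, fun ω' hω' => ?_⟩
  set δ := hstar ω' - hstar ω with hδ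
  have hω'n : ‖ω'‖ ≤ ‖ω‖ + 1 := by
    have := norm_add_le ω (ω' - ω)
    rw [add_sub_cancel] at this
    linarith
  have hi (ω : E) (h : H) : Integrable (fun p : X × W => g (ω, ⟪h, φ p.1⟫) p.2 * ⟪δ, φ p.1⟫) P :=
    integrable_comp_feature hφm hφ hY hP
      (F := fun z => g (ω, z.1.1) z.2 * z.1.2.1)
      ((hg.continuous.comp (f := fun z : (ℝ × ℝ × ℝ) × W => ((ω, z.1.1), z.2))
        (by fun_prop)).mul (by fun_prop)) h δ 0
  have h1 := hfoc ω δ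
  have h2 := hfoc ω' δ
  have hdiff : -(C * ‖ω' - ω‖ * (K * ‖δ‖)) ≤
      (∫ p, g (ω', ⟪hstar ω', φ p.1⟫) p.2 * ⟪δ, φ p.1⟫ ∂P) -
        ∫ p, g (ω, ⟪hstar ω, φ p.1⟫) p.2 * ⟪δ, φ p.1⟫ ∂P := by
    rw [← integral_sub (hi _ _) (hi _ _)]
    have hconst : -(C * ‖ω' - ω‖ * (K * ‖δ‖)) = ∫ _ : X × W, -(C * ‖ω' - ω‖ * (K * ‖δ‖)) ∂P := by
      simp
    rw [hconst]
    refine integral_mono_ae (integrable_const _) ((hi _ _).sub (hi _ _)) ?_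
    filter_upwards [hP] with p hp
    have hm := hmono ω' ⟪hstar ω, φ p.1⟫ ⟪hstar ω', φ p.1⟫ p.2
    rw [← inner_sub_left, ← hδ] at hm
    have hv := abs_inner_feature_le hφ (hstar ω) p.1
    have ht := (hC (ω, ⟪hstar ω, φ p.1⟫) (ω', ⟪hstar ω, φ p.1⟫)
      (max_le_max (by simp) hv) (max_le_max hω'n hv) p.2 hp).1
    have hnorm : ‖((ω', ⟪hstar ω, φ p.1⟫) : E × ℝ) - (ω, ⟪hstar ω, φ p.1⟫)‖ = ‖ω' - ω‖ := by
      simp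
    rw [hnorm] at ht
    have hprod := mul_le_mul ht (abs_inner_feature_le hφ δ p.1) (abs_nonneg _) (by positivity)
    rw [← abs_mul] at hprod
    have := (abs_le.1 hprod).1
    linarith
  have h3 : lam * ‖δ‖ ^ 2 ≤ C * ‖ω' - ω‖ * (K * ‖δ‖) := by
    have h4 : ⟪hstar ω', δ⟫ - ⟪hstar ω, δ⟫ = ‖δ‖ ^ 2 := by
      rw [← inner_sub_left, ← hδ, real_inner_self_eq_norm_sq]
    rw [← h4]
    linarith
  rcases (norm_nonneg δ).eq_or_lt with h0 | h0
  · rw [← h0]; positivity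
  · rw [div_mul_eq_mul_div, le_div_iff₀ hlam]
    nlinarith

/-- Second order expansion of the value function, with the derivative given by the adjoint. -/
lemma ParamC2.exists_value_expansion [FiniteDimensional ℝ E] {g k : E × ℝ → W → ℝ}
    (hg : ParamC2 g) (hk : ParamC2 k)
    (hmono : ∀ ω v v' y, 0 ≤ (g (ω, v') y - g (ω, v) y) * (v' - v)) {φ : X → H}
    (hφm : Measurable φ) {K : ℝ} (hK : 0 ≤ K) (hφ : ∀ x, ‖φ x‖ ≤ K) {Y : Set W}
    (hY : IsCompact Y) {P Q : Measure (X × W)} [IsProbabilityMeasure P] [IsProbabilityMeasure Q]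
    (hP : ∀ᵐ p ∂P, p.2 ∈ Y) (hQ : ∀ᵐ p ∂Q, p.2 ∈ Y) {lam : ℝ} (hlam : 0 < lam) {hstar : E → H}
    (hfoc : ∀ ω a, (∫ p, g (ω, ⟪hstar ω, φ p.1⟫) p.2 * ⟪a, φ p.1⟫ ∂P) +
      lam * ⟪hstar ω, a⟫ = 0) (ω : E) {a : H}
    (ha : ∀ b : H, (∫ p, fderiv ℝ (fun r => g r p.2) (ω, ⟪hstar ω, φ p.1⟫) (0, 1) *
        ⟪a, φ p.1⟫ * ⟪b, φ p.1⟫ ∂P) +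
      (∫ p, fderiv ℝ (fun r => k r p.2) (ω, ⟪hstar ω, φ p.1⟫) (0, 1) * ⟪b, φ p.1⟫ ∂Q) +
      lam * ⟪a, b⟫ = 0) :
    ∃ C, ∀ ω', ‖ω' - ω‖ ≤ 1 →
      |(∫ p, k (ω', ⟪hstar ω', φ p.1⟫) p.2 ∂Q) - (∫ p, k (ω, ⟪hstar ω, φ p.1⟫) p.2 ∂Q) -
        ((∫ p, fderiv ℝ (fun r => k r p.2) (ω, ⟪hstar ω, φ p.1⟫) (ω' - ω, 0) ∂Q) +
          ∫ p, ⟪a, φ p.1⟫ *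
            fderiv ℝ (fun r => g r p.2) (ω, ⟪hstar ω, φ p.1⟫) (ω' - ω, 0) ∂P)| ≤
        C * ‖ω' - ω‖ ^ 2 := by
  obtain ⟨L, hL0, hL⟩ := hg.exists_norm_sub_le hmono hφm hK hφ hY hP hlam hfoc ω
  set R := max (‖ω‖ + 1) (‖hstar ω‖ + L)
  obtain ⟨C₁, hC₁0, hC₁⟩ := hk.exists_integral_taylor_bound hφm hK hφ hY hQ 1 0 R
  obtain ⟨C₂, hC₂0, hC₂⟩ := hg.exists_integral_taylor_bound hφm hK hφ hY hP 0 a R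
  refine ⟨(C₁ + C₂) * (1 + L) ^ 2, fun ω' hω' => ?_⟩
  have hδL := hL ω' hω'
  set δ := hstar ω' - hstar ω with hδ
  have hωR : ‖ω‖ ≤ R := le_max_of_le_left (by linarith)
  have hω'R : ‖ω'‖ ≤ R := by
    have := norm_add_le ω (ω' - ω)
    rw [add_sub_cancel] at this
    exact le_max_of_le_left (by linarith)
  have hhR : ‖hstar ω‖ ≤ R := le_max_of_le_right (by linarith)
  have hh'R : ‖hstar ω'‖ ≤ R := by
    have := norm_add_le (hstar ω) (hstar ω' - hstar ω)
    rw [add_sub_cancel] at this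
    exact le_max_of_le_right (by nlinarith)
  have e₁ := hC₁ ω ω' (hstar ω) (hstar ω') hωR hω'R hhR hh'R
  have e₂ := hC₂ ω ω' (hstar ω) (hstar ω') hωR hω'R hhR hh'R
  have hsplit (A : E × ℝ →L[ℝ] ℝ) (e : E) (s : ℝ) : A (e, s) = A (e, 0) + A (0, 1) * s := by
    rw [show ((e, s) : E × ℝ) = (e, 0) + s • ((0 : E), (1 : ℝ)) by simp, map_add, map_smul,
      smul_eq_mul, mul_comm]
  have hcd {g : E × ℝ → W → ℝ} (hg : ParamC2 g) (e : E × ℝ) :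
      Continuous fun z : (ℝ × ℝ × ℝ) × W => fderiv ℝ (fun r => g r z.2) (ω, z.1.1) e :=
    (hg.continuous_fderiv.comp (f := fun z : (ℝ × ℝ × ℝ) × W => ((ω, z.1.1), z.2))
      (by fun_prop)).clm_apply continuous_const
  simp only [inner_zero_left, add_zero, mul_one, ← hδ, zero_add] at e₁ e₂
  have s₁ : (∫ p, fderiv ℝ (fun r => k r p.2) (ω, ⟪hstar ω, φ p.1⟫) (ω' - ω, ⟪δ, φ p.1⟫) ∂Q) =
      (∫ p, fderiv ℝ (fun r => k r p.2) (ω, ⟪hstar ω, φ p.1⟫) (ω' - ω, 0) ∂Q) +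
      ∫ p, fderiv ℝ (fun r => k r p.2) (ω, ⟪hstar ω, φ p.1⟫) (0, 1) * ⟪δ, φ p.1⟫ ∂Q := by
    rw [← integral_add
      (integrable_comp_feature hφm hφ hY hQ (hcd hk (ω' - ω, 0)) (hstar ω) 0 0)
      (integrable_comp_feature hφm hφ hY hQ
        (F := fun z => fderiv ℝ (fun r => k r z.2) (ω, z.1.1) (0, 1) * z.1.2.1)
        ((hcd hk (0, 1)).mul (by fun_prop)) (hstar ω) δ 0)]
    congr with p
    rw [hsplit]
  have s₂ : (∫ p, fderiv ℝ (fun r => g r p.2) (ω, ⟪hstar ω, φ p.1⟫) (ω' - ω, ⟪δ, φ p.1⟫) *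
        ⟪a, φ p.1⟫ ∂P) =
      (∫ p, ⟪a, φ p.1⟫ * fderiv ℝ (fun r => g r p.2) (ω, ⟪hstar ω, φ p.1⟫) (ω' - ω, 0) ∂P) +
      ∫ p, fderiv ℝ (fun r => g r p.2) (ω, ⟪hstar ω, φ p.1⟫) (0, 1) * ⟪a, φ p.1⟫ *
        ⟪δ, φ p.1⟫ ∂P := by
    rw [← integral_add
      (integrable_comp_feature hφm hφ hY hP
        (F := fun z => z.1.2.1 * fderiv ℝ (fun r => g r z.2) (ω, z.1.1) (ω' - ω, 0))
        (Continuous.mul (by fun_prop) (hcd hg (ω' - ω, 0))) (hstar ω) a 0)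
      (integrable_comp_feature hφm hφ hY hP
        (F := fun z => fderiv ℝ (fun r => g r z.2) (ω, z.1.1) (0, 1) * z.1.2.1 * z.1.2.2)
        (((hcd hg (0, 1)).mul (by fun_prop)).mul (by fun_prop)) (hstar ω) a δ)]
    congr with p
    rw [hsplit]
    ring
  rw [s₁] at e₁
  rw [s₂] at e₂
  have h1 := hfoc ω a
  have h2 := hfoc ω' a
  have h3 := ha δ
  have h4 : ⟪hstar ω', a⟫ - ⟪hstar ω, a⟫ = ⟪a, δ⟫ := by
    rw [← inner_sub_left, ← hδ, real_inner_comm]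
  rw [← h4] at h3
  have hsq : (‖ω' - ω‖ + ‖δ‖) ^ 2 ≤ ((1 + L) * ‖ω' - ω‖) ^ 2 := by
    gcongr
    linarith
  have hsum := mul_le_mul_of_nonneg_left hsq (add_nonneg hC₁0 hC₂0)
  have e₁' := abs_le.1 e₁
  have e₂' := abs_le.1 e₂
  rw [abs_le]
  constructor <;> linarith

end Feature

lemma hasDerivAt_snd_of_differentiable {E : Type*} [NormedAddCommGroup E] [NormedSpace ℝ E]
    {F : E × ℝ → ℝ} (hF : Differentiable ℝ F) (ω : E) (v : ℝ) :
    HasDerivAt (fun v => F (ω, v)) (fderiv ℝ F (ω, v) (0, 1)) v :=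
  (hF (ω, v)).hasFDerivAt.comp_hasDerivAt v ((hasDerivAt_const v ω).prodMk (hasDerivAt_id v))

lemma gradient_fst_of_differentiable {E : Type*} [NormedAddCommGroup E] [InnerProductSpace ℝ E]
    [CompleteSpace E] {F : E × ℝ → ℝ} (hF : Differentiable ℝ F) (ω : E) (v : ℝ) :
    gradient (fun ω => F (ω, v)) ω = (InnerProductSpace.toDual ℝ E).symm
      ((fderiv ℝ F (ω, v)).comp (ContinuousLinearMap.inl ℝ E ℝ)) := by
  have h : HasFDerivAt (fun ω => F (ω, v))
      ((fderiv ℝ F (ω, v)).comp (ContinuousLinearMap.inl ℝ E ℝ)) ω :=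
    (hF (ω, v)).hasFDerivAt.comp ω (hasFDerivAt_prodMk_left ω v)
  rw [gradient, h.fderiv]

lemma hasGradientAt_of_abs_sub_le_sq {E : Type*} [NormedAddCommGroup E] [InnerProductSpace ℝ E]
    [CompleteSpace E] {F : E → ℝ} {G x : E} {C : ℝ}
    (h : ∀ x', ‖x' - x‖ ≤ 1 → |F x' - F x - ⟪G, x' - x⟫| ≤ C * ‖x' - x‖ ^ 2) :
    HasGradientAt F G x := by
  rw [hasGradientAt_iff_hasFDerivAt, hasFDerivAt_iff_isLittleO]
  refine (Asymptotics.IsBigO.of_bound C ?_).trans_isLittleO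
    (Asymptotics.isLittleO_pow_sub_sub x one_lt_two)
  filter_upwards [Metric.closedBall_mem_nhds x one_pos] with x' hx'
  simpa [InnerProductSpace.toDual_apply_apply] using h x' (by simpa [dist_eq_norm] using hx')

/-- Context: `H` a real Hilbert space, `φ : X → H` measurable with
`‖φ x‖² ≤ κ` (so `h(x) := ⟪h, φ x⟫`), `Y ⊆ ℝ^q` compact, `ℓ_in, ℓ_out` of class `C³`
jointly in `(ω, v)` with all partial derivatives up to order three jointly continuous,
`v ↦ ℓ_in(ω, v, y)` convex, `P, Q` probability measures on `X × Y`, `λ > 0`,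
`L_out(ω,h) = E_Q[ℓ_out(ω, h(x), y)]`, `L_in(ω,h) = E_P[ℓ_in(ω, h(x), y)] + (λ/2)‖h‖²`,
and `h⋆_ω` the unique minimizer of `L_in(ω, ·)`.
Conclusion: the value function `F(ω) := L_out(ω, h⋆_ω)` is differentiable on `ℝ^d`
with gradient
`∇F(ω) = E_Q[∂_ω ℓ_out(ω, h⋆_ω(x), y)] + E_P[∂²_{ω,v} ℓ_in(ω, h⋆_ω(x), y) a⋆_ω(x)]`,
where the adjoint `a⋆_ω ∈ H` is the unique minimizer of the strongly convex quadratic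
`a ↦ (1/2) E_P[∂²_v ℓ_in(ω, h⋆_ω(x), y) a(x)²] + E_Q[∂_v ℓ_out(ω, h⋆_ω(x), y) a(x)]
 + (λ/2)‖a‖²`. -/
theorem stmt_3 {d q : ℕ} {H X : Type*}
    [NormedAddCommGroup H] [InnerProductSpace ℝ H] [CompleteSpace H]
    [MeasurableSpace X] [MeasurableSpace H] [BorelSpace H]
    (φ : X → H) (hφm : Measurable φ)
    (κ : ℝ) (hκ : 0 < κ) (hφb : ∀ x : X, ‖φ x‖ ^ 2 ≤ κ)
    (Y : Set (Euc q)) (hY : IsCompact Y)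
    (ℓin ℓout : Euc d → ℝ → Euc q → ℝ)
    (hC3in : ∀ y : Euc q, ContDiff ℝ 3 fun p : Euc d × ℝ => ℓin p.1 p.2 y)
    (hC3out : ∀ y : Euc q, ContDiff ℝ 3 fun p : Euc d × ℝ => ℓout p.1 p.2 y)
    (hjcin : ∀ i : ℕ, i ≤ 3 → Continuous fun p : (Euc d × ℝ) × Euc q =>
      iteratedFDeriv ℝ i (fun r : Euc d × ℝ => ℓin r.1 r.2 p.2) p.1)
    (hjcout : ∀ i : ℕ, i ≤ 3 → Continuous fun p : (Euc d × ℝ) × Euc q =>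
      iteratedFDeriv ℝ i (fun r : Euc d × ℝ => ℓout r.1 r.2 p.2) p.1)
    (hconv : ∀ (ω : Euc d) (y : Euc q), ConvexOn ℝ Set.univ fun v : ℝ => ℓin ω v y)
    (P Q : Measure (X × Euc q)) [IsProbabilityMeasure P] [IsProbabilityMeasure Q]
    (hPY : ∀ᵐ p ∂P, p.2 ∈ Y) (hQY : ∀ᵐ p ∂Q, p.2 ∈ Y)
    (lam : ℝ) (hlam : 0 < lam)
    (hstar : Euc d → H)
    -- `h⋆_ω` is the unique minimizer of `h ↦ L_in(ω, h)` over `H`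
    (hstarMin : ∀ (ω : Euc d) (h : H),
      (∫ p, ℓin ω ⟪hstar ω, φ p.1⟫ p.2 ∂P) + lam / 2 * ‖hstar ω‖ ^ 2 ≤
        (∫ p, ℓin ω ⟪h, φ p.1⟫ p.2 ∂P) + lam / 2 * ‖h‖ ^ 2)
    (hstarUnique : ∀ (ω : Euc d) (h : H),
      (∀ h' : H, (∫ p, ℓin ω ⟪h, φ p.1⟫ p.2 ∂P) + lam / 2 * ‖h‖ ^ 2 ≤
        (∫ p, ℓin ω ⟪h', φ p.1⟫ p.2 ∂P) + lam / 2 * ‖h'‖ ^ 2) → h = hstar ω) :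
    ∀ ω : Euc d, ∃ aStar : H,
      -- `a⋆_ω` is the unique minimizer of the adjoint objective `L_adj(ω, ·)`
      (∀ a : H,
        ((1 / 2) * ∫ p, (deriv (fun v : ℝ => deriv (fun v' : ℝ => ℓin ω v' p.2) v)
              ⟪hstar ω, φ p.1⟫) * ⟪aStar, φ p.1⟫ ^ 2 ∂P) +
          (∫ p, (deriv (fun v : ℝ => ℓout ω v p.2) ⟪hstar ω, φ p.1⟫) * ⟪aStar, φ p.1⟫ ∂Q) +
          lam / 2 * ‖aStar‖ ^ 2 ≤
        ((1 / 2) * ∫ p, (deriv (fun v : ℝ => deriv (fun v' : ℝ => ℓin ω v' p.2) v)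
              ⟪hstar ω, φ p.1⟫) * ⟪a, φ p.1⟫ ^ 2 ∂P) +
          (∫ p, (deriv (fun v : ℝ => ℓout ω v p.2) ⟪hstar ω, φ p.1⟫) * ⟪a, φ p.1⟫ ∂Q) +
          lam / 2 * ‖a‖ ^ 2) ∧
      (∀ a : H,
        (∀ a' : H,
          ((1 / 2) * ∫ p, (deriv (fun v : ℝ => deriv (fun v' : ℝ => ℓin ω v' p.2) v)
                ⟪hstar ω, φ p.1⟫) * ⟪a, φ p.1⟫ ^ 2 ∂P) +
            (∫ p, (deriv (fun v : ℝ => ℓout ω v p.2) ⟪hstar ω, φ p.1⟫) * ⟪a, φ p.1⟫ ∂Q) +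
            lam / 2 * ‖a‖ ^ 2 ≤
          ((1 / 2) * ∫ p, (deriv (fun v : ℝ => deriv (fun v' : ℝ => ℓin ω v' p.2) v)
                ⟪hstar ω, φ p.1⟫) * ⟪a', φ p.1⟫ ^ 2 ∂P) +
            (∫ p, (deriv (fun v : ℝ => ℓout ω v p.2) ⟪hstar ω, φ p.1⟫) * ⟪a', φ p.1⟫ ∂Q) +
            lam / 2 * ‖a'‖ ^ 2) → a = aStar) ∧
      -- differentiability of the value function with the stated gradient
      HasGradientAt (fun ω' : Euc d => ∫ p, ℓout ω' ⟪hstar ω', φ p.1⟫ p.2 ∂Q)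
        ((∫ p, gradient (fun ω' : Euc d => ℓout ω' ⟪hstar ω, φ p.1⟫ p.2) ω ∂Q) +
          ∫ p, ⟪aStar, φ p.1⟫ •
            gradient (fun ω' : Euc d => deriv (fun v : ℝ => ℓin ω' v p.2) ⟪hstar ω, φ p.1⟫) ω ∂P)
        ω := by
  intro ω
  have hK : 0 ≤ √κ := Real.sqrt_nonneg _
  have hφ (x : X) : ‖φ x‖ ≤ √κ := Real.le_sqrt_of_sq_le (hφb x)
  have hf : ParamC2 fun (p : Euc d × ℝ) y => ℓin p.1 p.2 y := .of_iteratedFDeriv hC3in hjcin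
  have hk : ParamC2 fun (p : Euc d × ℝ) y => ℓout p.1 p.2 y := .of_iteratedFDeriv hC3out hjcout
  obtain ⟨g, hgdef⟩ : ∃ g : Euc d × ℝ → Euc q → ℝ,
      g = fun p y => fderiv ℝ (fun r : Euc d × ℝ => ℓin r.1 r.2 y) p (0, 1) := ⟨_, rfl⟩
  have hg : ParamC2 g := hgdef ▸ .fderiv_apply_of_iteratedFDeriv hC3in hjcin (0, 1)
  have hfd (y : Euc q) : Differentiable ℝ fun r : Euc d × ℝ => ℓin r.1 r.2 y :=
    (hf.contDiff y).differentiable (by norm_num)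
  have hkd (y : Euc q) : Differentiable ℝ fun r : Euc d × ℝ => ℓout r.1 r.2 y :=
    (hk.contDiff y).differentiable (by norm_num)
  have hgd (y : Euc q) : Differentiable ℝ fun r => g r y :=
    (hg.contDiff y).differentiable (by norm_num)
  have hderiv_in (ω : Euc d) (v : ℝ) (y : Euc q) :
      HasDerivAt (fun v => ℓin ω v y) (g (ω, v) y) v := by
    rw [hgdef]
    exact hasDerivAt_snd_of_differentiable (hfd y) ω v
  have hderiv_out (v : ℝ) (y : Euc q) : deriv (fun v => ℓout ω v y) v =
      fderiv ℝ (fun r : Euc d × ℝ => ℓout r.1 r.2 y) (ω, v) (0, 1) :=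
    (hasDerivAt_snd_of_differentiable (hkd y) ω v).deriv
  have hderiv_g (v : ℝ) (y : Euc q) : deriv (fun v => g (ω, v) y) v =
      fderiv ℝ (fun r => g r y) (ω, v) (0, 1) :=
    (hasDerivAt_snd_of_differentiable (hgd y) ω v).deriv
  have hmonotone (ω : Euc d) (y : Euc q) : Monotone fun v => g (ω, v) y := by
    have := (hconv ω y).monotoneOn_deriv fun v _ => (hderiv_in ω v y).differentiableAt
    rw [monotoneOn_univ] at this
    convert this using 2 with v
    exact (hderiv_in ω v y).deriv.symm
  have hmono (ω : Euc d) (v v' : ℝ) (y : Euc q) :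
      0 ≤ (g (ω, v') y - g (ω, v) y) * (v' - v) := by
    rcases le_total v v' with h | h
    · exact mul_nonneg (sub_nonneg.2 (hmonotone ω y h)) (sub_nonneg.2 h)
    · exact mul_nonneg_of_nonpos_of_nonpos (sub_nonpos.2 (hmonotone ω y h)) (sub_nonpos.2 h)
  have hfoc (ω : Euc d) (a : H) :
      (∫ p, g (ω, ⟪hstar ω, φ p.1⟫) p.2 * ⟪a, φ p.1⟫ ∂P) + lam * ⟪hstar ω, a⟫ = 0 := by
    rw [hgdef]
    exact hf.integral_fderiv_add_inner_eq_zero hφm hK hφ hY hPY (hstarMin ω) a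
  have hcont_fderiv {g : Euc d × ℝ → Euc q → ℝ} (hg : ParamC2 g) :
      Continuous fun z : ℝ × Euc q => fderiv ℝ (fun r => g r z.2) (ω, z.1) :=
    hg.continuous_fderiv.comp (f := fun z : ℝ × Euc q => ((ω, z.1), z.2)) (by fun_prop)
  obtain ⟨B, hB⟩ := exists_bilin_integral hφm hφ hY hPY
    ((hcont_fderiv hg).clm_apply (continuous_const (y := ((0, 1) : Euc d × ℝ)))) (hstar ω)
  obtain ⟨L, hL⟩ := exists_clm_integral hφm hφ hY hQY
    ((hcont_fderiv hk).clm_apply (continuous_const (y := ((0, 1) : Euc d × ℝ)))) (hstar ω)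
  obtain ⟨a, ha, hmin⟩ := exists_regularized_quadratic_min B
    (fun a b => by simp only [hB, mul_right_comm])
    (fun a => by
      rw [hB]
      refine integral_nonneg fun p => ?_
      dsimp only [Pi.zero_apply]
      rw [mul_assoc, ← hderiv_g]
      exact mul_nonneg (hmonotone ω p.2).deriv_nonneg (mul_self_nonneg _)) L hlam
  simp only [hB, hL] at ha hmin
  simp only [mul_assoc, ← sq] at hmin
  simp only [(hderiv_in _ _ _).deriv, hderiv_g, hderiv_out]
  refine ⟨a, fun b => ?_, fun b hb => ?_, ?_⟩
  · have := hmin b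
    have : 0 ≤ lam / 2 * ‖b - a‖ ^ 2 := by positivity
    linarith
  · have h1 := hmin b
    have h2 := hb a
    have h3 : lam / 2 * ‖b - a‖ ^ 2 ≤ 0 := by linarith
    have h4 : ‖b - a‖ ^ 2 = 0 := le_antisymm (by nlinarith) (sq_nonneg _)
    exact sub_eq_zero.1 (norm_eq_zero.1 (pow_eq_zero_iff two_ne_zero |>.1 h4))
  · obtain ⟨C, hC⟩ := hg.exists_value_expansion hk hmono hφm hK hφ hY hPY hQY hlam hfoc ω ha
    refine hasGradientAt_of_abs_sub_le_sq (C := C) fun ω' hω' => ?_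
    have hgrad_k (v : ℝ) (y : Euc q) := gradient_fst_of_differentiable (hkd y) ω v
    have hgrad_g (v : ℝ) (y : Euc q) := gradient_fst_of_differentiable (hgd y) ω v
    have hcont_grad {g : Euc d × ℝ → Euc q → ℝ} (hg : ParamC2 g) :
        Continuous fun z : (ℝ × ℝ × ℝ) × Euc q => (InnerProductSpace.toDual ℝ (Euc d)).symm
          ((fderiv ℝ (fun r => g r z.2) (ω, z.1.1)).comp
            (ContinuousLinearMap.inl ℝ (Euc d) ℝ)) :=
      (LinearIsometryEquiv.continuous _).comp
        (((hcont_fderiv hg).comp (f := fun z : (ℝ × ℝ × ℝ) × Euc q => (z.1.1, z.2))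
          (by fun_prop)).clm_comp continuous_const)
    have hik := integrable_comp_feature hφm hφ hY hQY (hcont_grad hk) (hstar ω) 0 0
    have hig := integrable_comp_feature hφm hφ hY hPY
      (F := fun z => z.1.2.1 • (InnerProductSpace.toDual ℝ (Euc d)).symm
          ((fderiv ℝ (fun r => g r z.2) (ω, z.1.1)).comp
            (ContinuousLinearMap.inl ℝ (Euc d) ℝ)))
      (Continuous.smul (f := fun z : (ℝ × ℝ × ℝ) × Euc q => z.1.2.1) (by fun_prop)
        (hcont_grad hg)) (hstar ω) a 0
    simp only [hgrad_k, hgrad_g]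
    rw [inner_add_left, real_inner_comm, ← integral_inner hik, real_inner_comm (ω' - ω),
      ← integral_inner hig]
    simp only [real_inner_smul_left, real_inner_comm _ (ω' - ω), InnerProductSpace.toDual_symm_apply]
    exact hC ω' hω'
end

section
/- The map ω ↦ h⋆_ω is (L√κ/λ)-Lipschitz continuous on hull(Ω), where L := sup{‖∂²_{ω,v} ℓ_in(ω, v, y)‖ : ω ∈ hull(Ω), v ∈ V, y ∈ Y} > 0 and V := [−Bκ/λ, Bκ/λ] with B := sup{|∂_v ℓ_in(ω, 0, y)| : ω ∈ hull(Ω), y ∈ Y}. -/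
open MeasureTheory
open scoped RealInnerProductSpace BigOperators

section PartialDerivatives

variable {E F : Type*} [NormedAddCommGroup E] [NormedSpace ℝ E]
  [NormedAddCommGroup F]

theorem hasDerivAt_partial_snd {f : E × ℝ → ℝ} (hf : Differentiable ℝ f) (x : E) (v : ℝ) :
    HasDerivAt (fun v : ℝ => f (x, v)) (fderiv ℝ f (x, v) (0, 1)) v :=
  (hf (x, v)).hasFDerivAt.comp_hasDerivAt v ((hasDerivAt_const v x).prodMk (hasDerivAt_id v))

theorem deriv_partial_snd {f : E × ℝ → ℝ} (hf : Differentiable ℝ f) (x : E) (v : ℝ) :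
    deriv (fun v : ℝ => f (x, v)) v = fderiv ℝ f (x, v) (0, 1) :=
  (hasDerivAt_partial_snd hf x v).deriv

theorem hasFDerivAt_deriv_partial_snd {f : E × ℝ → ℝ} (hf : ContDiff ℝ 2 f) (x : E) (v : ℝ) :
    HasFDerivAt (fun x : E => deriv (fun v : ℝ => f (x, v)) v)
      ((fderiv ℝ (fderiv ℝ f) (x, v)).flip (0, 1) ∘L ContinuousLinearMap.inl ℝ E ℝ) x := by
  have hd : Differentiable ℝ f := hf.differentiable (by norm_num)
  have hd' : Differentiable ℝ (fderiv ℝ f) :=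
    (hf.fderiv_right (m := 1) (by norm_num)).differentiable (by norm_num)
  simp only [deriv_partial_snd hd]
  have hc : HasFDerivAt (fun x : E => fderiv ℝ f (x, v))
      (fderiv ℝ (fderiv ℝ f) (x, v) ∘L ContinuousLinearMap.inl ℝ E ℝ) x :=
    (hd' (x, v)).hasFDerivAt.comp x (hasFDerivAt_prodMk_left x v)
  have h := hc.clm_apply (hasFDerivAt_const ((0, 1) : E × ℝ) x)
  refine h.congr_fderiv ?_
  ext w
  simp

theorem norm_fderiv_deriv_partial_snd_le {f : E × ℝ → ℝ} (hf : ContDiff ℝ 2 f) (x : E) (v : ℝ) :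
    ‖fderiv ℝ (fun x : E => deriv (fun v : ℝ => f (x, v)) v) x‖ ≤ ‖iteratedFDeriv ℝ 2 f (x, v)‖ := by
  have hn : ‖fderiv ℝ (fderiv ℝ f) (x, v)‖ = ‖iteratedFDeriv ℝ 2 f (x, v)‖ := by
    rw [← norm_iteratedFDeriv_one, norm_iteratedFDeriv_fderiv]
  rw [(hasFDerivAt_deriv_partial_snd hf x v).fderiv, ← hn]
  refine ContinuousLinearMap.opNorm_le_bound _ (norm_nonneg (fderiv ℝ (fderiv ℝ f) (x, v))) fun w => ?_
  have h := (fderiv ℝ (fderiv ℝ f) (x, v)).le_opNorm₂ (w, 0) (0, 1)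
  simpa [Prod.norm_def] using h

theorem continuous_deriv_partial_snd {ℓ : E → ℝ → F → ℝ}
    (hd : ∀ y, Differentiable ℝ fun p : E × ℝ => ℓ p.1 p.2 y)
    (hc : Continuous fun p : (E × ℝ) × F =>
      iteratedFDeriv ℝ 1 (fun r : E × ℝ => ℓ r.1 r.2 p.2) p.1) (x : E) :
    Continuous fun p : ℝ × F => deriv (fun v => ℓ x v p.2) p.1 := by
  have h : ∀ p : ℝ × F, deriv (fun v => ℓ x v p.2) p.1 =
      iteratedFDeriv ℝ 1 (fun r : E × ℝ => ℓ r.1 r.2 p.2) (x, p.1) fun _ => (0, 1) := fun p => by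
    rw [iteratedFDeriv_one_apply]
    exact deriv_partial_snd (hd p.2) x p.1
  simp only [h]
  have h2 : Continuous fun p : ℝ × F =>
      iteratedFDeriv ℝ 1 (fun r : E × ℝ => ℓ r.1 r.2 p.2) (x, p.1) :=
    hc.comp (f := fun p : ℝ × F => ((x, p.1), p.2)) (by fun_prop)
  fun_prop

theorem bddAbove_norm_fderiv_deriv_partial_snd {ℓ : E → ℝ → F → ℝ}
    (hC : ∀ y, ContDiff ℝ 2 fun p : E × ℝ => ℓ p.1 p.2 y)
    (hc : Continuous fun p : (E × ℝ) × F =>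
      iteratedFDeriv ℝ 2 (fun r : E × ℝ => ℓ r.1 r.2 p.2) p.1)
    {S : Set E} {V : Set ℝ} {Y : Set F} (hS : IsCompact S) (hV : IsCompact V) (hY : IsCompact Y) :
    BddAbove ((fun t : E × ℝ × F =>
      ‖fderiv ℝ (fun x => deriv (fun v => ℓ x v t.2.2) t.2.1) t.1‖) '' (S ×ˢ V ×ˢ Y)) := by
  obtain ⟨C, hC'⟩ := ((hS.prod hV).prod hY).exists_bound_of_continuousOn hc.continuousOn
  refine ⟨C, ?_⟩
  rintro _ ⟨⟨x, v, y⟩, ⟨hx, hv, hy⟩, rfl⟩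
  exact (norm_fderiv_deriv_partial_snd_le (hC y) x v).trans (hC' ((x, v), y) ⟨⟨hx, hv⟩, hy⟩)

theorem bddAbove_abs_deriv_partial_snd {ℓ : E → ℝ → F → ℝ}
    (hd : ∀ y, Differentiable ℝ fun p : E × ℝ => ℓ p.1 p.2 y)
    (hc : Continuous fun p : (E × ℝ) × F =>
      iteratedFDeriv ℝ 1 (fun r : E × ℝ => ℓ r.1 r.2 p.2) p.1)
    {S : Set E} {Y : Set F} (hS : IsCompact S) (hY : IsCompact Y) (v : ℝ) :
    BddAbove ((fun t : E × F => |deriv (fun v => ℓ t.1 v t.2) v|) '' (S ×ˢ Y)) := by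
  obtain ⟨C, hC⟩ := ((hS.prod isCompact_singleton).prod hY).exists_bound_of_continuousOn
    (s := (S ×ˢ {v}) ×ˢ Y) hc.continuousOn
  refine ⟨C, ?_⟩
  rintro _ ⟨⟨x, y⟩, ⟨hx, hy⟩, rfl⟩
  have h := hC ((x, v), y) ⟨⟨hx, rfl⟩, hy⟩
  rw [norm_iteratedFDeriv_one] at h
  have h2 := (fderiv ℝ (fun p : E × ℝ => ℓ p.1 p.2 y) (x, v)).le_opNorm (0, 1)
  simp only [Prod.norm_mk, norm_zero, norm_one, zero_le_one, sup_of_le_right, mul_one] at h2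
  rw [← deriv_partial_snd (hd y)] at h2
  exact h2.trans h

end PartialDerivatives

theorem isCompact_closure_convexHull {n : ℕ} {s : Set (Euc n)} (hs : IsCompact s) :
    IsCompact (closure (convexHull ℝ s)) :=
  (isBounded_convexHull.2 hs.isBounded).isCompact_closure

section FeatureMap

variable {H X F : Type*} [NormedAddCommGroup H] [InnerProductSpace ℝ H]
  {φ : X → H} {κ : ℝ}

theorem abs_inner_le_mul_sqrt (hφb : ∀ x, ‖φ x‖ ^ 2 ≤ κ) (h : H) (x : X) :
    |⟪h, φ x⟫| ≤ ‖h‖ * √κ :=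
  (abs_real_inner_le_norm h (φ x)).trans
    (mul_le_mul_of_nonneg_left (Real.le_sqrt_of_sq_le (hφb x)) (norm_nonneg h))

variable [NormedAddCommGroup F] {Y : Set F}

theorem exists_bound_comp_feature (hφb : ∀ x, ‖φ x‖ ^ 2 ≤ κ) (hY : IsCompact Y)
    {G : ℝ × F → ℝ} (hG : Continuous G) (R : ℝ) :
    ∃ C, ∀ h : H, ‖h‖ ≤ R → ∀ x, ∀ y ∈ Y, ‖G (⟪h, φ x⟫, y)‖ ≤ C := by
  obtain ⟨C, hC⟩ := ((isCompact_Icc (a := -(R * √κ)) (b := R * √κ)).prod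
    hY).exists_bound_of_continuousOn hG.continuousOn
  refine ⟨C, fun h hh x y hy => hC _ ⟨abs_le.1 ?_, hy⟩⟩
  exact (abs_inner_le_mul_sqrt hφb h x).trans
    (mul_le_mul_of_nonneg_right hh (Real.sqrt_nonneg κ))

variable [MeasurableSpace X] [MeasurableSpace H] [BorelSpace H]

theorem measurable_inner_feature {F : Type*} [MeasurableSpace F] (hφm : Measurable φ) (h : H) :
    Measurable fun p : X × F => ⟪h, φ p.1⟫ :=
  (Continuous.measurable (by fun_prop : Continuous fun k : H => ⟪h, k⟫)).comp
    (hφm.comp measurable_fst)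

variable [SecondCountableTopology F] [MeasurableSpace F] [BorelSpace F]

theorem measurable_comp_feature (hφm : Measurable φ) {G : ℝ × F → ℝ} (hG : Continuous G) (h : H) :
    Measurable fun p : X × F => G (⟪h, φ p.1⟫, p.2) :=
  hG.measurable.comp ((measurable_inner_feature hφm h).prodMk measurable_snd)

variable {P : Measure (X × F)} [IsFiniteMeasure P]

theorem integrable_comp_feature_s5 (hφm : Measurable φ) (hφb : ∀ x, ‖φ x‖ ^ 2 ≤ κ) (hY : IsCompact Y)
    (hPY : ∀ᵐ p ∂P, p.2 ∈ Y) {G : ℝ × F → ℝ} (hG : Continuous G) (h : H) :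
    Integrable (fun p : X × F => G (⟪h, φ p.1⟫, p.2)) P := by
  obtain ⟨C, hC⟩ := exists_bound_comp_feature hφb hY hG ‖h‖
  refine .of_bound (measurable_comp_feature hφm hG h).aestronglyMeasurable C ?_
  filter_upwards [hPY] with p hp using hC h le_rfl p.1 p.2 hp

theorem integrable_comp_feature_mul_inner (hφm : Measurable φ) (hφb : ∀ x, ‖φ x‖ ^ 2 ≤ κ)
    (hY : IsCompact Y) (hPY : ∀ᵐ p ∂P, p.2 ∈ Y) {G : ℝ × F → ℝ} (hG : Continuous G) (h k : H) :
    Integrable (fun p : X × F => G (⟪h, φ p.1⟫, p.2) * ⟪k, φ p.1⟫) P :=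
  (integrable_comp_feature_s5 hφm hφb hY hPY hG h).mul_bdd (c := ‖k‖ * √κ)
    (measurable_inner_feature hφm k).aestronglyMeasurable
    (.of_forall fun p => abs_inner_le_mul_sqrt hφb k p.1)

theorem hasDerivAt_integral_comp_feature (hφm : Measurable φ) (hφb : ∀ x, ‖φ x‖ ^ 2 ≤ κ)
    (hY : IsCompact Y) (hPY : ∀ᵐ p ∂P, p.2 ∈ Y) {G G' : ℝ × F → ℝ} (hG : Continuous G)
    (hG' : Continuous G') (hd : ∀ v y, HasDerivAt (fun v => G (v, y)) (G' (v, y)) v) (h k : H) :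
    HasDerivAt (fun t : ℝ => ∫ p, G (⟪h + t • k, φ p.1⟫, p.2) ∂P)
      (∫ p, G' (⟪h, φ p.1⟫, p.2) * ⟪k, φ p.1⟫ ∂P) 0 := by
  obtain ⟨C, hC⟩ := exists_bound_comp_feature hφb hY hG' (‖h‖ + ‖k‖)
  have key := hasDerivAt_integral_of_dominated_loc_of_deriv_le (μ := P) (x₀ := (0 : ℝ))
    (s := Metric.ball 0 1) (bound := fun _ => C * (‖k‖ * √κ))
    (F := fun t p => G (⟪h + t • k, φ p.1⟫, p.2))
    (F' := fun t p => G' (⟪h + t • k, φ p.1⟫, p.2) * ⟪k, φ p.1⟫)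
    (Metric.ball_mem_nhds 0 one_pos)
    (.of_forall fun t => (measurable_comp_feature hφm hG _).aestronglyMeasurable)
    (integrable_comp_feature_s5 hφm hφb hY hPY hG _)
    (integrable_comp_feature_mul_inner hφm hφb hY hPY hG' _ k).aestronglyMeasurable
    ?_ (integrable_const _) ?_
  · simpa using key.2
  · filter_upwards [hPY] with p hp t ht
    have ht' : ‖t‖ ≤ 1 := (mem_ball_zero_iff.1 ht).le
    have hb : ‖h + t • k‖ ≤ ‖h‖ + ‖k‖ := by
      refine (norm_add_le _ _).trans ?_
      rw [norm_smul]
      nlinarith [norm_nonneg k]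
    rw [norm_mul]
    have h1 := hC _ hb p.1 p.2 hp
    exact mul_le_mul h1 (abs_inner_le_mul_sqrt hφb k p.1) (norm_nonneg _) ((norm_nonneg _).trans h1)
  · refine .of_forall fun p t _ => ?_
    have hin : HasDerivAt (fun t : ℝ => ⟪h + t • k, φ p.1⟫) ⟪k, φ p.1⟫ t := by
      simp only [inner_add_left, real_inner_smul_left]
      simpa using ((hasDerivAt_id t).mul_const ⟪k, φ p.1⟫).const_add ⟪h, φ p.1⟫
    exact (hd ⟪h + t • k, φ p.1⟫ p.2).comp t hin

/-- First-order optimality condition for the regularized risk. -/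
theorem integral_add_inner_eq_zero_of_minimizer (hφm : Measurable φ) (hφb : ∀ x, ‖φ x‖ ^ 2 ≤ κ)
    (hY : IsCompact Y) (hPY : ∀ᵐ p ∂P, p.2 ∈ Y) {G G' : ℝ × F → ℝ} (hG : Continuous G)
    (hG' : Continuous G') (hd : ∀ v y, HasDerivAt (fun v => G (v, y)) (G' (v, y)) v)
    {lam : ℝ} {h₀ : H}
    (hmin : ∀ h : H, (∫ p, G (⟪h₀, φ p.1⟫, p.2) ∂P) + lam / 2 * ‖h₀‖ ^ 2 ≤
      (∫ p, G (⟪h, φ p.1⟫, p.2) ∂P) + lam / 2 * ‖h‖ ^ 2) (k : H) :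
    (∫ p, G' (⟪h₀, φ p.1⟫, p.2) * ⟪k, φ p.1⟫ ∂P) + lam * ⟪h₀, k⟫ = 0 := by
  have hin : HasDerivAt (fun t : ℝ => h₀ + t • k) k 0 := by
    simpa using ((hasDerivAt_id (0 : ℝ)).smul_const k).const_add h₀
  have hnorm : HasDerivAt (fun t : ℝ => lam / 2 * ‖h₀ + t • k‖ ^ 2) (lam * ⟪h₀, k⟫) 0 := by
    refine (hin.norm_sq.const_mul (lam / 2)).congr_deriv ?_
    simp only [zero_smul, add_zero]
    ring
  refine IsLocalMin.hasDerivAt_eq_zero (a := 0) (.of_forall fun t => ?_)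
    ((hasDerivAt_integral_comp_feature hφm hφb hY hPY hG hG' hd h₀ k).add hnorm)
  simpa using hmin (h₀ + t • k)

end FeatureMap

section RegularizedMinimizer

variable {H X F : Type*} [NormedAddCommGroup H] [InnerProductSpace ℝ H]
  [MeasurableSpace X] [MeasurableSpace H] [BorelSpace H]
  [NormedAddCommGroup F] [SecondCountableTopology F] [MeasurableSpace F] [BorelSpace F]
  {φ : X → H} {κ : ℝ} {Y : Set F} {P : Measure (X × F)} [IsProbabilityMeasure P]

theorem norm_le_of_stationary (hφm : Measurable φ) (hφb : ∀ x, ‖φ x‖ ^ 2 ≤ κ)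
    (hY : IsCompact Y) (hPY : ∀ᵐ p ∂P, p.2 ∈ Y) {G' : ℝ × F → ℝ} (hG' : Continuous G')
    (hmono : ∀ y, Monotone fun v => G' (v, y)) {lam : ℝ} (hlam : 0 < lam) {h₀ : H}
    (hstat : ∀ k : H, (∫ p, G' (⟪h₀, φ p.1⟫, p.2) * ⟪k, φ p.1⟫ ∂P) + lam * ⟪h₀, k⟫ = 0)
    {B : ℝ} (hB : ∀ y ∈ Y, |G' (0, y)| ≤ B) : ‖h₀‖ ≤ B * √κ / lam := by
  have h1 := hstat h₀
  have h2 : -(B * (‖h₀‖ * √κ)) ≤ ∫ p, G' (⟪h₀, φ p.1⟫, p.2) * ⟪h₀, φ p.1⟫ ∂P := by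
    have hint := integrable_comp_feature_mul_inner hφm hφb hY hPY hG' h₀ h₀
    calc -(B * (‖h₀‖ * √κ)) = ∫ _, -(B * (‖h₀‖ * √κ)) ∂P := by simp
      _ ≤ _ := integral_mono_ae (integrable_const _) hint ?_
    filter_upwards [hPY] with p hp
    set v := ⟪h₀, φ p.1⟫
    have hmul : 0 ≤ (G' (v, p.2) - G' (0, p.2)) * v := by
      rcases le_total 0 v with hv | hv
      · exact mul_nonneg (sub_nonneg.2 (hmono p.2 hv)) hv
      · exact mul_nonneg_of_nonpos_of_nonpos (sub_nonpos.2 (hmono p.2 hv)) hv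
    have habs : |G' (0, p.2) * v| ≤ B * (‖h₀‖ * √κ) := by
      rw [abs_mul]
      exact mul_le_mul (hB _ hp) (abs_inner_le_mul_sqrt hφb h₀ p.1) (abs_nonneg _)
        ((abs_nonneg _).trans (hB _ hp))
    linarith [(abs_le.1 habs).1]
  rw [real_inner_self_eq_norm_sq] at h1
  obtain ⟨p, hp⟩ := hPY.exists
  have hB0 : 0 ≤ B := (abs_nonneg _).trans (hB _ hp)
  rcases (norm_nonneg h₀).eq_or_lt with h0 | h0
  · rw [← h0]
    positivity
  · rw [le_div_iff₀ hlam]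
    refine le_of_mul_le_mul_right ?_ h0
    linarith

theorem norm_sub_le_of_stationary (hφm : Measurable φ) (hφb : ∀ x, ‖φ x‖ ^ 2 ≤ κ)
    (hY : IsCompact Y) (hPY : ∀ᵐ p ∂P, p.2 ∈ Y) {G₁ G₂ : ℝ × F → ℝ} (hG₁ : Continuous G₁)
    (hG₂ : Continuous G₂) (hmono : ∀ y, Monotone fun v => G₁ (v, y))
    {lam : ℝ} (hlam : 0 < lam) {h₁ h₂ : H}
    (hstat₁ : ∀ k : H, (∫ p, G₁ (⟪h₁, φ p.1⟫, p.2) * ⟪k, φ p.1⟫ ∂P) + lam * ⟪h₁, k⟫ = 0)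
    (hstat₂ : ∀ k : H, (∫ p, G₂ (⟪h₂, φ p.1⟫, p.2) * ⟪k, φ p.1⟫ ∂P) + lam * ⟪h₂, k⟫ = 0)
    {D : ℝ} (hD : ∀ x, ∀ y ∈ Y, |G₁ (⟪h₂, φ x⟫, y) - G₂ (⟪h₂, φ x⟫, y)| ≤ D) :
    ‖h₁ - h₂‖ ≤ D * √κ / lam := by
  set k := h₁ - h₂ with hk
  have i₁ := integrable_comp_feature_mul_inner hφm hφb hY hPY hG₁ h₁ k
  have i₂ := integrable_comp_feature_mul_inner hφm hφb hY hPY hG₂ h₂ k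
  have h1 : -(D * (‖k‖ * √κ)) ≤ ∫ p, (G₁ (⟪h₁, φ p.1⟫, p.2) * ⟪k, φ p.1⟫ -
      G₂ (⟪h₂, φ p.1⟫, p.2) * ⟪k, φ p.1⟫) ∂P := by
    calc -(D * (‖k‖ * √κ)) = ∫ _, -(D * (‖k‖ * √κ)) ∂P := by simp
      _ ≤ _ := integral_mono_ae (integrable_const _) (i₁.sub i₂) ?_
    filter_upwards [hPY] with p hp
    have hu : ⟪k, φ p.1⟫ = ⟪h₁, φ p.1⟫ - ⟪h₂, φ p.1⟫ := inner_sub_left _ _ _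
    have hmul : 0 ≤ (G₁ (⟪h₁, φ p.1⟫, p.2) - G₁ (⟪h₂, φ p.1⟫, p.2)) * ⟪k, φ p.1⟫ := by
      rcases le_total ⟪h₂, φ p.1⟫ ⟪h₁, φ p.1⟫ with hv | hv
      · exact mul_nonneg (sub_nonneg.2 (hmono p.2 hv)) (by rw [hu]; exact sub_nonneg.2 hv)
      · exact mul_nonneg_of_nonpos_of_nonpos (sub_nonpos.2 (hmono p.2 hv))
          (by rw [hu]; exact sub_nonpos.2 hv)
    have habs : |(G₁ (⟪h₂, φ p.1⟫, p.2) - G₂ (⟪h₂, φ p.1⟫, p.2)) * ⟪k, φ p.1⟫| ≤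
        D * (‖k‖ * √κ) := by
      rw [abs_mul]
      exact mul_le_mul (hD _ _ hp) (abs_inner_le_mul_sqrt hφb k p.1) (abs_nonneg _)
        ((abs_nonneg _).trans (hD p.1 _ hp))
    simp only [Pi.sub_apply]
    linarith [(abs_le.1 habs).1]
  rw [integral_sub i₁ i₂] at h1
  have h2 : ⟪h₁, k⟫ - ⟪h₂, k⟫ = ‖k‖ ^ 2 := by
    rw [← inner_sub_left, ← hk, real_inner_self_eq_norm_sq]
  have h3 : lam * ‖k‖ ^ 2 ≤ D * (‖k‖ * √κ) := by
    rw [← h2]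
    linarith [hstat₁ k, hstat₂ k]
  obtain ⟨p, hp⟩ := hPY.exists
  have hD0 : 0 ≤ D := (abs_nonneg _).trans (hD p.1 _ hp)
  rcases (norm_nonneg k).eq_or_lt with h0 | h0
  · rw [← h0]
    positivity
  · rw [le_div_iff₀ hlam]
    refine le_of_mul_le_mul_right ?_ h0
    linarith

end RegularizedMinimizer

/-- Context as in Statement 4 (population problem only): `h⋆_ω` is the
unique minimizer of `L_in(ω,h) = E_P[ℓ_in(ω, h(x), y)] + (λ/2)‖h‖²`, `Ω ⊆ ℝ^d` compact.
Conclusion: `ω ↦ h⋆_ω` is `(L√κ/λ)`-Lipschitz on `hull(Ω)`, where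
`L := sup{‖∂²_{ω,v} ℓ_in(ω,v,y)‖ : ω ∈ hull(Ω), v ∈ V, y ∈ Y}`, with
`V := [−Bκ/λ, Bκ/λ]` and `B := sup{|∂_v ℓ_in(ω,0,y)| : ω ∈ hull(Ω), y ∈ Y}`. -/
theorem stmt_5 {d q : ℕ} {H X : Type*}
    [NormedAddCommGroup H] [InnerProductSpace ℝ H] [CompleteSpace H]
    [MeasurableSpace X] [MeasurableSpace H] [BorelSpace H]
    (φ : X → H) (hφm : Measurable φ)
    (κ : ℝ) (hκ : 0 < κ) (hφb : ∀ x : X, ‖φ x‖ ^ 2 ≤ κ)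
    (Y : Set (Euc q)) (hY : IsCompact Y)
    (ℓin : Euc d → ℝ → Euc q → ℝ)
    (hC3in : ∀ y : Euc q, ContDiff ℝ 3 fun p : Euc d × ℝ => ℓin p.1 p.2 y)
    (hjcin : ∀ i : ℕ, i ≤ 3 → Continuous fun p : (Euc d × ℝ) × Euc q =>
      iteratedFDeriv ℝ i (fun r : Euc d × ℝ => ℓin r.1 r.2 p.2) p.1)
    (hconv : ∀ (ω : Euc d) (y : Euc q), ConvexOn ℝ Set.univ fun v : ℝ => ℓin ω v y)
    (P : Measure (X × Euc q)) [IsProbabilityMeasure P] (hPY : ∀ᵐ p ∂P, p.2 ∈ Y)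
    (lam : ℝ) (hlam : 0 < lam)
    (hstar : Euc d → H)
    (hstarMin : ∀ (ω : Euc d) (h : H),
      (∫ p, ℓin ω ⟪hstar ω, φ p.1⟫ p.2 ∂P) + lam / 2 * ‖hstar ω‖ ^ 2 ≤
        (∫ p, ℓin ω ⟪h, φ p.1⟫ p.2 ∂P) + lam / 2 * ‖h‖ ^ 2)
    (Ω : Set (Euc d)) (hΩ : IsCompact Ω)
    (B : ℝ)
    (hB : B = sSup ((fun t : Euc d × Euc q => |deriv (fun v : ℝ => ℓin t.1 v t.2) 0|) ''
      ((convexHull ℝ Ω) ×ˢ Y)))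
    (V : Set ℝ) (hV : V = Set.Icc (-(B * κ / lam)) (B * κ / lam))
    (L : ℝ)
    (hL : L = sSup ((fun t : Euc d × ℝ × Euc q =>
      ‖gradient (fun ω' : Euc d => deriv (fun v : ℝ => ℓin ω' v t.2.2) t.2.1) t.1‖) ''
      ((convexHull ℝ Ω) ×ˢ V ×ˢ Y))) :
    ∀ ω₁ ∈ convexHull ℝ Ω, ∀ ω₂ ∈ convexHull ℝ Ω,
      ‖hstar ω₁ - hstar ω₂‖ ≤ L * Real.sqrt κ / lam * ‖ω₁ - ω₂‖ := by
  have hd : ∀ y, Differentiable ℝ fun p : Euc d × ℝ => ℓin p.1 p.2 y :=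
    fun y => (hC3in y).differentiable (by norm_num)
  have hC2 : ∀ y, ContDiff ℝ 2 fun p : Euc d × ℝ => ℓin p.1 p.2 y :=
    fun y => (hC3in y).of_le (by norm_num)
  have hdv : ∀ ω v y, HasDerivAt (fun v => ℓin ω v y) (deriv (fun v => ℓin ω v y) v) v :=
    fun ω v y => (hasDerivAt_partial_snd (hd y) ω v).differentiableAt.hasDerivAt
  have hcont : ∀ ω, Continuous fun p : ℝ × Euc q => ℓin ω p.1 p.2 := fun ω => by
    have h0 : Continuous fun p : ℝ × Euc q =>
        iteratedFDeriv ℝ 0 (fun r : Euc d × ℝ => ℓin r.1 r.2 p.2) (ω, p.1) :=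
      (hjcin 0 (by norm_num)).comp (f := fun p : ℝ × Euc q => ((ω, p.1), p.2)) (by fun_prop)
    have h1 : Continuous fun p : ℝ × Euc q =>
        iteratedFDeriv ℝ 0 (fun r : Euc d × ℝ => ℓin r.1 r.2 p.2) (ω, p.1) fun _ => 0 := by
      fun_prop
    simpa only [iteratedFDeriv_zero_apply] using h1
  have hcont' : ∀ ω, Continuous fun p : ℝ × Euc q => deriv (fun v => ℓin ω v p.2) p.1 :=
    continuous_deriv_partial_snd hd (hjcin 1 (by norm_num))
  have hmono : ∀ ω y, Monotone fun v => deriv (fun v => ℓin ω v y) v := fun ω y =>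
    monotoneOn_univ.1 ((hconv ω y).monotoneOn_deriv fun v _ => (hdv ω v y).differentiableAt)
  have hstat : ∀ ω (k : H), (∫ p, deriv (fun v => ℓin ω v p.2) ⟪hstar ω, φ p.1⟫ * ⟪k, φ p.1⟫ ∂P) +
      lam * ⟪hstar ω, k⟫ = 0 := fun ω k =>
    integral_add_inner_eq_zero_of_minimizer hφm hφb hY hPY (hcont ω) (hcont' ω)
      (hdv ω) (hstarMin ω) k
  have hKc := isCompact_closure_convexHull hΩ
  have hBle : ∀ ω ∈ convexHull ℝ Ω, ∀ y ∈ Y, |deriv (fun v => ℓin ω v y) 0| ≤ B := by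
    intro ω hω y hy
    rw [hB]
    exact le_csSup ((bddAbove_abs_deriv_partial_snd hd (hjcin 1 (by norm_num)) hKc hY 0).mono
      (Set.image_mono (Set.prod_mono subset_closure subset_rfl))) ⟨(ω, y), ⟨hω, hy⟩, rfl⟩
  have hLle : ∀ ω ∈ convexHull ℝ Ω, ∀ v ∈ V, ∀ y ∈ Y,
      ‖fderiv ℝ (fun ω => deriv (fun v => ℓin ω v y) v) ω‖ ≤ L := by
    intro ω hω v hv y hy
    simp only [gradient, LinearIsometryEquiv.norm_map] at hL
    rw [hL]
    exact le_csSup ((bddAbove_norm_fderiv_deriv_partial_snd hC2 (hjcin 2 (by norm_num)) hKc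
      (hV ▸ isCompact_Icc) hY).mono (Set.image_mono (Set.prod_mono subset_closure subset_rfl)))
      ⟨(ω, v, y), ⟨hω, hv, hy⟩, rfl⟩
  intro ω₁ hω₁ ω₂ hω₂
  have hnorm := norm_le_of_stationary hφm hφb hY hPY (hcont' ω₂) (hmono ω₂) hlam (hstat ω₂)
    (hBle ω₂ hω₂)
  have hmem : ∀ x, ⟪hstar ω₂, φ x⟫ ∈ V := fun x => by
    rw [hV]
    refine abs_le.1 ((abs_inner_le_mul_sqrt hφb _ x).trans ?_)
    calc ‖hstar ω₂‖ * √κ ≤ B * √κ / lam * √κ := by gcongr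
      _ = B * (√κ * √κ) / lam := by ring
      _ = B * κ / lam := by rw [Real.mul_self_sqrt hκ.le]
  have hdiff := norm_sub_le_of_stationary hφm hφb hY hPY (hcont' ω₁) (hcont' ω₂) (hmono ω₁) hlam
    (hstat ω₁) (hstat ω₂) (D := L * ‖ω₁ - ω₂‖) fun x y hy =>
      (convex_convexHull ℝ Ω).norm_image_sub_le_of_norm_fderiv_le (𝕜 := ℝ)
        (f := fun ω => deriv (fun v => ℓin ω v y) ⟪hstar ω₂, φ x⟫)
        (fun ω _ => (hasFDerivAt_deriv_partial_snd (hC2 y) ω _).differentiableAt)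
        (fun ω hω => hLle ω hω _ (hmem x) y hy) hω₂ hω₁
  calc _ ≤ _ := hdiff
    _ = _ := by ring
end

section
/- Fix Λ > 0 with λ ≤ Λ. Define Lip_out := (Λ + M_in κ) · max(M_out, M̄_out) and Lip_in := (Λ + M_in κ) · max(M_in, M̄_in). Then for every (x, y) ∈ X × Y, the maps ω ↦ ℓ_out(ω, h⋆_ω(x), y), ω ↦ ∂_ω ℓ_out(ω, h⋆_ω(x), y), and ω ↦ ∂_v ℓ_out(ω, h⋆_ω(x), y) are (Lip_out/λ)-Lipschitz continuous on hull(Ω), and the maps ω ↦ ∂_v ℓ_in(ω, h⋆_ω(x), y), ω ↦ ∂²_v ℓ_in(ω, h⋆_ω(x), y), and ω ↦ ∂²_{ω,v} ℓ_in(ω, h⋆_ω(x), y) are (Lip_in/λ)-Lipschitz continuous on hull(Ω). -/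
open MeasureTheory
open scoped RealInnerProductSpace BigOperators

/-- `f (ω, v, z)` is of class `C^n` in `(ω, v)`, with derivatives of order at most `n` jointly
continuous in `(ω, v, z)`. -/
structure JointContDiff {E Z G : Type*} [NormedAddCommGroup E] [NormedSpace ℝ E]
    [TopologicalSpace Z] [NormedAddCommGroup G] [NormedSpace ℝ G]
    (n : ℕ) (f : E → ℝ → Z → G) : Prop where
  contDiff : ∀ z, ContDiff ℝ n fun p : E × ℝ => f p.1 p.2 z
  continuous_iteratedFDeriv : ∀ i ≤ n, Continuous fun p : (E × ℝ) × Z =>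
    iteratedFDeriv ℝ i (fun r : E × ℝ => f r.1 r.2 p.2) p.1

namespace JointContDiff

section Normed

variable {E Z G G' : Type*} [NormedAddCommGroup E] [NormedSpace ℝ E]
  [TopologicalSpace Z] [NormedAddCommGroup G] [NormedSpace ℝ G]
  [NormedAddCommGroup G'] [NormedSpace ℝ G'] {n : ℕ} {f : E → ℝ → Z → G}

theorem continuous (hf : JointContDiff n f) :
    Continuous fun t : E × ℝ × Z => f t.1 t.2.1 t.2.2 := by
  have h := (continuousMultilinearCurryFin0 ℝ (E × ℝ) G).continuous.comp
    ((hf.continuous_iteratedFDeriv 0 (Nat.zero_le _)).comp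
      (by fun_prop : Continuous fun t : E × ℝ × Z => ((t.1, t.2.1), t.2.2)))
  simpa [Function.comp_def] using h

/-- Joint regularity passes to the total derivative composed with a continuous linear map. -/
theorem clm_fderiv (hf : JointContDiff (n + 1) f) (L : (E × ℝ →L[ℝ] G) →L[ℝ] G') :
    JointContDiff n fun ω v z => L (fderiv ℝ (fun p : E × ℝ => f p.1 p.2 z) (ω, v)) := by
  have hd : ∀ z, ContDiff ℝ n (fderiv ℝ fun p : E × ℝ => f p.1 p.2 z) := fun z =>
    (hf.contDiff z).fderiv_right (by norm_cast)
  refine ⟨fun z => L.contDiff.comp (hd z), fun i hi => ?_⟩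
  have key : ∀ p : (E × ℝ) × Z,
      iteratedFDeriv ℝ i
          (fun r : E × ℝ => L (fderiv ℝ (fun s : E × ℝ => f s.1 s.2 p.2) (r.1, r.2))) p.1 =
        ContinuousLinearMap.compContinuousMultilinearMapL ℝ (fun _ : Fin i => E × ℝ) _ _ L
          (continuousMultilinearCurryRightEquiv' ℝ i (E × ℝ) G
            (iteratedFDeriv ℝ (i + 1) (fun r : E × ℝ => f r.1 r.2 p.2) p.1)) := by
    intro p
    rw [iteratedFDeriv_succ_eq_comp_right, Function.comp_apply,
      LinearIsometryEquiv.apply_symm_apply,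
      ContinuousLinearMap.compContinuousMultilinearMapL_apply]
    exact L.iteratedFDeriv_comp_left (hd p.2).contDiffAt (by exact_mod_cast hi)
  simp only [key]
  exact (ContinuousLinearMap.continuous _).comp
    ((LinearIsometryEquiv.continuous _).comp (hf.continuous_iteratedFDeriv (i + 1) (by omega)))

theorem differentiableAt (hf : JointContDiff (n + 1) f) (z : Z) (p : E × ℝ) :
    DifferentiableAt ℝ (fun p : E × ℝ => f p.1 p.2 z) p :=
  ((hf.contDiff z).differentiable (by norm_cast)).differentiableAt

theorem hasDerivAt_right (hf : JointContDiff (n + 1) f) (ω : E) (v : ℝ) (z : Z) :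
    HasDerivAt (fun v => f ω v z) (fderiv ℝ (fun p : E × ℝ => f p.1 p.2 z) (ω, v) (0, 1)) v :=
  (hf.differentiableAt z (ω, v)).hasFDerivAt.comp_hasDerivAt v
    ((hasDerivAt_const v ω).prodMk (hasDerivAt_id v))

theorem hasFDerivAt_left (hf : JointContDiff (n + 1) f) (ω : E) (v : ℝ) (z : Z) :
    HasFDerivAt (fun ω => f ω v z)
      ((fderiv ℝ (fun p : E × ℝ => f p.1 p.2 z) (ω, v)).comp (ContinuousLinearMap.inl ℝ E ℝ)) ω :=
  HasFDerivAt.comp (g := fun p : E × ℝ => f p.1 p.2 z) (f := fun ω => (ω, v)) ω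
    (hf.differentiableAt z (ω, v)).hasFDerivAt (hasFDerivAt_prodMk_left ω v)

theorem deriv_right (hf : JointContDiff (n + 1) f) :
    JointContDiff n fun ω v z => deriv (fun v => f ω v z) v := by
  simp only [(hf.hasDerivAt_right _ _ _).deriv]
  exact hf.clm_fderiv (ContinuousLinearMap.apply ℝ G ((0, 1) : E × ℝ))

theorem fderiv_left (hf : JointContDiff (n + 1) f) :
    JointContDiff n fun ω v z => fderiv ℝ (fun ω => f ω v z) ω := by
  simp only [(hf.hasFDerivAt_left _ _ _).fderiv]
  exact hf.clm_fderiv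
    ((ContinuousLinearMap.compL ℝ E (E × ℝ) G).flip (ContinuousLinearMap.inl ℝ E ℝ))

/-- Bounds on the partial derivatives on a product of convex sets give a Lipschitz estimate. -/
theorem norm_sub_le (hf : JointContDiff (n + 1) f) {C : Set E} (hC : Convex ℝ C) {V : Set ℝ}
    (hV : Convex ℝ V) {z : Z} {a b : ℝ}
    (ha : ∀ ω ∈ C, ∀ v ∈ V, ‖fderiv ℝ (fun ω => f ω v z) ω‖ ≤ a)
    (hb : ∀ ω ∈ C, ∀ v ∈ V, ‖deriv (fun v => f ω v z) v‖ ≤ b)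
    {ω₁ ω₂ : E} (h₁ : ω₁ ∈ C) (h₂ : ω₂ ∈ C) {v₁ v₂ : ℝ} (k₁ : v₁ ∈ V) (k₂ : v₂ ∈ V) :
    ‖f ω₁ v₁ z - f ω₂ v₂ z‖ ≤ a * ‖ω₁ - ω₂‖ + b * ‖v₁ - v₂‖ := by
  have A := hC.norm_image_sub_le_of_norm_fderiv_le (𝕜 := ℝ) (f := fun ω => f ω v₁ z)
    (fun ω _ => (hf.hasFDerivAt_left ω v₁ z).differentiableAt) (fun ω hω => ha ω hω v₁ k₁) h₂ h₁
  have A' := hV.norm_image_sub_le_of_norm_deriv_le (f := fun v => f ω₂ v z)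
    (fun v _ => (hf.hasDerivAt_right ω₂ v z).differentiableAt) (fun v hv => hb ω₂ h₂ v hv) k₂ k₁
  calc ‖f ω₁ v₁ z - f ω₂ v₂ z‖ = ‖(f ω₁ v₁ z - f ω₂ v₁ z) + (f ω₂ v₁ z - f ω₂ v₂ z)‖ := by
        rw [sub_add_sub_cancel]
    _ ≤ _ := (norm_add_le _ _).trans (add_le_add A A')

end Normed

section Inner

/-- The inverse of the Riesz isomorphism of a real Hilbert space, as a linear map. -/
noncomputable def toDualSymmCLM (E : Type*) [NormedAddCommGroup E] [InnerProductSpace ℝ E]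
    [CompleteSpace E] : (E →L[ℝ] ℝ) →L[ℝ] E where
  toFun := (InnerProductSpace.toDual ℝ E).symm
  map_add' := map_add _
  map_smul' c x := by simp
  cont := (InnerProductSpace.toDual ℝ E).symm.continuous

variable {E Z : Type*} [NormedAddCommGroup E] [InnerProductSpace ℝ E] [CompleteSpace E]
  [TopologicalSpace Z] {n : ℕ} {f : E → ℝ → Z → ℝ}

theorem norm_gradient (g : E → ℝ) (ω : E) : ‖gradient g ω‖ = ‖fderiv ℝ g ω‖ :=
  (InnerProductSpace.toDual ℝ E).symm.norm_map _

theorem gradient_left (hf : JointContDiff (n + 1) f) :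
    JointContDiff n fun ω v z => gradient (fun ω => f ω v z) ω := by
  simp only [gradient, (hf.hasFDerivAt_left _ _ _).fderiv]
  exact hf.clm_fderiv ((toDualSymmCLM E).comp
      ((ContinuousLinearMap.compL ℝ E (E × ℝ) ℝ).flip (ContinuousLinearMap.inl ℝ E ℝ)))

theorem deriv_gradient_eq (hf : JointContDiff (n + 2) f) (ω : E) (v : ℝ) (z : Z) :
    deriv (fun v => gradient (fun ω => f ω v z) ω) v =
      gradient (fun ω => deriv (fun v => f ω v z) v) ω := by
  set F : E × ℝ → ℝ := fun p => f p.1 p.2 z with hF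
  have hF2 : ContDiff ℝ 2 F := (hf.contDiff z).of_le (by norm_cast; omega)
  have hd : DifferentiableAt ℝ (fderiv ℝ F) (ω, v) :=
    ((hF2.fderiv_right (m := 1) (by norm_num)).differentiable (by norm_num)).differentiableAt
  have hsymm : IsSymmSndFDerivAt ℝ F (ω, v) :=
    hF2.contDiffAt.isSymmSndFDerivAt (by simp)
  have h1 : HasDerivAt (fun v => fderiv ℝ F (ω, v)) (fderiv ℝ (fderiv ℝ F) (ω, v) (0, 1)) v :=
    HasFDerivAt.comp_hasDerivAt (l := fderiv ℝ F) (f := fun v => (ω, v)) v hd.hasFDerivAt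
      ((hasDerivAt_const v ω).prodMk (hasDerivAt_id v))
  have h2 : HasFDerivAt (fun ω => fderiv ℝ F (ω, v))
      ((fderiv ℝ (fderiv ℝ F) (ω, v)).comp (ContinuousLinearMap.inl ℝ E ℝ)) ω :=
    HasFDerivAt.comp (g := fderiv ℝ F) (f := fun ω => (ω, v)) ω hd.hasFDerivAt
      (hasFDerivAt_prodMk_left (𝕜 := ℝ) ω v)
  have h3 := ((toDualSymmCLM E).comp ((ContinuousLinearMap.compL ℝ E (E × ℝ) ℝ).flip
        (ContinuousLinearMap.inl ℝ E ℝ))).hasFDerivAt.comp_hasDerivAt v h1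
  have h4 := (ContinuousLinearMap.apply ℝ ℝ ((0, 1) : E × ℝ)).hasFDerivAt.comp ω h2
  have e1 : (fun v => gradient (fun ω => f ω v z) ω) =
      ((toDualSymmCLM E).comp ((ContinuousLinearMap.compL ℝ E (E × ℝ) ℝ).flip
        (ContinuousLinearMap.inl ℝ E ℝ))) ∘ fun v => fderiv ℝ F (ω, v) := by
    funext v
    simp only [gradient, (hf.hasFDerivAt_left _ _ _).fderiv]
    rfl
  have e2 : (fun ω => deriv (fun v => f ω v z) v) =
      (ContinuousLinearMap.apply ℝ ℝ ((0, 1) : E × ℝ)) ∘ fun ω => fderiv ℝ F (ω, v) := by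
    funext ω
    simp only [(hf.hasDerivAt_right _ _ _).deriv]
    rfl
  rw [e1, h3.deriv, gradient, e2, h4.fderiv]
  refine congrArg (InnerProductSpace.toDual ℝ E).symm ?_
  ext e
  exact hsymm.eq _ _

end Inner

end JointContDiff

section RegularizedRisk

variable {H X Z : Type*} [NormedAddCommGroup H] [InnerProductSpace ℝ H]
  {φ : X → H} {Y : Set Z} {r : ℝ}

theorem abs_inner_le_of_norm_le (hφb : ∀ x, ‖φ x‖ ≤ r) (h : H) (x : X) :
    |⟪h, φ x⟫| ≤ ‖h‖ * r :=
  (abs_real_inner_le_norm _ _).trans (mul_le_mul_of_nonneg_left (hφb x) (norm_nonneg _))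

theorem exists_abs_le_of_continuous [TopologicalSpace Z] (hY : IsCompact Y) {g : ℝ → Z → ℝ}
    (hg : Continuous fun t : ℝ × Z => g t.1 t.2) (R : ℝ) :
    ∃ C, ∀ v, |v| ≤ R → ∀ y ∈ Y, |g v y| ≤ C := by
  obtain ⟨C, hC⟩ := ((isCompact_Icc (a := -R) (b := R)).prod hY).exists_bound_of_continuousOn
    hg.continuousOn
  exact ⟨C, fun v hv y hy => hC (v, y) ⟨abs_le.1 hv, hy⟩⟩

/-- A lower bound on the integrand turns an energy identity into a norm bound. -/
theorem mul_norm_le_of_integral_add_eq_zero [MeasurableSpace X] [MeasurableSpace Z]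
    {P : Measure (X × Z)} [IsProbabilityMeasure P] {G : X × Z → ℝ} {lam c : ℝ}
    (hc : 0 ≤ c) {k : H} (hG : Integrable G P) (heq : (∫ p, G p ∂P) + lam * ⟪k, k⟫ = 0)
    (hlow : ∀ᵐ p ∂P, -(c * ‖k‖) ≤ G p) : lam * ‖k‖ ≤ c := by
  have h1 : -(c * ‖k‖) ≤ ∫ p, G p ∂P := by
    simpa using integral_mono_ae (integrable_const _) hG hlow
  rw [real_inner_self_eq_norm_sq] at heq
  rcases (norm_nonneg k).eq_or_lt with h0 | h0
  · simpa [← h0] using hc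
  · exact le_of_mul_le_mul_right (by nlinarith) h0

variable [MeasurableSpace X] [MeasurableSpace H] [BorelSpace H]
  [TopologicalSpace Z] [SecondCountableTopology Z] [MeasurableSpace Z] [BorelSpace Z]
  {P : Measure (X × Z)}

theorem aestronglyMeasurable_comp_inner (hφm : Measurable φ) {g : ℝ → Z → ℝ}
    (hg : Continuous fun t : ℝ × Z => g t.1 t.2) (h : H) :
    AEStronglyMeasurable (fun p : X × Z => g ⟪h, φ p.1⟫ p.2) P := by
  have hm : Measurable fun p : X × Z => ⟪h, φ p.1⟫ :=
    ((innerSL ℝ h).continuous.measurable.comp hφm).comp measurable_fst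
  exact (hg.measurable.comp (hm.prodMk measurable_snd)).aestronglyMeasurable

theorem integrable_comp_inner [IsFiniteMeasure P] (hφm : Measurable φ) (hφb : ∀ x, ‖φ x‖ ≤ r)
    (hY : IsCompact Y) (hPY : ∀ᵐ p ∂P, p.2 ∈ Y) {g : ℝ → Z → ℝ}
    (hg : Continuous fun t : ℝ × Z => g t.1 t.2) (h : H) :
    Integrable (fun p : X × Z => g ⟪h, φ p.1⟫ p.2) P := by
  obtain ⟨C, hC⟩ := exists_abs_le_of_continuous hY hg (‖h‖ * r)
  refine Integrable.of_bound (aestronglyMeasurable_comp_inner hφm hg h) C ?_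
  filter_upwards [hPY] with p hp
  exact hC _ (abs_inner_le_of_norm_le hφb h p.1) _ hp

theorem integrable_comp_inner_mul_inner [IsFiniteMeasure P] (hφm : Measurable φ)
    (hφb : ∀ x, ‖φ x‖ ≤ r) (hY : IsCompact Y) (hPY : ∀ᵐ p ∂P, p.2 ∈ Y) {g : ℝ → Z → ℝ}
    (hg : Continuous fun t : ℝ × Z => g t.1 t.2) (h k : H) :
    Integrable (fun p : X × Z => g ⟪h, φ p.1⟫ p.2 * ⟪k, φ p.1⟫) P :=
  (integrable_comp_inner hφm hφb hY hPY hg h).mul_bdd (c := ‖k‖ * r)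
    (aestronglyMeasurable_comp_inner hφm (g := fun v _ => v) continuous_fst k)
    (Filter.Eventually.of_forall fun p => abs_inner_le_of_norm_le hφb k p.1)

/-- First-order optimality condition for a minimizer of the regularized risk. -/
theorem integral_deriv_mul_inner_add_eq_zero [IsFiniteMeasure P] (hφm : Measurable φ)
    (hφb : ∀ x, ‖φ x‖ ≤ r) (hY : IsCompact Y) (hPY : ∀ᵐ p ∂P, p.2 ∈ Y) {g g' : ℝ → Z → ℝ}
    (hg : Continuous fun t : ℝ × Z => g t.1 t.2) (hg' : Continuous fun t : ℝ × Z => g' t.1 t.2)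
    (hgg' : ∀ v z, HasDerivAt (fun v => g v z) (g' v z) v) {lam : ℝ} {h₀ : H}
    (hmin : ∀ h : H, (∫ p, g ⟪h₀, φ p.1⟫ p.2 ∂P) + lam / 2 * ‖h₀‖ ^ 2 ≤
      (∫ p, g ⟪h, φ p.1⟫ p.2 ∂P) + lam / 2 * ‖h‖ ^ 2) (k : H) :
    (∫ p, g' ⟪h₀, φ p.1⟫ p.2 * ⟪k, φ p.1⟫ ∂P) + lam * ⟪h₀, k⟫ = 0 := by
  obtain ⟨C, hC⟩ := exists_abs_le_of_continuous hY hg' ((‖h₀‖ + ‖k‖) * r)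
  have hd := (hasDerivAt_integral_of_dominated_loc_of_deriv_le (μ := P) (𝕜 := ℝ) (x₀ := (0 : ℝ))
    (F := fun t p => g ⟪h₀ + t • k, φ p.1⟫ p.2)
    (F' := fun t p => g' ⟪h₀ + t • k, φ p.1⟫ p.2 * ⟪k, φ p.1⟫)
    (bound := fun _ => C * (‖k‖ * r)) (Metric.ball_mem_nhds (0 : ℝ) one_pos)
    (Filter.Eventually.of_forall fun t => aestronglyMeasurable_comp_inner hφm hg _)
    (integrable_comp_inner hφm hφb hY hPY hg _)
    (integrable_comp_inner_mul_inner hφm hφb hY hPY hg' _ _).aestronglyMeasurable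
    (by
      filter_upwards [hPY] with p hp t ht
      have hr : 0 ≤ r := (norm_nonneg _).trans (hφb p.1)
      have ht' : ‖t • k‖ ≤ ‖k‖ := by
        rw [norm_smul]
        exact mul_le_of_le_one_left (norm_nonneg _) (mem_ball_zero_iff.1 ht).le
      have h1 : |g' ⟪h₀ + t • k, φ p.1⟫ p.2| ≤ C := by
        refine hC _ ((abs_inner_le_of_norm_le hφb _ p.1).trans ?_) _ hp
        exact mul_le_mul_of_nonneg_right ((norm_add_le _ _).trans (by gcongr)) hr
      rw [norm_mul]
      exact mul_le_mul h1 (abs_inner_le_of_norm_le hφb k p.1) (norm_nonneg _)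
        ((abs_nonneg _).trans h1))
    (integrable_const _)
    (by
      refine Filter.Eventually.of_forall fun p t _ => ?_
      have h1 : HasDerivAt (fun t : ℝ => ⟪h₀ + t • k, φ p.1⟫) ⟪k, φ p.1⟫ t := by
        simp only [inner_add_left, real_inner_smul_left]
        simpa using ((hasDerivAt_id t).mul_const ⟪k, φ p.1⟫).const_add ⟪h₀, φ p.1⟫
      exact (hgg' _ p.2).comp t h1)).2
  have hq : HasDerivAt (fun t : ℝ => lam / 2 * ‖h₀ + t • k‖ ^ 2) (lam * ⟪h₀, k⟫) 0 := by
    have h1 : HasDerivAt (fun t : ℝ => h₀ + t • k) k 0 := by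
      simpa using ((hasDerivAt_id (0 : ℝ)).smul_const k).const_add h₀
    refine (h1.norm_sq.const_mul (lam / 2)).congr_deriv ?_
    rw [zero_smul, add_zero]
    ring
  have hloc : IsLocalMin ((fun t : ℝ => ∫ p, g ⟪h₀ + t • k, φ p.1⟫ p.2 ∂P) +
      fun t : ℝ => lam / 2 * ‖h₀ + t • k‖ ^ 2) 0 :=
    Filter.Eventually.of_forall fun t => by
      simpa only [Pi.add_apply, zero_smul, add_zero] using hmin (h₀ + t • k)
  simpa using hloc.hasDerivAt_eq_zero (hd.add hq)

/-- Stability of critical points of the regularized risk of a convex loss: perturbing the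
derivative of the loss by at most `c` moves the critical point by at most `c * r / lam`. -/
theorem mul_norm_sub_le_of_critical [IsProbabilityMeasure P] (hφm : Measurable φ)
    (hφb : ∀ x, ‖φ x‖ ≤ r) (hr : 0 ≤ r) (hY : IsCompact Y) (hPY : ∀ᵐ p ∂P, p.2 ∈ Y)
    {g₁ g₂ : ℝ → Z → ℝ} (hg₁ : Continuous fun t : ℝ × Z => g₁ t.1 t.2)
    (hg₂ : Continuous fun t : ℝ × Z => g₂ t.1 t.2) (hmono : ∀ z, Monotone fun v => g₁ v z)
    {lam c : ℝ} (hc : 0 ≤ c) {h₁ h₂ : H}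
    (hcrit₁ : ∀ k, (∫ p, g₁ ⟪h₁, φ p.1⟫ p.2 * ⟪k, φ p.1⟫ ∂P) + lam * ⟪h₁, k⟫ = 0)
    (hcrit₂ : ∀ k, (∫ p, g₂ ⟪h₂, φ p.1⟫ p.2 * ⟪k, φ p.1⟫ ∂P) + lam * ⟪h₂, k⟫ = 0)
    (hsub : ∀ x, ∀ y ∈ Y, |g₁ ⟪h₂, φ x⟫ y - g₂ ⟪h₂, φ x⟫ y| ≤ c) :
    lam * ‖h₁ - h₂‖ ≤ c * r := by
  have i₁ := integrable_comp_inner_mul_inner hφm hφb hY hPY hg₁ h₁ (h₁ - h₂)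
  have i₂ := integrable_comp_inner_mul_inner hφm hφb hY hPY hg₂ h₂ (h₁ - h₂)
  refine mul_norm_le_of_integral_add_eq_zero (mul_nonneg hc hr) (i₁.sub i₂) ?_ ?_
  · have e₁ := hcrit₁ (h₁ - h₂)
    have e₂ := hcrit₂ (h₁ - h₂)
    rw [integral_sub' i₁ i₂, inner_sub_left]
    linarith
  · filter_upwards [hPY] with p hp
    simp only [Pi.sub_apply]
    have hk := abs_inner_le_of_norm_le hφb (h₁ - h₂) p.1
    have hs := hsub p.1 p.2 hp
    have hm : 0 ≤ (g₁ ⟪h₁, φ p.1⟫ p.2 - g₁ ⟪h₂, φ p.1⟫ p.2) * ⟪h₁ - h₂, φ p.1⟫ := by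
      rw [inner_sub_left]
      rcases le_total ⟪h₁, φ p.1⟫ ⟪h₂, φ p.1⟫ with h | h
      · exact mul_nonneg_of_nonpos_of_nonpos (sub_nonpos.2 (hmono p.2 h)) (sub_nonpos.2 h)
      · exact mul_nonneg (sub_nonneg.2 (hmono p.2 h)) (sub_nonneg.2 h)
    have hp' := (abs_mul _ _).trans_le (mul_le_mul hs hk (abs_nonneg _) hc)
    have := neg_le_of_abs_le hp'
    linarith

end RegularizedRisk

theorem le_csSup_image_of_subset_isCompact {α : Type*} [TopologicalSpace α] {s t : Set α}
    (hst : s ⊆ t) (ht : IsCompact t) {f : α → ℝ} (hf : Continuous f) {a : α} (ha : a ∈ s) :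
    f a ≤ sSup (f '' s) :=
  le_csSup ((ht.bddAbove_image hf.continuousOn).mono (Set.image_mono hst))
    (Set.mem_image_of_mem f ha)

/-- Context as in Statements 4–5 with two losses `ℓ_in, ℓ_out`, and
bounds `M_out, M_in, M̄_out, M̄_in` defined as suprema over `hull(Ω) × V × Y` as in the
paper.  Fix `Λ > 0` with `λ ≤ Λ` and set `Lip_out := (Λ + M_in κ) max(M_out, M̄_out)`
and `Lip_in := (Λ + M_in κ) max(M_in, M̄_in)`.  Then for every `(x, y) ∈ X × Y`, the
maps `ω ↦ ℓ_out(ω, h⋆_ω(x), y)`, `ω ↦ ∂_ω ℓ_out(ω, h⋆_ω(x), y)`,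
`ω ↦ ∂_v ℓ_out(ω, h⋆_ω(x), y)` are `(Lip_out/λ)`-Lipschitz on `hull(Ω)`, and
`ω ↦ ∂_v ℓ_in(ω, h⋆_ω(x), y)`, `ω ↦ ∂²_v ℓ_in(ω, h⋆_ω(x), y)`,
`ω ↦ ∂²_{ω,v} ℓ_in(ω, h⋆_ω(x), y)` are `(Lip_in/λ)`-Lipschitz on `hull(Ω)`. -/
theorem stmt_6 {d q : ℕ} {H X : Type*}
    [NormedAddCommGroup H] [InnerProductSpace ℝ H] [CompleteSpace H]
    [MeasurableSpace X] [MeasurableSpace H] [BorelSpace H]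
    (φ : X → H) (hφm : Measurable φ)
    (κ : ℝ) (hκ : 0 < κ) (hφb : ∀ x : X, ‖φ x‖ ^ 2 ≤ κ)
    (Y : Set (Euc q)) (hY : IsCompact Y)
    (ℓin ℓout : Euc d → ℝ → Euc q → ℝ)
    (hC3in : ∀ y : Euc q, ContDiff ℝ 3 fun p : Euc d × ℝ => ℓin p.1 p.2 y)
    (hC3out : ∀ y : Euc q, ContDiff ℝ 3 fun p : Euc d × ℝ => ℓout p.1 p.2 y)
    (hjcin : ∀ i : ℕ, i ≤ 3 → Continuous fun p : (Euc d × ℝ) × Euc q =>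
      iteratedFDeriv ℝ i (fun r : Euc d × ℝ => ℓin r.1 r.2 p.2) p.1)
    (hjcout : ∀ i : ℕ, i ≤ 3 → Continuous fun p : (Euc d × ℝ) × Euc q =>
      iteratedFDeriv ℝ i (fun r : Euc d × ℝ => ℓout r.1 r.2 p.2) p.1)
    (hconv : ∀ (ω : Euc d) (y : Euc q), ConvexOn ℝ Set.univ fun v : ℝ => ℓin ω v y)
    (P : Measure (X × Euc q)) [IsProbabilityMeasure P] (hPY : ∀ᵐ p ∂P, p.2 ∈ Y)
    (lam : ℝ) (hlam : 0 < lam)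
    (hstar : Euc d → H)
    (hstarMin : ∀ (ω : Euc d) (h : H),
      (∫ p, ℓin ω ⟪hstar ω, φ p.1⟫ p.2 ∂P) + lam / 2 * ‖hstar ω‖ ^ 2 ≤
        (∫ p, ℓin ω ⟪h, φ p.1⟫ p.2 ∂P) + lam / 2 * ‖h‖ ^ 2)
    (Ω : Set (Euc d)) (hΩ : IsCompact Ω)
    (B : ℝ)
    (hB : B = sSup ((fun t : Euc d × Euc q => |deriv (fun v : ℝ => ℓin t.1 v t.2) 0|) ''
      ((convexHull ℝ Ω) ×ˢ Y)))
    (V : Set ℝ) (hV : V = Set.Icc (-(B * κ / lam)) (B * κ / lam))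
    (Mout Min Mbarout Mbarin : ℝ)
    (hMout : Mout = sSup ((fun t : Euc d × ℝ × Euc q =>
      max |ℓout t.1 t.2.1 t.2.2|
        (max ‖gradient (fun ω' : Euc d => ℓout ω' t.2.1 t.2.2) t.1‖
          |deriv (fun v : ℝ => ℓout t.1 v t.2.2) t.2.1|)) ''
      ((convexHull ℝ Ω) ×ˢ V ×ˢ Y)))
    (hMin : Min = sSup ((fun t : Euc d × ℝ × Euc q =>
      max |deriv (fun v : ℝ => ℓin t.1 v t.2.2) t.2.1|
        (max |deriv (fun v : ℝ => deriv (fun v' : ℝ => ℓin t.1 v' t.2.2) v) t.2.1|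
          ‖gradient (fun ω' : Euc d => deriv (fun v : ℝ => ℓin ω' v t.2.2) t.2.1) t.1‖)) ''
      ((convexHull ℝ Ω) ×ˢ V ×ˢ Y)))
    (hMbarout : Mbarout = sSup ((fun t : Euc d × ℝ × Euc q =>
      max ‖fderiv ℝ (fun ω' : Euc d => gradient (fun ω'' : Euc d => ℓout ω'' t.2.1 t.2.2) ω') t.1‖
        (max ‖gradient (fun ω' : Euc d => deriv (fun v : ℝ => ℓout ω' v t.2.2) t.2.1) t.1‖
          |deriv (fun v : ℝ => deriv (fun v' : ℝ => ℓout t.1 v' t.2.2) v) t.2.1|)) ''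
      ((convexHull ℝ Ω) ×ˢ V ×ˢ Y)))
    (hMbarin : Mbarin = sSup ((fun t : Euc d × ℝ × Euc q =>
      max ‖gradient (fun ω' : Euc d =>
          deriv (fun v : ℝ => deriv (fun v' : ℝ => ℓin ω' v' t.2.2) v) t.2.1) t.1‖
        (max |deriv (fun v : ℝ => deriv (fun v' : ℝ =>
            deriv (fun v'' : ℝ => ℓin t.1 v'' t.2.2) v') v) t.2.1|
          ‖fderiv ℝ (fun ω' : Euc d =>
            gradient (fun ω'' : Euc d => deriv (fun v : ℝ => ℓin ω'' v t.2.2) t.2.1) ω') t.1‖)) ''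
      ((convexHull ℝ Ω) ×ˢ V ×ˢ Y)))
    (Λ : ℝ) (hΛ : 0 < Λ) (hlamΛ : lam ≤ Λ)
    (Lipout Lipin : ℝ)
    (hLipout : Lipout = (Λ + Min * κ) * max Mout Mbarout)
    (hLipin : Lipin = (Λ + Min * κ) * max Min Mbarin) :
    ∀ x : X, ∀ y ∈ Y, ∀ ω₁ ∈ convexHull ℝ Ω, ∀ ω₂ ∈ convexHull ℝ Ω,
      (|ℓout ω₁ ⟪hstar ω₁, φ x⟫ y - ℓout ω₂ ⟪hstar ω₂, φ x⟫ y| ≤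
        Lipout / lam * ‖ω₁ - ω₂‖) ∧
      (‖gradient (fun ω' : Euc d => ℓout ω' ⟪hstar ω₁, φ x⟫ y) ω₁ -
          gradient (fun ω' : Euc d => ℓout ω' ⟪hstar ω₂, φ x⟫ y) ω₂‖ ≤
        Lipout / lam * ‖ω₁ - ω₂‖) ∧
      (|deriv (fun v : ℝ => ℓout ω₁ v y) ⟪hstar ω₁, φ x⟫ -
          deriv (fun v : ℝ => ℓout ω₂ v y) ⟪hstar ω₂, φ x⟫| ≤
        Lipout / lam * ‖ω₁ - ω₂‖) ∧
      (|deriv (fun v : ℝ => ℓin ω₁ v y) ⟪hstar ω₁, φ x⟫ -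
          deriv (fun v : ℝ => ℓin ω₂ v y) ⟪hstar ω₂, φ x⟫| ≤
        Lipin / lam * ‖ω₁ - ω₂‖) ∧
      (|deriv (fun v : ℝ => deriv (fun v' : ℝ => ℓin ω₁ v' y) v) ⟪hstar ω₁, φ x⟫ -
          deriv (fun v : ℝ => deriv (fun v' : ℝ => ℓin ω₂ v' y) v) ⟪hstar ω₂, φ x⟫| ≤
        Lipin / lam * ‖ω₁ - ω₂‖) ∧
      (‖gradient (fun ω' : Euc d => deriv (fun v : ℝ => ℓin ω' v y) ⟪hstar ω₁, φ x⟫) ω₁ -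
          gradient (fun ω' : Euc d => deriv (fun v : ℝ => ℓin ω' v y) ⟪hstar ω₂, φ x⟫) ω₂‖ ≤
        Lipin / lam * ‖ω₁ - ω₂‖) := by
  intro x y hy ω₁ hω₁ ω₂ hω₂
  have Jin : JointContDiff 3 ℓin := ⟨by exact_mod_cast hC3in, hjcin⟩
  have Jout : JointContDiff 3 ℓout := ⟨by exact_mod_cast hC3out, hjcout⟩
  have Din := Jin.deriv_right
  have DDin := Din.deriv_right
  have GDin := Din.gradient_left
  have Dout := Jout.deriv_right
  have Gout := Jout.gradient_left
  have hφ : ∀ x, ‖φ x‖ ≤ √κ := fun x => Real.le_sqrt_of_sq_le (hφb x)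
  have hC : Convex ℝ (convexHull ℝ Ω) := convex_convexHull ℝ Ω
  have hCc : IsCompact (closure (convexHull ℝ Ω)) :=
    (isBounded_convexHull.2 hΩ.isBounded).isCompact_closure
  have hVc : Convex ℝ V := hV ▸ convex_Icc _ _
  have hK : IsCompact (closure (convexHull ℝ Ω) ×ˢ V ×ˢ Y) :=
    hCc.prod ((hV ▸ isCompact_Icc : IsCompact V).prod hY)
  have hsub : convexHull ℝ Ω ×ˢ V ×ˢ Y ⊆ closure (convexHull ℝ Ω) ×ˢ V ×ˢ Y :=
    Set.prod_mono_left subset_closure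
  have bB : ∀ ω ∈ convexHull ℝ Ω, ∀ y ∈ Y, |deriv (fun v => ℓin ω v y) 0| ≤ B := by
    intro ω hω y hy
    rw [hB]
    exact le_csSup_image_of_subset_isCompact (Set.prod_mono_left subset_closure) (hCc.prod hY)
      (a := (ω, y))
      (Din.continuous.comp (by fun_prop : Continuous fun t : Euc d × Euc q =>
        (t.1, (0 : ℝ), t.2))).abs ⟨hω, hy⟩
  have bMout : ∀ ω ∈ convexHull ℝ Ω, ∀ v ∈ V, ∀ y ∈ Y, _ ≤ Mout := fun ω hω v hv y hy =>
    hMout ▸ le_csSup_image_of_subset_isCompact hsub hK (a := (ω, v, y))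
      (Jout.continuous.abs.max (Gout.continuous.norm.max Dout.continuous.abs)) ⟨hω, hv, hy⟩
  have bMin : ∀ ω ∈ convexHull ℝ Ω, ∀ v ∈ V, ∀ y ∈ Y, _ ≤ Min := fun ω hω v hv y hy =>
    hMin ▸ le_csSup_image_of_subset_isCompact hsub hK (a := (ω, v, y))
      (Din.continuous.abs.max (DDin.continuous.abs.max GDin.continuous.norm)) ⟨hω, hv, hy⟩
  have bMbarout : ∀ ω ∈ convexHull ℝ Ω, ∀ v ∈ V, ∀ y ∈ Y, _ ≤ Mbarout := fun ω hω v hv y hy =>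
    hMbarout ▸ le_csSup_image_of_subset_isCompact hsub hK (a := (ω, v, y))
      (Gout.fderiv_left.continuous.norm.max
        (Dout.gradient_left.continuous.norm.max Dout.deriv_right.continuous.abs)) ⟨hω, hv, hy⟩
  have bMbarin : ∀ ω ∈ convexHull ℝ Ω, ∀ v ∈ V, ∀ y ∈ Y, _ ≤ Mbarin := fun ω hω v hv y hy =>
    hMbarin ▸ le_csSup_image_of_subset_isCompact hsub hK (a := (ω, v, y))
      (DDin.gradient_left.continuous.norm.max
        (DDin.deriv_right.continuous.abs.max GDin.fderiv_left.continuous.norm)) ⟨hω, hv, hy⟩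
  simp only [max_le_iff] at bMout bMin bMbarout bMbarin
  have hcont : ∀ ω, Continuous fun t : ℝ × Euc q => deriv (fun v => ℓin ω v t.2) t.1 := fun ω =>
    Din.continuous.comp (by fun_prop : Continuous fun t : ℝ × Euc q => (ω, t.1, t.2))
  have hdiff : ∀ ω y, Differentiable ℝ fun v => ℓin ω v y := fun ω y v =>
    (Jin.hasDerivAt_right ω v y).differentiableAt
  have hmono : ∀ ω y, Monotone fun v => deriv (fun v => ℓin ω v y) v := fun ω y =>
    monotoneOn_univ.1 ((hconv ω y).monotoneOn_deriv fun v _ => hdiff ω y v)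
  have hcrit : ∀ ω k, (∫ p, deriv (fun v => ℓin ω v p.2) ⟪hstar ω, φ p.1⟫ * ⟪k, φ p.1⟫ ∂P) +
      lam * ⟪hstar ω, k⟫ = 0 := fun ω k =>
    integral_deriv_mul_inner_add_eq_zero hφm hφ hY hPY (g := ℓin ω)
      (Jin.continuous.comp (by fun_prop : Continuous fun t : ℝ × Euc q => (ω, t.1, t.2)))
      (hcont ω) (fun v y => (hdiff ω y v).hasDerivAt) (hstarMin ω) k
  have hB0 : 0 ≤ B := (abs_nonneg _).trans (bB ω₁ hω₁ y hy)
  have hmem : ∀ ω ∈ convexHull ℝ Ω, ∀ x, ⟪hstar ω, φ x⟫ ∈ V := by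
    intro ω hω x
    have h1 : lam * ‖hstar ω - 0‖ ≤ B * √κ :=
      mul_norm_sub_le_of_critical hφm hφ (Real.sqrt_nonneg κ) hY hPY (hcont ω)
        (g₂ := fun _ _ => 0) continuous_const (hmono ω) hB0 (hcrit ω) (by simp)
        (fun x y hy => by simpa using bB ω hω y hy)
    rw [sub_zero] at h1
    rw [hV]
    refine abs_le.1 ((abs_inner_le_of_norm_le hφ _ x).trans ((le_div_iff₀' hlam).2 ?_))
    calc lam * (‖hstar ω‖ * √κ) = lam * ‖hstar ω‖ * √κ := by ring
      _ ≤ B * √κ * √κ := by gcongr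
      _ = B * κ := by rw [mul_assoc, Real.mul_self_sqrt hκ.le]
  have m₁ := hmem ω₁ hω₁ x
  have m₂ := hmem ω₂ hω₂ x
  have hMin0 : 0 ≤ Min := (abs_nonneg _).trans (bMin ω₁ hω₁ _ m₁ y hy).1
  have hMout0 : 0 ≤ Mout := (abs_nonneg _).trans (bMout ω₁ hω₁ _ m₁ y hy).1
  have hMbarin0 : 0 ≤ Mbarin := (norm_nonneg _).trans (bMbarin ω₁ hω₁ _ m₁ y hy).1
  have hMbarout0 : 0 ≤ Mbarout := (norm_nonneg _).trans (bMbarout ω₁ hω₁ _ m₁ y hy).1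
  have lipDin : ∀ y ∈ Y, ∀ v₁ ∈ V, ∀ v₂ ∈ V,
      |deriv (fun v => ℓin ω₁ v y) v₁ - deriv (fun v => ℓin ω₂ v y) v₂| ≤
        Min * ‖ω₁ - ω₂‖ + Min * |v₁ - v₂| := fun y hy v₁ hv₁ v₂ hv₂ =>
    Din.norm_sub_le hC hVc
      (fun ω hω v hv => (JointContDiff.norm_gradient _ _).symm.trans_le (bMin ω hω v hv y hy).2.2)
      (fun ω hω v hv => (bMin ω hω v hv y hy).2.1) hω₁ hω₂ hv₁ hv₂
  have hlip : lam * |⟪hstar ω₁, φ x⟫ - ⟪hstar ω₂, φ x⟫| ≤ Min * κ * ‖ω₁ - ω₂‖ := by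
    have h1 : lam * ‖hstar ω₁ - hstar ω₂‖ ≤ Min * ‖ω₁ - ω₂‖ * √κ :=
      mul_norm_sub_le_of_critical hφm hφ (Real.sqrt_nonneg κ) hY hPY (hcont ω₁)
        (g₂ := fun v y => deriv (fun v => ℓin ω₂ v y) v) (hcont ω₂) (hmono ω₁)
        (by positivity) (hcrit ω₁) (hcrit ω₂) fun x y hy => by
          simpa using lipDin y hy _ (hmem ω₂ hω₂ x) _ (hmem ω₂ hω₂ x)
    rw [← inner_sub_left]
    calc lam * |⟪hstar ω₁ - hstar ω₂, φ x⟫| ≤ lam * (‖hstar ω₁ - hstar ω₂‖ * √κ) := by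
          gcongr
          exact abs_inner_le_of_norm_le hφ _ x
      _ = lam * ‖hstar ω₁ - hstar ω₂‖ * √κ := by ring
      _ ≤ Min * ‖ω₁ - ω₂‖ * √κ * √κ := by gcongr
      _ = Min * κ * ‖ω₁ - ω₂‖ := by rw [mul_assoc _ √κ, Real.mul_self_sqrt hκ.le]; ring
  have hfinal : ∀ {D a m : ℝ}, 0 ≤ a → a ≤ m →
      D ≤ a * ‖ω₁ - ω₂‖ + a * |⟪hstar ω₁, φ x⟫ - ⟪hstar ω₂, φ x⟫| →
      D ≤ (Λ + Min * κ) * m / lam * ‖ω₁ - ω₂‖ := by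
    intro D a m ha ham hD
    rw [div_mul_eq_mul_div, le_div_iff₀' hlam]
    calc lam * D ≤ lam * (a * ‖ω₁ - ω₂‖ + a * |⟪hstar ω₁, φ x⟫ - ⟪hstar ω₂, φ x⟫|) := by gcongr
      _ = a * (lam * ‖ω₁ - ω₂‖ + lam * |⟪hstar ω₁, φ x⟫ - ⟪hstar ω₂, φ x⟫|) := by ring
      _ ≤ m * (Λ * ‖ω₁ - ω₂‖ + Min * κ * ‖ω₁ - ω₂‖) := by gcongr; exact ha.trans ham
      _ = (Λ + Min * κ) * m * ‖ω₁ - ω₂‖ := by ring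
  subst hLipout hLipin
  refine ⟨hfinal hMout0 (le_max_left _ _) ?_, hfinal hMbarout0 (le_max_right _ _) ?_,
    hfinal hMbarout0 (le_max_right _ _) ?_,
    hfinal hMin0 (le_max_left _ _) (lipDin y hy _ m₁ _ m₂),
    hfinal hMbarin0 (le_max_right _ _) ?_, hfinal hMbarin0 (le_max_right _ _) ?_⟩
  · exact Jout.norm_sub_le hC hVc
      (fun ω hω v hv => (JointContDiff.norm_gradient _ _).symm.trans_le (bMout ω hω v hv y hy).2.1)
      (fun ω hω v hv => (bMout ω hω v hv y hy).2.2) hω₁ hω₂ m₁ m₂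
  · exact Gout.norm_sub_le hC hVc (fun ω hω v hv => (bMbarout ω hω v hv y hy).1)
      (fun ω hω v hv => (congrArg norm (Jout.deriv_gradient_eq ω v y)).trans_le
        (bMbarout ω hω v hv y hy).2.1) hω₁ hω₂ m₁ m₂
  · exact Dout.norm_sub_le hC hVc
      (fun ω hω v hv =>
        (JointContDiff.norm_gradient _ _).symm.trans_le (bMbarout ω hω v hv y hy).2.1)
      (fun ω hω v hv => (bMbarout ω hω v hv y hy).2.2) hω₁ hω₂ m₁ m₂
  · exact DDin.norm_sub_le hC hVc
      (fun ω hω v hv => (JointContDiff.norm_gradient _ _).symm.trans_le (bMbarin ω hω v hv y hy).1)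
      (fun ω hω v hv => (bMbarin ω hω v hv y hy).2.1) hω₁ hω₂ m₁ m₂
  · exact GDin.norm_sub_le hC hVc (fun ω hω v hv => (bMbarin ω hω v hv y hy).2.2)
      (fun ω hω v hv => (congrArg norm (Din.deriv_gradient_eq ω v y)).trans_le
        (bMbarin ω hω v hv y hy).1) hω₁ hω₂ m₁ m₂
end

section
/- Let Ω be a compact subset of ℝ^d, Z a measurable space, and t : Ω × Z → ℝ a parametric family such that |t_ω(z)| ≤ M for all (ω, z), and such that for some L > 0 the map ω ↦ t_ω(z) is L-Lipschitz for every z ∈ Z. Then there exists a constant c(Ω) ≥ 1 depending only on Ω and d such that for every probability measure μ on Z and every 0 < ε ≤ M, every subset S ⊆ Ω whose associated functions are pairwise ε-separated in L²(μ) — meaning ∫ (t_ω(z) − t_{ω'}(z))² dμ(z) > ε² for all distinct ω, ω' ∈ S — is finite with cardinality at most c(Ω) · (max(L · diam(Ω), M)/ε)^d. -/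
open MeasureTheory
open scoped BigOperators

/-- Volume bound: a finite `δ`-separated set contained in a closed ball of radius `D` around one
of its points has at most `(1 + 2 D / δ) ^ d` elements. -/
lemma card_le_of_separated_of_dist_le {d : ℕ} (T : Finset (EuclideanSpace ℝ (Fin d)))
    {δ D : ℝ} (hδ : 0 < δ) (hD : 0 ≤ D)
    (hsep : ∀ x ∈ T, ∀ y ∈ T, x ≠ y → δ ≤ dist x y) (hdist : ∀ x ∈ T, ∀ y ∈ T, dist x y ≤ D) :
    (T.card : ℝ) ≤ (1 + 2 * D / δ) ^ d := by
  rcases T.eq_empty_or_nonempty with rfl | ⟨x₀, hx₀⟩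
  · simp only [Finset.card_empty, Nat.cast_zero]
    positivity
  set ν : Measure (EuclideanSpace ℝ (Fin d)) := volume
  have hdisj : (T : Set (EuclideanSpace ℝ (Fin d))).PairwiseDisjoint
      fun x => Metric.ball x (δ / 2) := by
    intro x hx y hy hxy
    apply Metric.ball_disjoint_ball
    have := hsep x hx y hy hxy
    linarith
  have hsub : (⋃ x ∈ T, Metric.ball x (δ / 2)) ⊆ Metric.ball x₀ (D + δ / 2) :=
    Set.iUnion₂_subset fun x hx =>
      Metric.ball_subset_ball' (by linarith [hdist x hx x₀ hx₀])
  have hvol : ∑ x ∈ T, ν.real (Metric.ball x (δ / 2)) ≤ ν.real (Metric.ball x₀ (D + δ / 2)) := by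
    rw [← measureReal_biUnion_finset hdisj (fun x _ => measurableSet_ball)
      (fun x _ => measure_ball_lt_top.ne)]
    exact measureReal_mono hsub measure_ball_lt_top.ne
  have hball : ∀ (x : EuclideanSpace ℝ (Fin d)) {r : ℝ}, 0 < r →
      ν.real (Metric.ball x r) = r ^ d * ν.real (Metric.ball 0 1) := by
    intro x r hr
    rw [measureReal_def, Measure.addHaar_ball_of_pos ν x hr, ENNReal.toReal_mul,
      ENNReal.toReal_ofReal (by positivity), finrank_euclideanSpace_fin, measureReal_def]
  have hunit : 0 < ν.real (Metric.ball (0 : EuclideanSpace ℝ (Fin d)) 1) :=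
    ENNReal.toReal_pos (Metric.measure_ball_pos ν 0 one_pos).ne' measure_ball_lt_top.ne
  rw [hball x₀ (by positivity), Finset.sum_congr rfl fun x _ => hball x (half_pos hδ),
    Finset.sum_const, nsmul_eq_mul, ← mul_assoc] at hvol
  have hcard := le_of_mul_le_mul_right hvol hunit
  rw [← le_div_iff₀ (by positivity), ← div_pow] at hcard
  refine hcard.trans_eq ?_
  congr 1
  field_simp
  ring

/-- A set all of whose finite subsets have cardinality at most `B` is finite, of cardinality at
most `B`. -/
lemma Set.finite_and_natCard_le_of_forall_finset {α : Type*} {S : Set α} {B : ℝ}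
    (h : ∀ T : Finset α, (T : Set α) ⊆ S → (T.card : ℝ) ≤ B) :
    S.Finite ∧ (Nat.card S : ℝ) ≤ B := by
  have hfin : S.Finite := by
    by_contra hinf
    obtain ⟨T, hTS, hT⟩ := Set.Infinite.exists_subset_card_eq hinf (⌊B⌋₊ + 1)
    have := h T hTS
    rw [hT] at this
    push_cast at this
    linarith [Nat.lt_floor_add_one B]
  refine ⟨hfin, ?_⟩
  have := h hfin.toFinset (by simp)
  rwa [Nat.card_coe_set_eq, Set.ncard_eq_toFinset_card S hfin]

/-- On a probability space, the integral of the square of a function bounded by `C` is at most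
`C ^ 2`. -/
lemma integral_sq_le_of_abs_le {Z : Type*} [MeasurableSpace Z] {μ : Measure Z}
    [IsProbabilityMeasure μ] {f : Z → ℝ} {C : ℝ} (hf : ∀ z, |f z| ≤ C) :
    ∫ z, f z ^ 2 ∂μ ≤ C ^ 2 := by
  have := integral_mono_of_nonneg (μ := μ) (f := fun z => f z ^ 2) (g := fun _ => C ^ 2)
    (.of_forall fun z => sq_nonneg _) (integrable_const _)
    (.of_forall fun z => sq_le_sq' (neg_le_of_abs_le (hf z)) (le_of_abs_le (hf z)))
  simpa using this

/-- Let `Ω ⊆ ℝ^d` be compact.  There exists a constant `c(Ω) ≥ 1`,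
depending only on `Ω` and `d`, such that for every measurable space `Z`, every
parametric family `t : Ω × Z → ℝ` with `|t_ω(z)| ≤ M` and `ω ↦ t_ω(z)` `L`-Lipschitz
(`L > 0`) for every `z`, every probability measure `μ` on `Z`, and every `0 < ε ≤ M`,
any subset `S ⊆ Ω` whose associated functions are pairwise `ε`-separated in `L²(μ)`
(`∫ (t_ω − t_{ω'})² dμ > ε²` for distinct `ω, ω' ∈ S`) is finite with cardinality at
most `c(Ω) (max(L diam(Ω), M)/ε)^d`. -/
theorem stmt_10 {d : ℕ} (Ω : Set (EuclideanSpace ℝ (Fin d))) (hΩ : IsCompact Ω) :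
    ∃ c : ℝ, 1 ≤ c ∧
      ∀ (Z : Type) (_ : MeasurableSpace Z)
        (t : EuclideanSpace ℝ (Fin d) → Z → ℝ) (M L : ℝ),
        0 < M → 0 < L →
        (∀ ω z, |t ω z| ≤ M) →
        (∀ ω, Measurable (t ω)) →
        (∀ (z : Z) (ω ω' : EuclideanSpace ℝ (Fin d)), |t ω z - t ω' z| ≤ L * ‖ω - ω'‖) →
        ∀ μ : Measure Z, IsProbabilityMeasure μ →
        ∀ ε : ℝ, 0 < ε → ε ≤ M →
        ∀ S : Set (EuclideanSpace ℝ (Fin d)), S ⊆ Ω →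
        (∀ ω ∈ S, ∀ ω' ∈ S, ω ≠ ω' → ε ^ 2 < ∫ z, (t ω z - t ω' z) ^ 2 ∂μ) →
        S.Finite ∧ (Nat.card S : ℝ) ≤ c * (max (L * Metric.diam Ω) M / ε) ^ d := by
  refine ⟨3 ^ d, one_le_pow₀ (by norm_num), ?_⟩
  intro Z _ t M L hM hL _ _ hlip μ _ ε hε hεM S hSΩ hS
  apply Set.finite_and_natCard_le_of_forall_finset
  intro T hTS
  have hsep : ∀ x ∈ T, ∀ y ∈ T, x ≠ y → ε / L ≤ dist x y := by
    intro x hx y hy hxy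
    have hsq : ε ^ 2 < (L * ‖x - y‖) ^ 2 :=
      (hS x (hTS hx) y (hTS hy) hxy).trans_le (integral_sq_le_of_abs_le fun z => hlip z x y)
    rw [div_le_iff₀' hL, dist_eq_norm]
    exact (lt_of_pow_lt_pow_left₀ 2 (by positivity) hsq).le
  have hdist : ∀ x ∈ T, ∀ y ∈ T, dist x y ≤ Metric.diam Ω := fun x hx y hy =>
    Metric.dist_le_diam_of_mem hΩ.isBounded (hSΩ (hTS hx)) (hSΩ (hTS hy))
  have hdiam : 0 ≤ Metric.diam Ω := Metric.diam_nonneg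
  refine (card_le_of_separated_of_dist_le T (div_pos hε hL) hdiam hsep hdist).trans ?_
  rw [← mul_pow]
  gcongr
  have hone : 1 ≤ max (L * Metric.diam Ω) M / ε :=
    (one_le_div hε).2 (hεM.trans (le_max_right _ _))
  have htwo : 2 * Metric.diam Ω / (ε / L) ≤ 2 * (max (L * Metric.diam Ω) M / ε) := by
    rw [show 2 * Metric.diam Ω / (ε / L) = 2 * (L * Metric.diam Ω / ε) by field_simp]
    gcongr
    exact le_max_left _ _
  linarith
end

section
/- Let k ∈ {1, 2}, let Ω be a compact subset of ℝ^d, Z a measurable space, and 𝔻 a probability measure on Z. Let t : Ω × Z^k → ℝ be a parametric family of measurable functions that is degenerate with respect to 𝔻 (for k = 1: E_{z̄∼𝔻}[t_ω(z̄)] = 0 for all ω; for k = 2: E_{z̄∼𝔻}[t_ω(z, z̄)] = E_{z̄∼𝔻}[t_ω(z̄, z)] = 0 for all z ∈ Z and all ω), uniformly bounded by M > 0, and such that ω ↦ t_ω(z_1, …, z_k) is L-Lipschitz for every (z_1, …, z_k). Given i.i.d. samples z_1, …, z_n from 𝔻, define the U-statistic U_n^k t_ω := (1/n)Σ_{i=1}^n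 t_ω(z_i) if k = 1 and U_n^k t_ω := (1/(n(n−1))) Σ_{i≠j} t_ω(z_i, z_j) if k = 2. Then there exists a constant c(Ω) ≥ 1 depending only on Ω and d such that for every p ∈ {1, 2}: E[sup_{ω∈Ω} |U_n^k t_ω|^p]^{1/p} ≤ n^{−k/2} · c(Ω) · max(M · L · diam(Ω), M²)^{1/2}. -/
open MeasureTheory
open scoped BigOperators

/-- A bound on the number of maps `α → β` taking at most `s` values. -/
lemma card_le_of_image_card_le {α β : Type*} [Fintype α] [Fintype β] [DecidableEq α]
    [DecidableEq β] [Nonempty β] (s : ℕ) (T : Finset (α → β))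
    (hT : ∀ f ∈ T, (Finset.univ.image f).card ≤ s) :
    T.card ≤ s ^ Fintype.card α * Fintype.card β ^ s := by
  have hsub : T ⊆ (Finset.univ : Finset ((α → Fin s) × (Fin s → β))).image
      (fun u => u.2 ∘ u.1) := by
    intro f hf
    obtain ⟨e⟩ : Nonempty (↥(Finset.univ.image f) ↪ Fin s) := by
      rw [Function.Embedding.nonempty_iff_card_le]
      rw [Fintype.card_coe, Fintype.card_fin]
      exact hT f hf
    refine Finset.mem_image.2 ⟨(fun a => e ⟨f a, Finset.mem_image_of_mem f (Finset.mem_univ a)⟩,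
      Function.extend e Subtype.val (fun _ => Classical.arbitrary β)), Finset.mem_univ _, ?_⟩
    funext a
    simp only [Function.comp_apply]
    exact e.injective.extend_apply _ _ _
  calc T.card ≤ _ := Finset.card_le_card hsub
    _ ≤ _ := Finset.card_image_le
    _ = _ := by simp [Finset.card_univ]

/-- A function on a product space whose integral over one coordinate vanishes has integral `0`. -/
lemma integral_pi_eq_zero_of_integral_update {Z : Type*} [MeasurableSpace Z] (μ : Measure Z)
    [IsProbabilityMeasure μ] {n : ℕ} (i : Fin n) (F : (Fin n → Z) → ℝ)
    (hF : Integrable F (Measure.pi fun _ => μ))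
    (h : ∀ zs, ∫ z, F (Function.update zs i z) ∂μ = 0) :
    ∫ zs, F zs ∂(Measure.pi fun _ : Fin n => μ) = 0 := by
  cases n with
  | zero => exact i.elim0
  | succ n =>
    have hmp := (measurePreserving_piFinSuccAbove (fun _ : Fin (n + 1) => μ) i).symm
    obtain ⟨z₀⟩ := nonempty_of_isProbabilityMeasure μ
    rw [← hmp.integral_comp' F, integral_prod_symm]
    · refine integral_eq_zero_of_ae (ae_of_all _ fun y => ?_)
      have := h (i.insertNth z₀ y)
      simp only [Fin.update_insertNth] at this
      exact this
    · exact (hmp.integrable_comp_emb (MeasurableEquiv.measurableEmbedding _)).2 hF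

/-- Moments of a completely degenerate chaos of order `k`. -/
lemma integral_sum_pow_le {Z : Type*} [MeasurableSpace Z] (μ : Measure Z)
    [IsProbabilityMeasure μ] {n k : ℕ} (hn : 0 < n) (m : ℕ)
    (Y : (Fin k → Fin n) → (Fin n → Z) → ℝ) {b : ℝ}
    (hmeas : ∀ a, Measurable (Y a)) (hb : ∀ a zs, |Y a zs| ≤ b)
    (hdep : ∀ a i, i ∉ Set.range a → ∀ zs z, Y a (Function.update zs i z) = Y a zs)
    (hdeg : ∀ a i, i ∈ Set.range a → ∀ zs, ∫ z, Y a (Function.update zs i z) ∂μ = 0) :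
    ∫ zs, (∑ a, Y a zs) ^ (2 * m) ∂(Measure.pi fun _ : Fin n => μ) ≤
      ((m * k : ℕ) : ℝ) ^ (2 * m * k) * (n : ℝ) ^ (m * k) * b ^ (2 * m) := by
  classical
  have : Nonempty (Fin n) := ⟨⟨0, hn⟩⟩
  have hbdd (A : Fin (2 * m) → Fin k → Fin n) (zs : Fin n → Z) :
      |∏ r, Y (A r) zs| ≤ b ^ (2 * m) := by
    rw [Finset.abs_prod]
    calc _ ≤ ∏ _r : Fin (2 * m), b := Finset.prod_le_prod (fun _ _ => abs_nonneg _)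
          fun r _ => hb _ _
      _ = _ := by simp
  have hint (A : Fin (2 * m) → Fin k → Fin n) :
      Integrable (fun zs => ∏ r, Y (A r) zs) (Measure.pi fun _ : Fin n => μ) :=
    Integrable.of_bound (Finset.measurable_fun_prod _ fun r _ => hmeas _).aestronglyMeasurable
      _ (ae_of_all _ fun zs => hbdd A zs)
  let T : Finset (Fin (2 * m) → Fin k → Fin n) :=
    Finset.univ.filter fun A => ∀ r l, ∃ r' l', r' ≠ r ∧ A r' l' = A r l
  have hzero : ∀ A ∉ T, ∫ zs, ∏ r, Y (A r) zs ∂(Measure.pi fun _ : Fin n => μ) = 0 := by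
    intro A hA
    simp only [T, Finset.mem_filter, Finset.mem_univ, true_and] at hA
    push Not at hA
    obtain ⟨r, l, hrl⟩ := hA
    refine integral_pi_eq_zero_of_integral_update μ (A r l) _ (hint A) fun zs => ?_
    have hfac (z : Z) : ∏ r', Y (A r') (Function.update zs (A r l) z) =
        Y (A r) (Function.update zs (A r l) z) * ∏ r' ∈ Finset.univ.erase r, Y (A r') zs := by
      rw [← Finset.mul_prod_erase _ _ (Finset.mem_univ r)]
      congr 1
      refine Finset.prod_congr rfl fun r' hr' => hdep _ _ ?_ _ _
      rintro ⟨l', hl'⟩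
      exact hrl r' l' (Finset.ne_of_mem_erase hr') hl'
    simp only [hfac]
    rw [integral_mul_const, hdeg _ _ ⟨l, rfl⟩, zero_mul]
  have hcard : T.card ≤ (m * k) ^ (2 * m * k) * n ^ (m * k) := by
    have h1 : (T.image fun A (u : Fin (2 * m) × Fin k) => A u.1 u.2).card = T.card :=
      Finset.card_image_of_injective _ fun A B hAB => by
        funext r l; exact congrFun hAB (r, l)
    rw [← h1]
    refine (card_le_of_image_card_le (m * k) _ fun f hf => ?_).trans (by simp)
    obtain ⟨A, hA, rfl⟩ := Finset.mem_image.1 hf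
    simp only [T, Finset.mem_filter, Finset.mem_univ, true_and] at hA
    have h2 := Finset.mul_card_image_le_card (s := Finset.univ)
      (f := fun u : Fin (2 * m) × Fin k => A u.1 u.2) (n := 2) (by
        intro i hi
        obtain ⟨⟨r, l⟩, -, rfl⟩ := Finset.mem_image.1 hi
        obtain ⟨r', l', hr, he⟩ := hA r l
        refine Finset.one_lt_card.2 ⟨(r, l), by simp, (r', l'), by simp [he], ?_⟩
        intro h
        exact hr (congrArg Prod.fst h).symm)
    simp only [Finset.card_univ, Fintype.card_prod, Fintype.card_fin] at h2
    nlinarith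
  calc ∫ zs, (∑ a, Y a zs) ^ (2 * m) ∂(Measure.pi fun _ : Fin n => μ)
      = ∑ A : Fin (2 * m) → Fin k → Fin n,
          ∫ zs, ∏ r, Y (A r) zs ∂(Measure.pi fun _ : Fin n => μ) := by
        simp only [Fintype.sum_pow]
        exact integral_finsetSum _ fun A _ => hint A
    _ = ∑ A ∈ T, ∫ zs, ∏ r, Y (A r) zs ∂(Measure.pi fun _ : Fin n => μ) :=
        (Finset.sum_subset (Finset.subset_univ _) fun A _ hA => hzero A hA).symm
    _ ≤ ∑ A ∈ T, b ^ (2 * m) := by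
        refine Finset.sum_le_sum fun A _ => ?_
        have := norm_integral_le_of_norm_le_const
          (f := fun zs => ∏ r, Y (A r) zs)
          (ae_of_all (Measure.pi fun _ : Fin n => μ) (hbdd A))
        simp only [probReal_univ, mul_one] at this
        exact (le_abs_self _).trans this
    _ = T.card * b ^ (2 * m) := by simp
    _ ≤ _ := by
        refine mul_le_mul_of_nonneg_right ?_ ((even_two_mul m).pow_nonneg b)
        exact_mod_cast hcard

/-- Nets of the unit ball of `ℝ^d` for the supremum norm. -/
lemma exists_net (d N : ℕ) (hN : 0 < N) : ∃ S : Finset (Fin d → ℝ), S.card ≤ (3 * N) ^ d ∧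
    ∀ x : Fin d → ℝ, ‖x‖ ≤ 1 → ∃ y ∈ S, ‖x - y‖ ≤ 1 / (N : ℝ) := by
  classical
  refine ⟨(Fintype.piFinset fun _ : Fin d => Finset.Icc (-(N : ℤ)) N).image
    fun a i => (a i : ℝ) / N, ?_, fun x hx => ?_⟩
  · refine Finset.card_image_le.trans ?_
    rw [Fintype.card_piFinset]
    simp only [Int.card_Icc, Finset.prod_const, Finset.card_univ, Fintype.card_fin]
    exact Nat.pow_le_pow_left (by omega) d
  · have hN' : (0 : ℝ) < N := by exact_mod_cast hN
    have hxi (i : Fin d) := abs_le.1 ((norm_le_pi_norm x i).trans hx)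
    refine ⟨fun i => (⌊N * x i⌋ : ℝ) / N, Finset.mem_image.2 ⟨fun i => ⌊N * x i⌋, ?_, rfl⟩, ?_⟩
    · refine Fintype.mem_piFinset.2 fun i => Finset.mem_Icc.2 ⟨Int.le_floor.2 ?_, ?_⟩
      · push_cast; nlinarith [hxi i]
      · have : ((⌊N * x i⌋ : ℤ) : ℝ) ≤ N := (Int.floor_le _).trans (by nlinarith [hxi i])
        exact_mod_cast this
    · refine (pi_norm_le_iff_of_nonneg (by positivity)).2 fun i => ?_
      have h1 := Int.floor_le (N * x i)
      have h2 := Int.lt_floor_add_one (N * x i)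
      have h3 : x i - ⌊N * x i⌋ / N = (N * x i - ⌊N * x i⌋) / N := by field_simp
      rw [Pi.sub_apply, Real.norm_eq_abs, h3, abs_of_nonneg (div_nonneg (by linarith) hN'.le)]
      gcongr
      linarith

/-- Chaining: a process on the unit ball of `ℝ^d` whose increments satisfy a Kolmogorov type moment
bound is dominated, uniformly over the ball, by a random variable with a controlled moment. -/
lemma exists_integrable_dominating (d : ℕ) {A : ℝ} (hA : 0 ≤ A) : ∃ C : ℝ, 0 ≤ C ∧
    ∀ {Θ : Type*} [MeasurableSpace Θ] (P : Measure Θ) [IsProbabilityMeasure P]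
      (V : (Fin d → ℝ) → Θ → ℝ) (b K : ℝ),
      (∀ x, Measurable (V x)) → (∀ x θ, |V x θ| ≤ b) →
      (∀ θ x y, |V x θ - V y θ| ≤ K * ‖x - y‖) →
      (∫ θ, V 0 θ ^ (2 * (4 * d + 2)) ∂P ≤ A) →
      (∀ x y, ∫ θ, (V x θ - V y θ) ^ (2 * (4 * d + 2)) ∂P ≤ A * ‖x - y‖ ^ (4 * d + 2)) →
      ∃ H : Θ → ℝ, Integrable H P ∧ ∫ θ, H θ ∂P ≤ C ∧
        ∀ θ x, ‖x‖ ≤ 1 → |V x θ| ^ (2 * (4 * d + 2)) ≤ H θ := by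
  classical
  set m := 4 * d + 2 with hm
  refine ⟨3 ^ (2 * m) * (A + 2 * (2 ^ (2 * m) * 2 ^ m * 144 ^ d * A) + 1), by positivity, ?_⟩
  intro Θ _ P _ V b K hmeas hb hlip h0 hinc
  have hnet (j : ℕ) : ∃ S : Finset (Fin d → ℝ), (j = 0 → S = {0}) ∧ S.card ≤ (3 * 16 ^ j) ^ d ∧
      ∀ x : Fin d → ℝ, ‖x‖ ≤ 1 → ∃ y ∈ S, ‖x - y‖ ≤ 1 / (16 : ℝ) ^ j := by
    rcases Nat.eq_zero_or_pos j with rfl | hj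
    · exact ⟨{0}, fun _ => rfl, by simpa using Nat.one_le_pow _ _ (by norm_num),
        fun x hx => ⟨0, by simp, by simpa using hx⟩⟩
    · obtain ⟨S, h1, h2⟩ := exists_net d (16 ^ j) (by positivity)
      exact ⟨S, fun h => absurd h hj.ne', h1, fun x hx => by simpa using h2 x hx⟩
  choose S hS0 hScard hSnet using hnet
  let E (j : ℕ) : Finset ((Fin d → ℝ) × (Fin d → ℝ)) :=
    (S j ×ˢ S (j + 1)).filter fun u => ‖u.2 - u.1‖ ≤ 2 * (1 / (16 : ℝ) ^ j)
  let W (j : ℕ) (θ : Θ) : ℝ := ∑ u ∈ E j, (V u.2 θ - V u.1 θ) ^ (2 * m)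
  obtain ⟨J, hJ⟩ : ∃ J : ℕ, K * (1 / (16 : ℝ) ^ J) ≤ 1 := by
    obtain ⟨J, hJ⟩ := pow_unbounded_of_one_lt K (by norm_num : (1 : ℝ) < 16)
    refine ⟨J, ?_⟩
    rw [mul_one_div, div_le_one (by positivity)]
    exact hJ.le
  let R (θ : Θ) : ℝ := V 0 θ ^ (2 * m) +
    ∑ j ∈ Finset.range J, (2 : ℝ) ^ ((j + 1) * (2 * m)) * W j θ + 1
  have hint0 : Integrable (fun θ => V 0 θ ^ (2 * m)) P := by
    refine Integrable.of_bound ((hmeas 0).pow_const _).aestronglyMeasurable (b ^ (2 * m))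
      (ae_of_all _ fun θ => ?_)
    rw [Real.norm_eq_abs, abs_pow]
    exact pow_le_pow_left₀ (abs_nonneg _) (hb _ _) _
  have hintd (x y : Fin d → ℝ) : Integrable (fun θ => (V x θ - V y θ) ^ (2 * m)) P := by
    refine Integrable.of_bound (((hmeas x).sub (hmeas y)).pow_const _).aestronglyMeasurable
      ((b + b) ^ (2 * m)) (ae_of_all _ fun θ => ?_)
    rw [Real.norm_eq_abs, abs_pow]
    exact pow_le_pow_left₀ (abs_nonneg _)
      ((abs_sub _ _).trans (add_le_add (hb _ _) (hb _ _))) _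
  have hintW (j : ℕ) : Integrable (W j) P := integrable_finsetSum _ fun u _ => hintd _ _
  have hintS : Integrable
      (fun θ => ∑ j ∈ Finset.range J, (2 : ℝ) ^ ((j + 1) * (2 * m)) * W j θ) P :=
    integrable_finsetSum _ fun j _ => (hintW j).const_mul _
  have hintR : Integrable R P := (hint0.add hintS).add (integrable_const 1)
  have hWnn (j : ℕ) (θ : Θ) : 0 ≤ W j θ :=
    Finset.sum_nonneg fun u _ => (even_two_mul m).pow_nonneg _
  have hWint (j : ℕ) : (2 : ℝ) ^ ((j + 1) * (2 * m)) * ∫ θ, W j θ ∂P ≤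
      (2 ^ (2 * m) * 2 ^ m * 144 ^ d * A) * (1 / 16) ^ j := by
    have hEcard : ((E j).card : ℝ) ≤ 144 ^ d * 16 ^ (2 * d * j) := by
      have h1 : (E j).card ≤ (3 * 16 ^ j) ^ d * (3 * 16 ^ (j + 1)) ^ d := by
        refine (Finset.card_filter_le _ _).trans ?_
        rw [Finset.card_product]
        exact Nat.mul_le_mul (hScard _) (hScard _)
      have h2 : (3 * 16 ^ j) ^ d * (3 * 16 ^ (j + 1)) ^ d = 144 ^ d * 16 ^ (2 * d * j) := by
        rw [← mul_pow, show 2 * d * j = (2 * j) * d by ring, pow_mul, ← mul_pow]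
        congr 1
        ring
      rw [h2] at h1
      exact_mod_cast h1
    have h3 : ∫ θ, W j θ ∂P ≤ (144 ^ d * 16 ^ (2 * d * j)) * (A * (2 * (1 / 16 ^ j)) ^ m) := by
      calc ∫ θ, W j θ ∂P = ∑ u ∈ E j, ∫ θ, (V u.2 θ - V u.1 θ) ^ (2 * m) ∂P :=
            integral_finsetSum _ fun u _ => hintd _ _
        _ ≤ ∑ u ∈ E j, A * (2 * (1 / (16 : ℝ) ^ j)) ^ m := by
            refine Finset.sum_le_sum fun u hu => (hinc _ _).trans ?_
            have := (Finset.mem_filter.1 hu).2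
            gcongr
        _ = (E j).card * (A * (2 * (1 / (16 : ℝ) ^ j)) ^ m) := by simp
        _ ≤ _ := by gcongr
    calc _ ≤ (2 : ℝ) ^ ((j + 1) * (2 * m)) *
          ((144 ^ d * 16 ^ (2 * d * j)) * (A * (2 * (1 / 16 ^ j)) ^ m)) := by gcongr
      _ = _ := by
        have e1 : (2 : ℝ) ^ ((j + 1) * (2 * m)) = 2 ^ (2 * m) * 4 ^ (m * j) := by
          rw [show (4 : ℝ) = 2 ^ 2 by norm_num, ← pow_mul, ← pow_add]
          congr 1; ring
        have e2 : (2 * (1 / (16 : ℝ) ^ j)) ^ m = 2 ^ m * (1 / 16) ^ (m * j) := by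
          rw [mul_pow, ← one_div_pow, ← pow_mul, mul_comm j m]
        have e3 : (4 : ℝ) ^ (m * j) * 16 ^ (2 * d * j) * (1 / 16) ^ (m * j) = (1 / 16) ^ j := by
          rw [pow_mul 4 m j, pow_mul 16 (2 * d) j, pow_mul (1 / 16) m j, ← mul_pow, ← mul_pow]
          congr 1
          rw [hm, show (4 : ℝ) ^ (4 * d + 2) = 16 ^ (2 * d + 1) by
            rw [show (16 : ℝ) = 4 ^ 2 by norm_num, ← pow_mul]; congr 1; ring,
            one_div_pow]
          rw [show 4 * d + 2 = (2 * d + 1) + 2 * d + 1 by ring, pow_add (16 : ℝ) (2 * d + 1 + 2 * d),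
            pow_add (16 : ℝ) (2 * d + 1) (2 * d)]
          field_simp
        rw [e1, e2, ← e3]
        ring
  refine ⟨fun θ => 3 ^ (2 * m) * R θ, hintR.const_mul _, ?_, fun θ x hx => ?_⟩
  · rw [integral_const_mul]
    refine mul_le_mul_of_nonneg_left ?_ (by positivity)
    have hR : ∫ θ, R θ ∂P = ∫ θ, V 0 θ ^ (2 * m) ∂P +
        ∑ j ∈ Finset.range J, (2 : ℝ) ^ ((j + 1) * (2 * m)) * ∫ θ, W j θ ∂P + 1 := by
      have h1 := integral_add (hint0.add hintS) (integrable_const (1 : ℝ))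
      have h2 := integral_add hint0 hintS
      simp only [Pi.add_apply] at h1
      simp only [R]
      rw [h1, h2, integral_finsetSum _ fun j _ => (hintW j).const_mul _]
      simp [integral_const_mul]
    rw [hR]
    gcongr
    calc _ ≤ ∑ j ∈ Finset.range J, (2 ^ (2 * m) * 2 ^ m * 144 ^ d * A) * (1 / 16 : ℝ) ^ j :=
          Finset.sum_le_sum fun j _ => hWint j
      _ = (∑ j ∈ Finset.range J, (1 / 16 : ℝ) ^ j) * (2 ^ (2 * m) * 2 ^ m * 144 ^ d * A) := by
          rw [← Finset.mul_sum, mul_comm]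
      _ ≤ _ := by
          gcongr
          rw [geom_sum_eq (by norm_num)]
          have h1 : (0 : ℝ) ≤ (1 / 16) ^ J := by positivity
          have h2 : (((1 : ℝ) / 16) ^ J - 1) / (1 / 16 - 1) = 16 / 15 * (1 - (1 / 16) ^ J) := by
            ring
          linarith
  · have hSnn : 0 ≤ ∑ j ∈ Finset.range J, (2 : ℝ) ^ ((j + 1) * (2 * m)) * W j θ :=
      Finset.sum_nonneg fun j _ => mul_nonneg (by positivity) (hWnn j θ)
    have h0nn : 0 ≤ V 0 θ ^ (2 * m) := (even_two_mul m).pow_nonneg _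
    have hRnn : 0 ≤ R θ := by simp only [R]; positivity
    have hm0 : 2 * m ≠ 0 := by omega
    obtain ⟨T, hT0, hT⟩ : ∃ T : ℝ, 0 ≤ T ∧ T ^ (2 * m) = R θ :=
      ⟨R θ ^ (((2 * m : ℕ) : ℝ)⁻¹), by positivity, Real.rpow_inv_natCast_pow hRnn hm0⟩
    have hleT {v : ℝ} (hv : v ^ (2 * m) ≤ R θ) : |v| ≤ T := by
      rw [← hT] at hv
      refine le_of_pow_le_pow_left₀ hm0 hT0 ?_
      rwa [(even_two_mul m).pow_abs]
    choose y hyS hy using fun j => hSnet j x hx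
    have hy0 : y 0 = 0 := by
      have := hyS 0
      rwa [hS0 0 rfl, Finset.mem_singleton] at this
    have hstep (j : ℕ) (hj : j ∈ Finset.range J) :
        |V (y (j + 1)) θ - V (y j) θ| ≤ T * (1 / 2 * (1 / 2) ^ j) := by
      have hmem : (y j, y (j + 1)) ∈ E j := by
        refine Finset.mem_filter.2 ⟨Finset.mem_product.2 ⟨hyS _, hyS _⟩, ?_⟩
        calc ‖y (j + 1) - y j‖ = ‖(x - y j) - (x - y (j + 1))‖ := by congr 1; abel
          _ ≤ ‖x - y j‖ + ‖x - y (j + 1)‖ := norm_sub_le _ _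
          _ ≤ 1 / 16 ^ j + 1 / 16 ^ (j + 1) := add_le_add (hy _) (hy _)
          _ ≤ 1 / 16 ^ j + 1 / 16 ^ j := by
              gcongr
              · norm_num
              · omega
          _ = _ := by ring
      have h1 : (V (y (j + 1)) θ - V (y j) θ) ^ (2 * m) ≤ W j θ :=
        Finset.single_le_sum (f := fun u => (V u.2 θ - V u.1 θ) ^ (2 * m))
          (fun u _ => (even_two_mul m).pow_nonneg _) hmem
      have h2 : (2 ^ (j + 1) * (V (y (j + 1)) θ - V (y j) θ)) ^ (2 * m) ≤ R θ := by
        rw [mul_pow, ← pow_mul]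
        have h3 : (2 : ℝ) ^ ((j + 1) * (2 * m)) * W j θ ≤
            ∑ j ∈ Finset.range J, (2 : ℝ) ^ ((j + 1) * (2 * m)) * W j θ :=
          Finset.single_le_sum (f := fun j => (2 : ℝ) ^ ((j + 1) * (2 * m)) * W j θ)
            (fun j _ => mul_nonneg (by positivity) (hWnn j θ)) hj
        have h4 : (2 : ℝ) ^ ((j + 1) * (2 * m)) * (V (y (j + 1)) θ - V (y j) θ) ^ (2 * m) ≤
          (2 : ℝ) ^ ((j + 1) * (2 * m)) * W j θ := by gcongr
        simp only [R]
        linarith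
      have h5 := hleT h2
      rw [abs_mul, abs_of_pos (by positivity)] at h5
      calc |V (y (j + 1)) θ - V (y j) θ|
          = (2 ^ (j + 1) * |V (y (j + 1)) θ - V (y j) θ|) * (1 / 2 * (1 / 2) ^ j) := by
            rw [one_div_pow, pow_succ]; field_simp
        _ ≤ _ := by gcongr
    have hsum : |V (y J) θ - V 0 θ| ≤ T := by
      rw [← hy0, ← Finset.sum_range_sub (fun j => V (y j) θ) J]
      refine (Finset.abs_sum_le_sum_abs _ _).trans ((Finset.sum_le_sum hstep).trans ?_)
      rw [← Finset.mul_sum, ← Finset.mul_sum, geom_sum_eq (by norm_num)]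
      refine mul_le_of_le_one_right hT0 ?_
      have h1 : (0 : ℝ) ≤ (1 / 2) ^ J := by positivity
      have h2 : (((1 : ℝ) / 2) ^ J - 1) / (1 / 2 - 1) = 2 * (1 - (1 / 2) ^ J) := by ring
      linarith
    have hV0 : |V 0 θ| ≤ T := hleT (by simp only [R]; linarith)
    have hlast : |V x θ - V (y J) θ| ≤ T := by
      have h1 : (1 : ℝ) ≤ T := by
        have : |(1 : ℝ)| ≤ T := hleT (by simp only [R, one_pow]; linarith)
        simpa using this
      refine (hlip _ _ _).trans (le_trans ?_ h1)
      rcases le_total 0 K with hK | hK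
      · exact (mul_le_mul_of_nonneg_left (hy J) hK).trans hJ
      · exact (mul_nonpos_of_nonpos_of_nonneg hK (norm_nonneg _)).trans zero_le_one
    have hfin : |V x θ| ≤ 3 * T := by
      rw [abs_le] at *
      constructor <;> linarith [hsum.1, hsum.2, hV0.1, hV0.2, hlast.1, hlast.2]
    calc |V x θ| ^ (2 * m) ≤ (3 * T) ^ (2 * m) := by gcongr
      _ = _ := by rw [mul_pow, hT]

/-- A bounded set of `ℝ^d` is covered by a Lipschitz image of the unit ball of the supremum norm. -/
lemma exists_parametrization {d : ℕ} (Ω : Set (EuclideanSpace ℝ (Fin d)))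
    (hΩ : Bornology.IsBounded Ω) : ∃ ψ : (Fin d → ℝ) → EuclideanSpace ℝ (Fin d),
      (∀ x y, ‖ψ x - ψ y‖ ≤ Metric.diam Ω * ((d + 1) * ‖x - y‖)) ∧
      ∀ ω ∈ Ω, ∃ x, ‖x‖ ≤ 1 ∧ ψ x = ω := by
  obtain ⟨ω₀, hω₀⟩ : ∃ ω₀ : EuclideanSpace ℝ (Fin d), ∀ ω ∈ Ω, ‖ω - ω₀‖ ≤ Metric.diam Ω := by
    rcases Ω.eq_empty_or_nonempty with rfl | ⟨ω₀, h₀⟩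
    · exact ⟨0, by simp⟩
    · exact ⟨ω₀, fun ω hω => by
        rw [← dist_eq_norm]; exact Metric.dist_le_diam_of_mem hΩ hω h₀⟩
  refine ⟨fun x => ω₀ + Metric.diam Ω • WithLp.toLp 2 x, fun x y => ?_, fun ω hω => ?_⟩
  · have h1 : ω₀ + Metric.diam Ω • WithLp.toLp 2 x - (ω₀ + Metric.diam Ω • WithLp.toLp 2 y) =
        Metric.diam Ω • WithLp.toLp 2 (x - y) := by
      rw [WithLp.toLp_sub, smul_sub]; abel
    rw [h1, norm_smul, Real.norm_of_nonneg Metric.diam_nonneg]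
    refine mul_le_mul_of_nonneg_left ?_ Metric.diam_nonneg
    rw [EuclideanSpace.norm_eq]
    refine Real.sqrt_le_iff.2 ⟨by positivity, ?_⟩
    calc ∑ i, ‖(x - y) i‖ ^ 2 ≤ ∑ _i : Fin d, ‖x - y‖ ^ 2 := by
          gcongr with i
          exact norm_le_pi_norm (x - y) i
      _ = d * ‖x - y‖ ^ 2 := by simp
      _ ≤ ((d + 1) * ‖x - y‖) ^ 2 := by
          rw [mul_pow]
          have : (0 : ℝ) ≤ d := by positivity
          gcongr
          nlinarith
  · rcases (Metric.diam_nonneg (s := Ω)).eq_or_lt' with hD | hD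
    · refine ⟨0, by simp, ?_⟩
      have := hω₀ ω hω
      rw [hD, norm_le_zero_iff, sub_eq_zero] at this
      simp [this]
    · refine ⟨(Metric.diam Ω)⁻¹ • WithLp.ofLp (ω - ω₀), ?_, ?_⟩
      · rw [norm_smul, norm_inv, Real.norm_of_nonneg hD.le, inv_mul_le_iff₀ hD, mul_one]
        refine (pi_norm_le_iff_of_nonneg hD.le).2 fun i => ?_
        exact (PiLp.norm_apply_le (ω - ω₀) i).trans (hω₀ ω hω)
      · beta_reduce
        rw [WithLp.toLp_smul, smul_smul, mul_inv_cancel₀ hD.ne', one_smul]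
        simp

/-- Maximal inequality for a parametric family of completely degenerate chaoses of order `k`. -/
lemma exists_sup_chaos_le (d k : ℕ) : ∃ c : ℝ, 1 ≤ c ∧
    ∀ (Ω : Set (EuclideanSpace ℝ (Fin d))), Bornology.IsBounded Ω →
    ∀ {Z : Type*} [MeasurableSpace Z] (μ : Measure Z) [IsProbabilityMeasure μ] (M L : ℝ),
      0 < M → 0 < L → ∀ {n : ℕ}, 0 < n →
      ∀ (Y : EuclideanSpace ℝ (Fin d) → (Fin k → Fin n) → (Fin n → Z) → ℝ),
      (∀ ω a, Measurable (Y ω a)) → (∀ ω a zs, |Y ω a zs| ≤ M) →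
      (∀ a zs ω ω', |Y ω a zs - Y ω' a zs| ≤ L * ‖ω - ω'‖) →
      (∀ ω a i, i ∉ Set.range a → ∀ zs z, Y ω a (Function.update zs i z) = Y ω a zs) →
      (∀ ω a i, i ∈ Set.range a → ∀ zs, ∫ z, Y ω a (Function.update zs i z) ∂μ = 0) →
      ∀ s : ℝ, 0 < s → ∀ p : ℝ, (p = 1 ∨ p = 2) →
      (∫ zs, (⨆ ω : Ω, |s * ∑ a, Y ω a zs| ^ p) ∂(Measure.pi fun _ : Fin n => μ)) ^ (1 / p) ≤
        s * Real.sqrt n ^ k * c * Real.sqrt (max (M * L * Metric.diam Ω) (M ^ 2)) := by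
  set m := 4 * d + 2 with hm
  set c₀ : ℝ := ((m * k : ℕ) : ℝ) ^ (2 * m * k)
  have hc₀nn : 0 ≤ c₀ := by positivity
  obtain ⟨C, hC0, hC⟩ := exists_integrable_dominating d (A := c₀ * (2 * (d + 1)) ^ m)
    (by positivity)
  refine ⟨1 + C, by linarith, ?_⟩
  intro Ω hΩ Z _ μ _ M L hM hL n hn Y hmeas hb hlip hdep hdeg s hs p hp
  obtain ⟨ψ, hψ, hψsurj⟩ := exists_parametrization Ω hΩ
  set D := Metric.diam Ω
  have hD0 : 0 ≤ D := Metric.diam_nonneg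
  set Q := max (M * L * D) (M ^ 2)
  have hMQ : M ^ 2 ≤ Q := le_max_right _ _
  have hLQ : M * L * D ≤ Q := le_max_left _ _
  have hQ0 : 0 < Q := lt_of_lt_of_le (by positivity) hMQ
  have hn' : (0 : ℝ) < n := by exact_mod_cast hn
  set κ : ℝ := (Real.sqrt n ^ k * Real.sqrt Q)⁻¹ with hκ
  have hκ0 : 0 < κ := by positivity
  have hκpow : κ ^ (2 * m) * (n : ℝ) ^ (m * k) * Q ^ m = 1 := by
    have h1 : κ ^ 2 * (n : ℝ) ^ k * Q = 1 := by
      rw [hκ, inv_pow, mul_pow, ← pow_mul, mul_comm k 2, pow_mul, Real.sq_sqrt hn'.le,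
        Real.sq_sqrt hQ0.le]
      field_simp
    rw [pow_mul, mul_comm m k, pow_mul (n : ℝ), ← mul_pow, ← mul_pow, h1, one_pow]
  let P : Measure (Fin n → Z) := Measure.pi fun _ => μ
  let V (x : Fin d → ℝ) (zs : Fin n → Z) : ℝ := κ * ∑ a, Y (ψ x) a zs
  have hsumint {F : (Fin k → Fin n) → (Fin n → Z) → ℝ} {b : ℝ} {q : ℝ}
      (hFm : ∀ a, Measurable (F a)) (hFb : ∀ a zs, |F a zs| ≤ b)
      (hFdep : ∀ a i, i ∉ Set.range a → ∀ zs z, F a (Function.update zs i z) = F a zs)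
      (hFdeg : ∀ a i, i ∈ Set.range a → ∀ zs, ∫ z, F a (Function.update zs i z) ∂μ = 0)
      (hbq : b ^ 2 ≤ Q * q) :
      ∫ zs, (κ * ∑ a, F a zs) ^ (2 * m) ∂P ≤ c₀ * q ^ m := by
    simp only [mul_pow]
    rw [integral_const_mul]
    calc κ ^ (2 * m) * ∫ zs, (∑ a, F a zs) ^ (2 * m) ∂P
        ≤ κ ^ (2 * m) * (c₀ * (n : ℝ) ^ (m * k) * b ^ (2 * m)) :=
          mul_le_mul_of_nonneg_left (integral_sum_pow_le μ hn m F hFm hFb hFdep hFdeg)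
            (by positivity)
      _ ≤ κ ^ (2 * m) * (c₀ * (n : ℝ) ^ (m * k) * (Q * q) ^ m) := by
          rw [pow_mul b]
          gcongr
      _ = (κ ^ (2 * m) * (n : ℝ) ^ (m * k) * Q ^ m) * (c₀ * q ^ m) := by
          rw [mul_pow]; ring
      _ = c₀ * q ^ m := by rw [hκpow, one_mul]
  have hint (ω : EuclideanSpace ℝ (Fin d)) (a : Fin k → Fin n) (i : Fin n) (zs : Fin n → Z) :
      Integrable (fun z => Y ω a (Function.update zs i z)) μ :=
    Integrable.of_bound ((hmeas ω a).comp (measurable_update zs)).aestronglyMeasurable M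
      (ae_of_all _ fun z => hb _ _ _)
  obtain ⟨H, hHint, hHC, hH⟩ := hC P V (κ * ((Fintype.card (Fin k → Fin n)) * M))
    (κ * ((Fintype.card (Fin k → Fin n)) * (L * (D * (d + 1)))))
    (fun x => (Finset.measurable_fun_sum _ fun a _ => hmeas _ a).const_mul κ)
    (fun x zs => by
      simp only [V]
      rw [abs_mul, abs_of_pos hκ0]
      gcongr
      refine (Finset.abs_sum_le_sum_abs _ _).trans ?_
      refine (Finset.sum_le_sum fun a _ => hb _ a zs).trans ?_
      simp)
    (fun zs x y => by
      simp only [V]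
      rw [← mul_sub, ← Finset.sum_sub_distrib, abs_mul, abs_of_pos hκ0, mul_assoc, mul_assoc]
      gcongr
      refine (Finset.abs_sum_le_sum_abs _ _).trans ?_
      refine (Finset.sum_le_sum fun a _ => (hlip a zs _ _).trans
        (mul_le_mul_of_nonneg_left (hψ x y) hL.le)).trans ?_
      simp [mul_assoc])
    (by
      refine (hsumint (hmeas (ψ 0)) (hb (ψ 0)) (hdep (ψ 0)) (hdeg (ψ 0)) (q := 1)
        (by linarith)).trans ?_
      rw [one_pow]
      gcongr
      refine one_le_pow₀ ?_
      have : (0 : ℝ) ≤ d := by positivity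
      linarith)
    (fun x y => by
      have h1 := hsumint (F := fun a zs => Y (ψ x) a zs - Y (ψ y) a zs)
        (b := min (2 * M) (L * (D * ((d + 1) * ‖x - y‖)))) (q := 2 * (d + 1) * ‖x - y‖)
        (fun a => (hmeas _ a).sub (hmeas _ a))
        (fun a zs => le_min
          ((abs_sub _ _).trans (by linarith [hb (ψ x) a zs, hb (ψ y) a zs]))
          ((hlip a zs _ _).trans (mul_le_mul_of_nonneg_left (hψ x y) hL.le)))
        (fun a i hi zs z => by simp only [hdep _ a i hi])
        (fun a i hi zs => by
          rw [integral_sub (hint _ _ _ _) (hint _ _ _ _), hdeg _ a i hi, hdeg _ a i hi, sub_zero])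
        (by
          rw [sq]
          refine (mul_le_mul (min_le_left _ _) (min_le_right _ _)
            (le_min (by positivity) (by positivity)) (by positivity)).trans ?_
          calc 2 * M * (L * (D * ((d + 1) * ‖x - y‖)))
              = (M * L * D) * (2 * (d + 1) * ‖x - y‖) := by ring
            _ ≤ _ := by gcongr)
      rw [mul_pow (2 * ((d : ℝ) + 1)), ← mul_assoc] at h1
      simpa only [V, ← mul_sub, ← Finset.sum_sub_distrib] using h1)
  have hp0 : 0 < p := by rcases hp with rfl | rfl <;> norm_num
  have hp1 : 1 ≤ p := by rcases hp with rfl | rfl <;> norm_num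
  have hp2 : p ≤ (2 * m : ℕ) := by
    have : (2 : ℝ) ≤ (2 * m : ℕ) := by exact_mod_cast (by omega : 2 ≤ 2 * m)
    rcases hp with rfl | rfl <;> linarith
  set τ : ℝ := s * κ⁻¹ with hτ
  have hτ0 : 0 < τ := by positivity
  have hH0 (zs : Fin n → Z) : 0 ≤ H zs :=
    (by positivity : (0 : ℝ) ≤ |V 0 zs| ^ (2 * m)).trans (hH zs 0 (by simp))
  have hpow (u : ℝ) (hu : 0 ≤ u) : u ^ p ≤ 1 + u ^ (2 * m) := by
    rcases le_total u 1 with h | h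
    · have := Real.rpow_le_one hu h hp0.le
      have := pow_nonneg hu (2 * m)
      linarith
    · have := Real.rpow_le_rpow_of_exponent_le h hp2
      rw [Real.rpow_natCast] at this
      linarith
  have hsup (zs : Fin n → Z) : ⨆ ω : Ω, |s * ∑ a, Y ω a zs| ^ p ≤ τ ^ p * (1 + H zs) := by
    refine Real.iSup_le (fun ω => ?_) (mul_nonneg (by positivity) (by linarith [hH0 zs]))
    obtain ⟨x, hx, hxω⟩ := hψsurj ω ω.2
    have h1 : s * ∑ a, Y ω a zs = τ * V x zs := by
      simp only [V, hxω, hτ]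
      field_simp
    rw [h1, abs_mul, abs_of_pos hτ0, Real.mul_rpow hτ0.le (abs_nonneg _)]
    gcongr
    exact (hpow _ (abs_nonneg _)).trans (by linarith [hH zs x hx])
  have hI : ∫ zs, (⨆ ω : Ω, |s * ∑ a, Y ω a zs| ^ p) ∂P ≤ τ ^ p * (1 + C) := by
    calc _ ≤ ∫ zs, τ ^ p * (1 + H zs) ∂P :=
          integral_mono_of_nonneg
            (ae_of_all _ fun zs => Real.iSup_nonneg fun ω => by positivity)
            (((integrable_const 1).add hHint).const_mul _) (ae_of_all _ hsup)
      _ = τ ^ p * (1 + ∫ zs, H zs ∂P) := by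
          rw [integral_const_mul, integral_add (integrable_const 1) hHint]
          simp
      _ ≤ _ := by gcongr
  calc _ ≤ (τ ^ p * (1 + C)) ^ (1 / p) :=
        Real.rpow_le_rpow (integral_nonneg fun zs => Real.iSup_nonneg fun ω => by positivity) hI
          (by positivity)
    _ = τ * (1 + C) ^ (1 / p) := by
        rw [Real.mul_rpow (by positivity) (by positivity), ← Real.rpow_mul hτ0.le,
          mul_one_div_cancel hp0.ne', Real.rpow_one]
    _ ≤ τ * (1 + C) := by
        gcongr
        exact Real.rpow_le_self_of_one_le (by linarith) ((div_le_one hp0).2 hp1)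
    _ = _ := by
        rw [hτ, hκ, inv_inv]; ring

/-- Let `Ω ⊆ ℝ^d` be compact.  There exists a constant `c(Ω) ≥ 1`,
depending only on `Ω` and `d`, such that for every measurable space `Z`, every
probability measure `𝔻` on `Z`, and every uniformly bounded (`|t_ω| ≤ M`, `M > 0`)
parametric family which is `L`-Lipschitz in `ω` and degenerate w.r.t. `𝔻`, the
corresponding `U`-statistic of order `k ∈ {1, 2}` satisfies, for `p ∈ {1, 2}`,
`E[sup_{ω ∈ Ω} |U_n^k t_ω|^p]^{1/p} ≤ n^{−k/2} c(Ω) max(M L diam(Ω), M²)^{1/2}`,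
the expectation being over i.i.d. samples `z₁, …, z_n ∼ 𝔻`.  For `k = 1`,
`U_n^1 t_ω = (1/n)Σᵢ t_ω(zᵢ)` and degeneracy means `E_𝔻[t_ω] = 0`; for `k = 2`,
`U_n^2 t_ω = (1/(n(n−1))) Σ_{i≠j} t_ω(zᵢ, zⱼ)` and degeneracy means
`E_{z̄}[t_ω(z, z̄)] = E_{z̄}[t_ω(z̄, z)] = 0` for all `z`. -/
theorem stmt_11 {d : ℕ} (Ω : Set (EuclideanSpace ℝ (Fin d))) (hΩ : IsCompact Ω) :
    ∃ c : ℝ, 1 ≤ c ∧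
      ∀ (Z : Type) (_ : MeasurableSpace Z) (𝔻 : Measure Z), IsProbabilityMeasure 𝔻 →
        ∀ M L : ℝ, 0 < M → 0 < L →
        -- case `k = 1`
        ((∀ t : EuclideanSpace ℝ (Fin d) → Z → ℝ,
          (∀ ω z, |t ω z| ≤ M) →
          (∀ ω, Measurable (t ω)) →
          (∀ (z : Z) (ω ω' : EuclideanSpace ℝ (Fin d)), |t ω z - t ω' z| ≤ L * ‖ω - ω'‖) →
          (∀ ω, (∫ z, t ω z ∂𝔻) = 0) →
          ∀ (n : ℕ), 0 < n → ∀ p : ℝ, (p = 1 ∨ p = 2) →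
          (∫ zs : Fin n → Z,
              (⨆ ω : Ω, |(1 / (n : ℝ)) * ∑ i, t ω (zs i)| ^ p)
              ∂(Measure.pi fun _ : Fin n => 𝔻)) ^ (1 / p) ≤
            (1 / Real.sqrt n) * c * Real.sqrt (max (M * L * Metric.diam Ω) (M ^ 2))) ∧
        -- case `k = 2`
        (∀ t : EuclideanSpace ℝ (Fin d) → Z → Z → ℝ,
          (∀ ω z z', |t ω z z'| ≤ M) →
          (∀ ω, Measurable fun zz : Z × Z => t ω zz.1 zz.2) →
          (∀ (z z' : Z) (ω ω' : EuclideanSpace ℝ (Fin d)),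
            |t ω z z' - t ω' z z'| ≤ L * ‖ω - ω'‖) →
          (∀ ω z, (∫ z', t ω z z' ∂𝔻) = 0 ∧ (∫ z', t ω z' z ∂𝔻) = 0) →
          ∀ (n : ℕ), 1 < n → ∀ p : ℝ, (p = 1 ∨ p = 2) →
          (∫ zs : Fin n → Z,
              (⨆ ω : Ω,
                |(1 / ((n : ℝ) * ((n : ℝ) - 1))) *
                  ∑ i : Fin n, ∑ j : Fin n, if i = j then 0 else t ω (zs i) (zs j)| ^ p)
              ∂(Measure.pi fun _ : Fin n => 𝔻)) ^ (1 / p) ≤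
            (1 / (n : ℝ)) * c * Real.sqrt (max (M * L * Metric.diam Ω) (M ^ 2)))) := by
  obtain ⟨c₁, hc₁, H₁⟩ := exists_sup_chaos_le d 1
  obtain ⟨c₂, hc₂, H₂⟩ := exists_sup_chaos_le d 2
  refine ⟨c₁ + 2 * c₂, by linarith, ?_⟩
  intro Z _ 𝔻 _ M L hM hL
  refine ⟨?_, ?_⟩
  · intro t hb hmeas hlip hdeg n hn p hp
    have h := H₁ Ω hΩ.isBounded 𝔻 M L hM hL hn (fun ω a zs => t ω (zs (a 0)))
      (fun ω a => (hmeas ω).comp (measurable_pi_apply _)) (fun ω a zs => hb _ _)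
      (fun a zs ω ω' => hlip _ _ _)
      (fun ω a i hi zs z => by
        rw [Function.update_of_ne]
        rintro h
        exact hi ⟨0, h⟩)
      (fun ω a i hi zs => by
        obtain ⟨l, rfl⟩ := hi
        rw [Subsingleton.elim l 0]
        simpa using hdeg ω) (1 / n) (by positivity) p hp
    have hsum (ω : EuclideanSpace ℝ (Fin d)) (zs : Fin n → Z) :
        ∑ a : Fin 1 → Fin n, t ω (zs (a 0)) = ∑ i, t ω (zs i) :=
      Fintype.sum_equiv (Equiv.funUnique (Fin 1) (Fin n)) _ _ fun a => rfl
    simp only [hsum] at h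
    refine h.trans ?_
    have hn' : (0 : ℝ) < n := by exact_mod_cast hn
    have h1 : 1 / (n : ℝ) * Real.sqrt n ^ 1 = 1 / Real.sqrt n := by
      rw [pow_one, one_div_mul_eq_div, Real.sqrt_div_self, one_div]
    rw [h1]
    gcongr
    linarith
  · intro t hb hmeas hlip hdeg n hn p hp
    have hn' : (1 : ℝ) < n := by exact_mod_cast hn
    have hn1 : (0 : ℝ) < n - 1 := by linarith
    have h := H₂ Ω hΩ.isBounded 𝔻 M L hM hL (by omega : 0 < n)
      (fun ω a zs => if a 0 = a 1 then 0 else t ω (zs (a 0)) (zs (a 1)))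
      (fun ω a => by
        split_ifs
        · exact measurable_const
        · have h2 : Measurable fun zs : Fin n → Z => (zs (a 0), zs (a 1)) :=
            (measurable_pi_apply _).prodMk (measurable_pi_apply _)
          exact (hmeas ω).comp h2)
      (fun ω a zs => by
        split_ifs
        · simpa using hM.le
        · exact hb _ _ _)
      (fun a zs ω ω' => by
        split_ifs
        · rw [sub_self, abs_zero]; positivity
        · exact hlip _ _ _ _)
      (fun ω a i hi zs z => by
        rw [Function.update_of_ne fun h => hi ⟨0, h⟩, Function.update_of_ne fun h => hi ⟨1, h⟩])
      (fun ω a i hi zs => by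
        obtain ⟨l, rfl⟩ := hi
        by_cases h01 : a 0 = a 1
        · simp [h01]
        · simp only [h01, if_false]
          fin_cases l
          · simpa [Function.update_of_ne (Ne.symm h01)] using (hdeg ω (zs (a 1))).2
          · simpa [Function.update_of_ne h01] using (hdeg ω (zs (a 0))).1)
      (1 / ((n : ℝ) * ((n : ℝ) - 1))) (by positivity) p hp
    have hsum (ω : EuclideanSpace ℝ (Fin d)) (zs : Fin n → Z) :
        ∑ a : Fin 2 → Fin n, (if a 0 = a 1 then 0 else t ω (zs (a 0)) (zs (a 1))) =
          ∑ i : Fin n, ∑ j : Fin n, if i = j then 0 else t ω (zs i) (zs j) := by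
      rw [← Fintype.sum_prod_type']
      exact Fintype.sum_equiv (finTwoArrowEquiv (Fin n)) _ _ fun a => rfl
    simp only [hsum] at h
    refine h.trans ?_
    rw [Real.sq_sqrt (by positivity)]
    refine mul_le_mul_of_nonneg_right ?_ (Real.sqrt_nonneg _)
    have hn2 : (2 : ℝ) ≤ n := by exact_mod_cast hn
    have h1 : 1 / ((n : ℝ) * (n - 1)) * n ≤ 1 / n * 2 := by
      rw [div_mul_eq_mul_div, div_mul_eq_mul_div, div_le_div_iff₀ (by positivity) (by positivity)]
      nlinarith
    calc 1 / ((n : ℝ) * (n - 1)) * n * c₂ ≤ 1 / n * 2 * c₂ := by gcongr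
      _ = 1 / n * (2 * c₂) := by ring
      _ ≤ _ := by gcongr; linarith
end

section
/- Let Ω be a compact subset of ℝ^d, Z a measurable space, and t : Ω × Z → ℝ a parametric family of measurable functions uniformly bounded by M > 0 such that ω ↦ t_ω(z) is L-Lipschitz for every z ∈ Z. Let 𝔻 be a probability measure on Z and z_1, …, z_n i.i.d. samples from 𝔻. Then there exists a constant c(Ω) ≥ 1 depending only on Ω and d such that for every p ∈ {1, 2}: E[sup_{ω∈Ω} |E_{z∼𝔻}[t_ω(z)] − (1/n)Σ_{i=1}^n t_ω(z_i)|^p]^{1/p} ≤ (1/√n) · c(Ω) · max(M · L · diam(Ω), M²)^{1/2}. -/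
open MeasureTheory
open scoped BigOperators
open ProbabilityTheory

/-- The deviation of the empirical mean of `f` on a sample from its mean. -/
noncomputable def empDev {Z : Type*} [MeasurableSpace Z] (P : Measure Z) {n : ℕ} (f : Z → ℝ)
    (zs : Fin n → Z) : ℝ :=
  (∫ z, f z ∂P) - (1 / (n : ℝ)) * ∑ i, f (zs i)

section EmpDev

variable {Z : Type*} [MeasurableSpace Z] {P : Measure Z} {n : ℕ}

lemma measurable_empDev {f : Z → ℝ} (hf : Measurable f) :
    Measurable (empDev P f : (Fin n → Z) → ℝ) := by
  unfold empDev
  fun_prop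

lemma empDev_sub {f g : Z → ℝ} (hf : Integrable f P) (hg : Integrable g P) (zs : Fin n → Z) :
    empDev P f zs - empDev P g zs = empDev P (fun z => f z - g z) zs := by
  simp only [empDev, integral_sub hf hg, Finset.sum_sub_distrib]
  ring

variable [IsProbabilityMeasure P]

lemma integrable_of_abs_le {f : Z → ℝ} {b : ℝ} (hf : Measurable f) (hb : ∀ z, |f z| ≤ b) :
    Integrable f P :=
  Integrable.of_bound hf.aestronglyMeasurable b (ae_of_all _ fun z => by simpa using hb z)

lemma abs_empDev_le {f : Z → ℝ} {b : ℝ} (hn : 0 < n) (hb : ∀ z, |f z| ≤ b) (zs : Fin n → Z) :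
    |empDev P f zs| ≤ 2 * b := by
  have h1 : |∫ z, f z ∂P| ≤ b := by
    have := norm_integral_le_of_norm_le_const (μ := P) (f := f) (C := b)
      (ae_of_all _ fun z => by simpa using hb z)
    simpa using this
  have h2 : |(1 / (n : ℝ)) * ∑ i, f (zs i)| ≤ b := by
    have hn' : (0 : ℝ) < n := by exact_mod_cast hn
    rw [abs_mul, abs_of_pos (by positivity : (0 : ℝ) < 1 / n)]
    have : |∑ i, f (zs i)| ≤ n * b := by
      refine (Finset.abs_sum_le_sum_abs _ _).trans ?_
      refine (Finset.sum_le_sum fun i _ => hb (zs i)).trans ?_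
      simp
    calc 1 / (n : ℝ) * |∑ i, f (zs i)| ≤ 1 / (n : ℝ) * (n * b) := by gcongr
      _ = b := by field_simp
  unfold empDev
  exact (abs_sub _ _).trans (by linarith)

/-- Hoeffding's bound for the moment generating function of an empirical mean. -/
lemma integral_exp_empDev_le {f : Z → ℝ} {b : ℝ} (hn : 0 < n) (hf : Measurable f)
    (hb : ∀ z, |f z| ≤ b) (s : ℝ) :
    ∫ zs : Fin n → Z, Real.exp (s * empDev P f zs) ∂(Measure.pi fun _ => P) ≤
      Real.exp (b ^ 2 * s ^ 2 / (2 * n)) := by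
  have hn' : (n : ℝ) ≠ 0 := by exact_mod_cast hn.ne'
  have hsub := hasSubgaussianMGF_of_mem_Icc (μ := P) (X := f) (a := -b) (b := b) hf.aemeasurable
    (ae_of_all _ fun z => abs_le.mp (hb z))
  have hmgf := hsub.mgf_le (-s / n)
  have hc : (((‖b - -b‖₊ / 2) ^ 2 : NNReal) : ℝ) = b ^ 2 := by
    push_cast
    rw [Real.norm_eq_abs, div_pow, sq_abs]
    ring
  rw [hc] at hmgf
  have heq : ∀ zs : Fin n → Z, Real.exp (s * empDev P f zs) =
      ∏ i, Real.exp (-s / n * (f (zs i) - ∫ z, f z ∂P)) := by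
    intro zs
    rw [← Real.exp_sum, ← Finset.mul_sum, Finset.sum_sub_distrib]
    congr 1
    simp only [empDev, Finset.sum_const, Finset.card_univ, Fintype.card_fin, nsmul_eq_mul]
    field_simp
    ring
  simp_rw [heq]
  rw [integral_fintype_prod_eq_pow (fun z => Real.exp (-s / n * (f z - ∫ z, f z ∂P)))]
  refine (pow_le_pow_left₀ (integral_nonneg fun _ => (Real.exp_pos _).le) hmgf _).trans ?_
  rw [← Real.exp_nat_mul, Fintype.card_fin]
  refine (congrArg Real.exp ?_).le
  field_simp

lemma pow_two_mul_le_exp_add_exp (x : ℝ) (q : ℕ) :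
    x ^ (2 * q) ≤ (2 * q).factorial * (Real.exp x + Real.exp (-x)) := by
  have h := Real.pow_div_factorial_le_exp |x| (abs_nonneg x) (2 * q)
  rw [div_le_iff₀ (by positivity), (even_two_mul q).pow_abs] at h
  rw [mul_comm ((2 * q).factorial : ℝ)]
  refine h.trans (mul_le_mul_of_nonneg_right ?_ (by positivity))
  rcases abs_cases x with ⟨hx, _⟩ | ⟨hx, _⟩ <;> rw [hx]
  · linarith [Real.exp_pos (-x)]
  · linarith [Real.exp_pos x]

lemma integrable_empDev_pow {f : Z → ℝ} {b : ℝ} (hn : 0 < n) (hf : Measurable f)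
    (hb : ∀ z, |f z| ≤ b) (k : ℕ) :
    Integrable (fun zs : Fin n → Z => empDev P f zs ^ k) (Measure.pi fun _ => P) := by
  refine Integrable.of_bound ((measurable_empDev hf).pow_const k).aestronglyMeasurable
    ((2 * b) ^ k) (ae_of_all _ fun zs => ?_)
  rw [norm_pow, Real.norm_eq_abs]
  exact pow_le_pow_left₀ (abs_nonneg _) (abs_empDev_le hn hb zs) k

/-- Even moments of the deviation of an empirical mean of a bounded function. -/
lemma integral_empDev_pow_le {f : Z → ℝ} {b : ℝ} (hn : 0 < n) (hb0 : 0 < b) (hf : Measurable f)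
    (hb : ∀ z, |f z| ≤ b) (q : ℕ) :
    ∫ zs : Fin n → Z, empDev P f zs ^ (2 * q) ∂(Measure.pi fun _ => P) ≤
      (2 * q).factorial * (2 * Real.exp (1 / 2)) * (b ^ 2 / n) ^ q := by
  have hn' : (0 : ℝ) < n := by exact_mod_cast hn
  have hint : ∀ s : ℝ, Integrable (fun zs : Fin n → Z => Real.exp (s * empDev P f zs))
      (Measure.pi fun _ => P) := by
    intro s
    refine Integrable.of_bound
      (((measurable_empDev hf).const_mul s).exp).aestronglyMeasurable
      (Real.exp (|s| * (2 * b))) (ae_of_all _ fun zs => ?_)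
    rw [Real.norm_eq_abs, Real.abs_exp, Real.exp_le_exp]
    refine (le_abs_self _).trans ?_
    rw [abs_mul]
    exact mul_le_mul_of_nonneg_left (abs_empDev_le hn hb zs) (abs_nonneg s)
  set s : ℝ := Real.sqrt n / b with hs
  have hs2 : s ^ 2 = n / b ^ 2 := by rw [hs, div_pow, Real.sq_sqrt hn'.le]
  have hexp : Real.exp (b ^ 2 * s ^ 2 / (2 * n)) = Real.exp (1 / 2) := by
    rw [hs2]
    congr 1
    field_simp
  have h1 := integral_exp_empDev_le (P := P) hn hf hb s
  have h2 := integral_exp_empDev_le (P := P) hn hf hb (-s)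
  rw [neg_sq, hexp] at h2
  rw [hexp] at h1
  have hpt : ∀ zs : Fin n → Z, empDev P f zs ^ (2 * q) ≤
      (b ^ 2 / n) ^ q * (2 * q).factorial *
        (Real.exp (s * empDev P f zs) + Real.exp (-s * empDev P f zs)) := by
    intro zs
    have h := pow_two_mul_le_exp_add_exp (s * empDev P f zs) q
    rw [mul_pow, pow_mul s, hs2, ← neg_mul] at h
    have h' := mul_le_mul_of_nonneg_left h (by positivity : 0 ≤ (b ^ 2 / (n : ℝ)) ^ q)
    rw [← mul_assoc, ← mul_pow, div_mul_div_cancel₀ hn'.ne', div_self (by positivity), one_pow,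
      one_mul, ← mul_assoc] at h'
    exact h'
  calc _ ≤ ∫ zs : Fin n → Z, (b ^ 2 / n) ^ q * (2 * q).factorial *
        (Real.exp (s * empDev P f zs) + Real.exp (-s * empDev P f zs))
          ∂(Measure.pi fun _ => P) :=
        integral_mono (integrable_empDev_pow hn hf hb _)
          (((hint s).add (hint (-s))).const_mul _) hpt
    _ = (b ^ 2 / n) ^ q * (2 * q).factorial *
        ((∫ zs : Fin n → Z, Real.exp (s * empDev P f zs) ∂(Measure.pi fun _ => P)) +
         ∫ zs : Fin n → Z, Real.exp (-s * empDev P f zs) ∂(Measure.pi fun _ => P)) := by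
        rw [integral_const_mul, integral_add (hint s) (hint (-s))]
    _ ≤ (b ^ 2 / n) ^ q * (2 * q).factorial * (2 * Real.exp (1 / 2)) := by
        gcongr
        linarith
    _ = _ := by ring

/-- A finite family of deviations of empirical means has its squares dominated by a single
integrable function, whose integral depends on the cardinality `N` only through `N ^ (1 / q)`. -/
lemma exists_sq_empDev_le {ι : Type*} (S : Finset ι) (f : ι → Z → ℝ) {b g : ℝ} {q : ℕ}
    (hn : 0 < n) (hb0 : 0 < b) (hg : 0 < g) (hf : ∀ s ∈ S, Measurable (f s))
    (hb : ∀ s ∈ S, ∀ z, |f s z| ≤ b) (hq : 1 ≤ q) (hS : (S.card : ℝ) ≤ g ^ q) :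
    ∃ F : (Fin n → Z) → ℝ, Integrable F (Measure.pi fun _ => P) ∧
      (∀ zs, 0 ≤ F zs) ∧ (∀ s ∈ S, ∀ zs, empDev P (f s) zs ^ 2 ≤ F zs) ∧
      ∫ zs, F zs ∂(Measure.pi fun _ => P) ≤
        (1 + (2 * q).factorial * (2 * Real.exp (1 / 2))) * (b ^ 2 / n * g) := by
  have hn' : (0 : ℝ) < n := by exact_mod_cast hn
  set K : ℝ := (2 * q).factorial * (2 * Real.exp (1 / 2)) with hK
  have hK0 : 0 ≤ K := by positivity
  set v : ℝ := b ^ 2 / n with hv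
  have hv0 : 0 < v := by positivity
  set a : ℝ := v * g with ha
  have ha0 : 0 < a := by positivity
  have hint : ∀ s ∈ S, Integrable (fun zs : Fin n → Z => empDev P (f s) zs ^ (2 * q))
      (Measure.pi fun _ => P) := fun s hs => integrable_empDev_pow hn (hf s hs) (hb s hs) _
  have hev : ∀ s (zs : Fin n → Z), 0 ≤ empDev P (f s) zs ^ (2 * q) :=
    fun s zs => (even_two_mul q).pow_nonneg _
  refine ⟨fun zs => a + a / a ^ q * ∑ s ∈ S, empDev P (f s) zs ^ (2 * q), ?_, ?_, ?_, ?_⟩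
  · exact (integrable_const a).add ((integrable_finsetSum _ hint).const_mul _)
  · intro zs
    have := Finset.sum_nonneg fun s (_ : s ∈ S) => hev s zs
    positivity
  · intro s hs zs
    have h1 : empDev P (f s) zs ^ (2 * q) ≤ ∑ s ∈ S, empDev P (f s) zs ^ (2 * q) :=
      Finset.single_le_sum (f := fun s => empDev P (f s) zs ^ (2 * q))
        (fun s _ => hev s zs) hs
    set y := empDev P (f s) zs ^ 2 with hy
    have hy0 : 0 ≤ y := sq_nonneg _
    have h2 : y / a ≤ 1 + (y / a) ^ q := by
      rcases le_total (y / a) 1 with h | h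
      · linarith [pow_nonneg (div_nonneg hy0 ha0.le) q]
      · linarith [le_self_pow₀ h (by omega : q ≠ 0)]
    calc y = a * (y / a) := by field_simp
      _ ≤ a * (1 + (y / a) ^ q) := by gcongr
      _ = a + a / a ^ q * empDev P (f s) zs ^ (2 * q) := by
          rw [pow_mul, ← hy, div_pow]
          ring
      _ ≤ a + a / a ^ q * ∑ s ∈ S, empDev P (f s) zs ^ (2 * q) := by gcongr
  · rw [integral_add (integrable_const a) ((integrable_finsetSum _ hint).const_mul _),
      integral_const_mul (a / a ^ q), integral_finsetSum _ hint]
    have h1 : ∑ s ∈ S, ∫ zs : Fin n → Z, empDev P (f s) zs ^ (2 * q) ∂(Measure.pi fun _ => P)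
        ≤ g ^ q * (K * v ^ q) := by
      refine (Finset.sum_le_sum fun s hs =>
        integral_empDev_pow_le hn hb0 (hf s hs) (hb s hs) q).trans ?_
      rw [Finset.sum_const, nsmul_eq_mul]
      gcongr
    have h2 : a / a ^ q * (g ^ q * (K * v ^ q)) = K * a := by
      rw [ha, mul_pow]
      field_simp
    have h3 := mul_le_mul_of_nonneg_left h1 (by positivity : 0 ≤ a / a ^ q)
    rw [h2] at h3
    simp only [integral_const, probReal_univ, one_smul]
    linarith

end EmpDev

/-- Grid projections: a bounded set of diameter `D` in `ℝ^d` is approximated at scale `h`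
by a set of at most `(3 (1 + D / h)) ^ d` points. -/
lemma exists_grid_projection {d : ℕ} {Ω : Set (EuclideanSpace ℝ (Fin d))}
    (hΩ : Bornology.IsBounded Ω) (hne : Ω.Nonempty) {h : ℝ} (hh : 0 < h) :
    ∃ (π : EuclideanSpace ℝ (Fin d) → EuclideanSpace ℝ (Fin d))
      (S : Finset (EuclideanSpace ℝ (Fin d))),
      (∀ ω ∈ Ω, π ω ∈ S) ∧ (∀ ω, ‖ω - π ω‖ ≤ (d + 1) * h) ∧
      (S.card : ℝ) ≤ (3 * (1 + Metric.diam Ω / h)) ^ d := by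
  classical
  obtain ⟨ω₀, hω₀⟩ := hne
  set D := Metric.diam Ω with hD
  have hD0 : 0 ≤ D := Metric.diam_nonneg
  let G : (Fin d → ℤ) → EuclideanSpace ℝ (Fin d) :=
    fun v => WithLp.toLp 2 fun i => ω₀ i + h * v i
  let c : ℤ := ⌈D / h⌉
  have hc0 : 0 ≤ c := Int.ceil_nonneg (by positivity)
  refine ⟨fun ω => G fun i => ⌊(ω i - ω₀ i) / h⌋,
    (Fintype.piFinset fun _ : Fin d => Finset.Icc (-c) c).image G, ?_, ?_, ?_⟩
  · intro ω hω
    refine Finset.mem_image_of_mem _ (Fintype.mem_piFinset.mpr fun i => ?_)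
    have h1 : |ω i - ω₀ i| ≤ D := by
      have h2 : |(ω - ω₀) i| ≤ ‖ω - ω₀‖ := by
        simpa using PiLp.norm_apply_le (ω - ω₀) i
      have h3 := Metric.dist_le_diam_of_mem hΩ hω hω₀
      rw [dist_eq_norm] at h3
      exact h2.trans h3
    have h4 : |(ω i - ω₀ i) / h| ≤ D / h := by
      rw [abs_div, abs_of_pos hh]
      gcongr
    obtain ⟨h5, h6⟩ := abs_le.mp h4
    have h7 : D / h ≤ c := Int.le_ceil _
    rw [Finset.mem_Icc]
    constructor
    · rw [Int.le_floor]
      push_cast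
      linarith
    · have h8 : ((⌊(ω i - ω₀ i) / h⌋ : ℤ) : ℝ) ≤ c := (Int.floor_le _).trans (h6.trans h7)
      exact Int.cast_le.mp h8
  · intro ω
    have hcoord : ∀ i, |(ω - G fun i => ⌊(ω i - ω₀ i) / h⌋) i| ≤ h := by
      intro i
      have h1 : (ω - G fun i => ⌊(ω i - ω₀ i) / h⌋) i =
          h * Int.fract ((ω i - ω₀ i) / h) := by
        have : Int.fract ((ω i - ω₀ i) / h) = (ω i - ω₀ i) / h - ⌊(ω i - ω₀ i) / h⌋ := rfl
        rw [this]
        simp only [G, PiLp.sub_apply]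
        field_simp
        ring
      rw [h1, abs_of_nonneg (mul_nonneg hh.le (Int.fract_nonneg _))]
      nlinarith [Int.fract_lt_one ((ω i - ω₀ i) / h)]
    rw [EuclideanSpace.norm_eq]
    refine Real.sqrt_le_iff.mpr ⟨by positivity, ?_⟩
    calc _ ≤ ∑ _i : Fin d, h ^ 2 := Finset.sum_le_sum fun i _ => by
            rw [Real.norm_eq_abs]
            exact pow_le_pow_left₀ (abs_nonneg _) (hcoord i) 2
      _ = d * h ^ 2 := by simp
      _ ≤ ((d + 1) * h) ^ 2 := by
          rw [mul_pow]
          gcongr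
          nlinarith [(Nat.cast_nonneg d : (0 : ℝ) ≤ d)]
  · have h1 : ((Fintype.piFinset fun _ : Fin d => Finset.Icc (-c) c).card : ℝ)
        = ((2 * c + 1 : ℤ) : ℝ) ^ d := by
      rw [Fintype.card_piFinset]
      simp only [Int.card_Icc, Finset.prod_const, Finset.card_univ, Fintype.card_fin]
      push_cast
      congr 1
      have : (((c + 1 - -c).toNat : ℤ) : ℝ) = ((c + 1 - -c : ℤ) : ℝ) := by
        rw [Int.toNat_of_nonneg (by omega)]
      rw [Int.cast_natCast] at this
      rw [this]
      push_cast
      ring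
    refine (Nat.cast_le.mpr Finset.card_image_le).trans ?_
    rw [h1]
    have h2 : (c : ℝ) < D / h + 1 := Int.ceil_lt_add_one _
    have h3 : (0 : ℝ) ≤ c := by exact_mod_cast hc0
    push_cast
    have h4 : 0 ≤ D / h := by positivity
    refine pow_le_pow_left₀ (by positivity) ?_ _
    linarith

/-- The constant in the chaining bound for the second moment of the supremum. -/
noncomputable def chainingConst (d : ℕ) : ℝ :=
  96 * (d + 1) ^ 2 * (1 + (2 * (2 * d + 1)).factorial * (2 * Real.exp (1 / 2)))

lemma le_chainingConst (d : ℕ) : 96 * ((d : ℝ) + 1) ^ 2 ≤ chainingConst d := by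
  unfold chainingConst
  have : 0 ≤ ((2 * (2 * d + 1)).factorial : ℝ) * (2 * Real.exp (1 / 2)) := by positivity
  nlinarith [sq_nonneg ((d : ℝ) + 1)]

/-- Chaining: the squared deviations of the empirical means of a bounded Lipschitz family over a
bounded set are dominated by an integrable function with integral of order `1 / n`. -/
theorem exists_sq_empDev_le_of_lipschitz {d : ℕ} {Ω : Set (EuclideanSpace ℝ (Fin d))}
    (hΩ : Bornology.IsBounded Ω) (hne : Ω.Nonempty) {Z : Type*} [MeasurableSpace Z]
    {t : EuclideanSpace ℝ (Fin d) → Z → ℝ} {M L : ℝ} (hM : 0 < M) (hL : 0 < L)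
    (htM : ∀ ω z, |t ω z| ≤ M) (htm : ∀ ω, Measurable (t ω))
    (htL : ∀ (z : Z) (ω ω' : EuclideanSpace ℝ (Fin d)), |t ω z - t ω' z| ≤ L * ‖ω - ω'‖)
    {P : Measure Z} [IsProbabilityMeasure P] {n : ℕ} (hn : 0 < n) :
    ∃ F : (Fin n → Z) → ℝ, Integrable F (Measure.pi fun _ => P) ∧
      (∀ ω ∈ Ω, ∀ zs, empDev P (t ω) zs ^ 2 ≤ F zs) ∧
      ∫ zs, F zs ∂(Measure.pi fun _ => P) ≤
        18 * chainingConst d * (max (M * L * Metric.diam Ω) (M ^ 2) / n) := by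
  classical
  set D := Metric.diam Ω with hD
  have hD0 : 0 ≤ D := Metric.diam_nonneg
  have hn' : (0 : ℝ) < n := by exact_mod_cast hn
  set Q : ℝ := max (M * L * D) (M ^ 2) with hQ
  have hQ1 : M * L * D ≤ Q := le_max_left _ _
  have hQ2 : M ^ 2 ≤ Q := le_max_right _ _
  set ρ : ℝ := Q / M ^ 2 with hρ
  have hM2 : 0 < M ^ 2 := by positivity
  have hρ1 : 1 ≤ ρ := (one_le_div hM2).mpr hQ2
  have hQρ : Q = M ^ 2 * ρ := by rw [hρ]; field_simp
  set K : ℝ := 1 + (2 * (2 * d + 1)).factorial * (2 * Real.exp (1 / 2)) with hK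
  have hK0 : 0 ≤ K := by positivity
  have hC : chainingConst d = 96 * (d + 1) ^ 2 * K := rfl
  let h : ℕ → ℝ := fun k => M / L / 4 ^ k
  have hh : ∀ k, 0 < h k := fun k => by positivity
  choose π S hπS hπ hcard using fun k => exists_grid_projection hΩ hne (hh k)
  have hcard' : ∀ k, ((S k).card : ℝ) ≤ (6 * 4 ^ k * ρ) ^ d := by
    intro k
    refine (hcard k).trans (pow_le_pow_left₀ (by positivity) ?_ _)
    have h1 : D / h k ≤ 4 ^ k * ρ := by
      have : D / h k = 4 ^ k * (M * L * D / M ^ 2) := by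
        simp only [h]
        field_simp
      rw [this]
      exact mul_le_mul_of_nonneg_left (div_le_div_of_nonneg_right hQ1 hM2.le) (by positivity)
    have h2 : 1 ≤ 4 ^ k * ρ := one_le_mul_of_one_le_of_one_le (one_le_pow₀ (by norm_num)) hρ1
    change 3 * (1 + D / h k) ≤ _
    linarith
  obtain ⟨F₀, hF₀i, hF₀n, hF₀, hF₀I⟩ := exists_sq_empDev_le (P := P) (n := n) (S 0) t
    (b := M) (g := 24 * ρ) (q := 2 * d + 1) hn hM (by positivity) (fun s _ => htm s)
    (fun s _ => htM s) (by omega) (by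
      refine (hcard' 0).trans ?_
      calc (6 * 4 ^ 0 * ρ) ^ d ≤ (24 * ρ) ^ d := by gcongr; norm_num
        _ ≤ (24 * ρ) ^ (2 * d + 1) := pow_le_pow_right₀ (by linarith) (by omega))
  let T : ℕ → Finset (EuclideanSpace ℝ (Fin d) × EuclideanSpace ℝ (Fin d)) := fun k =>
    (S k ×ˢ S (k + 1)).filter fun x => ‖x.2 - x.1‖ ≤ 2 * (d + 1) * h k
  have hlink : ∀ k, ∃ F : (Fin n → Z) → ℝ, Integrable F (Measure.pi fun _ => P) ∧
      (∀ zs, 0 ≤ F zs) ∧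
      (∀ x ∈ T k, ∀ zs, empDev P (fun z => t x.2 z - t x.1 z) zs ^ 2 ≤ F zs) ∧
      ∫ zs, F zs ∂(Measure.pi fun _ => P) ≤
        K * ((2 * (d + 1) * (M / 4 ^ k)) ^ 2 / n * (24 * 4 ^ k * ρ)) := by
    intro k
    refine exists_sq_empDev_le (T k) (fun x z => t x.2 z - t x.1 z) hn (by positivity)
      (by positivity) (fun x _ => (htm _).sub (htm _)) ?_ (by omega) ?_
    · intro x hx z
      have h1 := (Finset.mem_filter.mp hx).2
      refine (htL z _ _).trans ((mul_le_mul_of_nonneg_left h1 hL.le).trans (le_of_eq ?_))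
      simp only [h]
      field_simp
    · have h1 : ((T k).card : ℝ) ≤ (S k).card * (S (k + 1)).card := by
        rw [← Nat.cast_mul, ← Finset.card_product]
        exact_mod_cast Finset.card_filter_le _ _
      have h4 : (1 : ℝ) ≤ 4 ^ k := one_le_pow₀ (by norm_num)
      have h5 : 1 ≤ 24 * 4 ^ k * ρ := by nlinarith
      calc ((T k).card : ℝ) ≤ (6 * 4 ^ k * ρ) ^ d * (6 * 4 ^ (k + 1) * ρ) ^ d :=
            h1.trans (mul_le_mul (hcard' k) (hcard' (k + 1)) (Nat.cast_nonneg _) (by positivity))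
        _ ≤ (24 * 4 ^ k * ρ) ^ d * (24 * 4 ^ k * ρ) ^ d := by
            gcongr ?_ ^ d * ?_ ^ d
            · gcongr; norm_num
            · rw [pow_succ]; linarith
        _ = (24 * 4 ^ k * ρ) ^ (2 * d) := by rw [two_mul, pow_add]
        _ ≤ (24 * 4 ^ k * ρ) ^ (2 * d + 1) := pow_le_pow_right₀ h5 (by omega)
  choose F hFi hFn hF hFI using hlink
  set e : ℝ := 2 * (L * ((d + 1) * h n)) with he
  have hsumi : Integrable (fun zs => ∑ k ∈ Finset.range n, 2 ^ k * F k zs)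
      (Measure.pi fun _ => P) := integrable_finsetSum _ fun k _ => (hFi k).const_mul _
  have hti : ∀ ω, Integrable (t ω) P := fun ω => integrable_of_abs_le (htm ω) (htM ω)
  have hgeom : ∑ k ∈ Finset.range n, (1 / 2 : ℝ) ^ k ≤ 2 := sum_geometric_two_le n
  refine ⟨fun zs => 3 * ((F₀ zs + e ^ 2) + 2 * ∑ k ∈ Finset.range n, 2 ^ k * F k zs), ?_, ?_, ?_⟩
  · exact ((hF₀i.add (integrable_const _)).add (hsumi.const_mul 2)).const_mul 3
  · intro ω hω zs
    set X : ℕ → ℝ := fun k => empDev P (t (π k ω)) zs with hX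
    have h0 : X 0 ^ 2 ≤ F₀ zs := hF₀ _ (hπS 0 ω hω) zs
    have hE : (empDev P (t ω) zs - X n) ^ 2 ≤ e ^ 2 := by
      rw [hX, empDev_sub (hti _) (hti _)]
      refine sq_le_sq' (abs_le.mp ?_).1 (abs_le.mp ?_).2 <;>
      exact abs_empDev_le hn (fun z => (htL z _ _).trans
        (mul_le_mul_of_nonneg_left (hπ n ω) hL.le)) zs
    have hS : (∑ k ∈ Finset.range n, (X (k + 1) - X k)) ^ 2 ≤
        2 * ∑ k ∈ Finset.range n, 2 ^ k * F k zs := by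
      have hpos : 0 ≤ ∑ k ∈ Finset.range n, 2 ^ k * F k zs :=
        Finset.sum_nonneg fun k _ => mul_nonneg (by positivity) (hFn k zs)
      refine (Finset.sum_sq_le_sum_mul_sum_of_sq_le_mul (Finset.range n)
        (f := fun k => (1 / 2 : ℝ) ^ k) (g := fun k => 2 ^ k * F k zs)
        (fun k _ => by positivity) (fun k _ => mul_nonneg (by positivity) (hFn k zs))
        fun k _ => ?_).trans (mul_le_mul_of_nonneg_right hgeom hpos)
      rw [← mul_assoc, ← mul_pow, one_div_mul_cancel two_ne_zero, one_pow, one_mul]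
      rw [hX]
      simp only
      rw [empDev_sub (hti _) (hti _)]
      refine hF k (π k ω, π (k + 1) ω) (Finset.mem_filter.mpr
        ⟨Finset.mem_product.mpr ⟨hπS k ω hω, hπS (k + 1) ω hω⟩, ?_⟩) zs
      have h1 := hπ k ω
      have h2 := hπ (k + 1) ω
      have h3 : h (k + 1) ≤ h k := by
        simp only [h]
        gcongr <;> norm_num
      have h4 : ((d : ℝ) + 1) * h (k + 1) ≤ (d + 1) * h k := by gcongr
      calc ‖π (k + 1) ω - π k ω‖ = ‖(ω - π k ω) - (ω - π (k + 1) ω)‖ := by congr 1; abel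
        _ ≤ ‖ω - π k ω‖ + ‖ω - π (k + 1) ω‖ := norm_sub_le _ _
        _ ≤ 2 * (d + 1) * h k := by linarith
    rw [Finset.sum_range_sub] at hS
    have hdec : empDev P (t ω) zs = X 0 + (empDev P (t ω) zs - X n) + (X n - X 0) := by ring
    rw [hdec]
    have h3 : ∀ x y z : ℝ, (x + y + z) ^ 2 ≤ 3 * ((x ^ 2 + y ^ 2) + z ^ 2) := fun x y z => by
      nlinarith [sq_nonneg (x - y), sq_nonneg (x - z), sq_nonneg (y - z)]
    refine (h3 _ _ _).trans ?_
    dsimp only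
    linarith
  · set A : ℝ := chainingConst d * (Q / n) with hA
    have hA' : A = 96 * (d + 1) ^ 2 * K * (M ^ 2 * ρ / n) := by rw [hA, hC, hQρ]
    have hd1 : (1 : ℝ) ≤ (d + 1) ^ 2 := one_le_pow₀ (by linarith [(Nat.cast_nonneg d : (0 : ℝ) ≤ d)])
    have hB : ∫ zs, F₀ zs ∂(Measure.pi fun _ => P) ≤ A := by
      refine hF₀I.trans ?_
      rw [hA']
      have : 0 ≤ K * (M ^ 2 * ρ / n) := by positivity
      calc K * (M ^ 2 / n * (24 * ρ)) = 24 * (K * (M ^ 2 * ρ / n)) := by ring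
        _ ≤ (96 * (d + 1) ^ 2) * (K * (M ^ 2 * ρ / n)) := by gcongr; linarith
        _ = _ := by ring
    have hE : e ^ 2 ≤ A := by
      have h1 : e ^ 2 = 4 * (d + 1) ^ 2 * (M ^ 2 / 16 ^ n) := by
        have : (16 : ℝ) ^ n = (4 ^ n) ^ 2 := by rw [← pow_mul, mul_comm, pow_mul]; norm_num
        rw [he, this]
        simp only [h]
        field_simp
        norm_num
      have h2 : (n : ℝ) ≤ 16 ^ n := by
        exact_mod_cast (Nat.lt_pow_self (by norm_num : 1 < 16)).le
      rw [h1, hA]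
      have h3 := le_chainingConst d
      refine mul_le_mul (by linarith) ?_ (by positivity) (by linarith)
      exact div_le_div₀ (by positivity) hQ2 hn' h2
    have hS : ∫ zs, ∑ k ∈ Finset.range n, 2 ^ k * F k zs ∂(Measure.pi fun _ => P) ≤ 2 * A := by
      rw [integral_finsetSum _ fun k _ => (hFi k).const_mul _]
      have hA0 : 0 ≤ A := by rw [hA']; positivity
      refine le_trans (Finset.sum_le_sum fun k _ => ?_)
        ((Finset.sum_mul _ _ A).symm.le.trans (mul_le_mul_of_nonneg_right hgeom hA0))
      rw [integral_const_mul]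
      refine (mul_le_mul_of_nonneg_left (hFI k) (by positivity)).trans (le_of_eq ?_)
      rw [hA', one_div, inv_pow]
      have : (4 : ℝ) ^ k = (2 ^ k) ^ 2 := by rw [← pow_mul, mul_comm, pow_mul]; norm_num
      rw [this]
      field_simp
      ring
    rw [integral_const_mul,
      integral_add (f := fun zs => F₀ zs + e ^ 2) (hF₀i.add (integrable_const _))
        (hsumi.const_mul 2),
      integral_add hF₀i (integrable_const _), integral_const_mul, integral_const, probReal_univ,
      one_smul]
    linarith

/-- Let `Ω ⊆ ℝ^d` be compact.  There exists a constant `c(Ω) ≥ 1`,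
depending only on `Ω` and `d`, such that for every measurable space `Z`, every
parametric family `t : Ω × Z → ℝ` of measurable functions uniformly bounded by `M > 0`
with `ω ↦ t_ω(z)` `L`-Lipschitz for every `z`, every probability measure `𝔻` on `Z`,
every sample size `n ≥ 1` and every `p ∈ {1, 2}`:
`E[sup_{ω∈Ω} |E_𝔻[t_ω] − (1/n)Σᵢ t_ω(zᵢ)|^p]^{1/p}
  ≤ (1/√n) c(Ω) max(M L diam(Ω), M²)^{1/2}`,
the expectation being over i.i.d. samples `z₁, …, z_n ∼ 𝔻` (the product measure). -/
theorem stmt_12 {d : ℕ} (Ω : Set (EuclideanSpace ℝ (Fin d))) (hΩ : IsCompact Ω) :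
    ∃ c : ℝ, 1 ≤ c ∧
      ∀ (Z : Type) (_ : MeasurableSpace Z)
        (t : EuclideanSpace ℝ (Fin d) → Z → ℝ) (M L : ℝ),
        0 < M → 0 < L →
        (∀ ω z, |t ω z| ≤ M) →
        (∀ ω, Measurable (t ω)) →
        (∀ (z : Z) (ω ω' : EuclideanSpace ℝ (Fin d)), |t ω z - t ω' z| ≤ L * ‖ω - ω'‖) →
        ∀ (𝔻 : Measure Z), IsProbabilityMeasure 𝔻 →
        ∀ (n : ℕ), 0 < n →
        ∀ p : ℝ, (p = 1 ∨ p = 2) →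
        (∫ zs : Fin n → Z,
            (⨆ ω : Ω, |(∫ z, t ω z ∂𝔻) - (1 / (n : ℝ)) * ∑ i, t ω (zs i)| ^ p)
            ∂(Measure.pi fun _ : Fin n => 𝔻)) ^ (1 / p) ≤
          (1 / Real.sqrt n) * c * Real.sqrt (max (M * L * Metric.diam Ω) (M ^ 2)) := by
  set C : ℝ := 18 * chainingConst d with hC
  have hC1 : 1 ≤ C := by
    have h1 := le_chainingConst d
    have h2 : (1 : ℝ) ≤ (d + 1) ^ 2 :=
      one_le_pow₀ (by linarith [(Nat.cast_nonneg d : (0 : ℝ) ≤ d)])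
    linarith
  refine ⟨Real.sqrt C, Real.one_le_sqrt.mpr hC1, ?_⟩
  intro Z _ t M L hM hL htM htm htL 𝔻 _ n hn p hp
  have hp0 : 0 < p := by rcases hp with rfl | rfl <;> norm_num
  have hn' : (0 : ℝ) < n := by exact_mod_cast hn
  set Q : ℝ := max (M * L * Metric.diam Ω) (M ^ 2) with hQ
  have hQ0 : 0 < Q := lt_of_lt_of_le (by positivity) (le_max_right _ _)
  rcases Ω.eq_empty_or_nonempty with hem | hne
  · have : IsEmpty Ω := Set.isEmpty_coe_sort.mpr hem
    simp only [Real.iSup_of_isEmpty, integral_zero]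
    rw [Real.zero_rpow (by positivity)]
    positivity
  have : Nonempty Ω := hne.to_subtype
  obtain ⟨F, hFi, hF, hFI⟩ :=
    exists_sq_empDev_le_of_lipschitz hΩ.isBounded hne hM hL htM htm htL (P := 𝔻) hn
  change ∫ zs, F zs ∂(Measure.pi fun _ => 𝔻) ≤ C * (Q / n) at hFI
  set β : ℝ := (1 / Real.sqrt n) * Real.sqrt C * Real.sqrt Q with hβ
  have hβ0 : 0 < β := by positivity
  have hβ2 : β ^ 2 = C * (Q / n) := by
    rw [hβ, mul_pow, mul_pow, div_pow, Real.sq_sqrt hn'.le, Real.sq_sqrt (by linarith),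
      Real.sq_sqrt hQ0.le]
    ring
  rw [← hβ2] at hFI
  have hnn : ∀ zs : Fin n → Z,
      0 ≤ ⨆ ω : Ω, |(∫ z, t ω z ∂𝔻) - (1 / (n : ℝ)) * ∑ i, t ω (zs i)| ^ p :=
    fun zs => Real.iSup_nonneg fun ω => Real.rpow_nonneg (abs_nonneg _) _
  rcases hp with rfl | rfl
  · rw [one_div_one, Real.rpow_one]
    calc _ ≤ ∫ zs, (β / 2 + 1 / (2 * β) * F zs) ∂(Measure.pi fun _ => 𝔻) := by
          refine integral_mono_of_nonneg (ae_of_all _ hnn)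
            ((integrable_const _).add (hFi.const_mul _)) (ae_of_all _ fun zs => ?_)
          refine ciSup_le fun ω => ?_
          rw [Real.rpow_one]
          have h1 := hF ω ω.2 zs
          change |empDev 𝔻 (t ω) zs| ≤ _
          rw [← sq_abs] at h1
          set y := |empDev 𝔻 (t ω) zs|
          calc y ≤ β / 2 + 1 / (2 * β) * y ^ 2 := by
                have : β / 2 + 1 / (2 * β) * y ^ 2 - y = (y - β) ^ 2 / (2 * β) := by
                  field_simp
                  ring
                have h2 : 0 ≤ (y - β) ^ 2 / (2 * β) := by positivity
                linarith
            _ ≤ β / 2 + 1 / (2 * β) * F zs := by gcongr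
      _ = β / 2 + 1 / (2 * β) * ∫ zs, F zs ∂(Measure.pi fun _ => 𝔻) := by
          rw [integral_add (integrable_const _) (hFi.const_mul _), integral_const_mul,
            integral_const, probReal_univ, one_smul]
      _ ≤ β / 2 + 1 / (2 * β) * β ^ 2 := by gcongr
      _ = β := by field_simp; norm_num
  · rw [← Real.sqrt_eq_rpow, Real.sqrt_le_left hβ0.le]
    refine le_trans (integral_mono_of_nonneg (ae_of_all _ hnn) hFi (ae_of_all _ fun zs => ?_)) hFI
    refine ciSup_le fun ω => ?_
    rw [Real.rpow_two, sq_abs]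
    exact hF ω ω.2 zs
end
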